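/- Let S ⊆ Sym TT_n be finite. Then T_S^tr is archimedean if and only if K_S is a compact subset of (M_n(ℝ))^g (with its Euclidean topology). -/

import Mathlib

noncomputable section

open Matrix

/-- The polynomial ring ℝ[ξ] in the g·n² commuting variables ξ_{jıȷ}. -/
abbrev PolyRing (n g : ℕ) : Type := MvPolynomial (Fin g × Fin n × Fin n) ℝ

/-- n×n matrices over ℝ[ξ]. -/
abbrev MatP (n g : ℕ) : Type := Matrix (Fin n) (Fin n) (PolyRing n g)

/-- The generic matrices Ξ_j = (ξ_{jıȷ})_{ıȷ}. -/
def genMat (n g : ℕ) (j : Fin g) : MatP n g :=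
  Matrix.of fun a b => MvPolynomial.X (j, a, b)

/-- The set of generic matrices together with their transposes. -/
def genSet (n g : ℕ) : Set (MatP n g) :=
  Set.range (genMat n g) ∪ Set.range (fun j => (genMat n g j)ᵀ)

/-- The trace ring TT_n: the ℝ-subalgebra of M_n(ℝ[ξ]) generated by the Ξ_j, their
transposes, and the scalar matrices tr(w)·1 for all products w of the Ξ_j, Ξ_jᵀ. -/
def traceRing (n g : ℕ) : Subalgebra ℝ (MatP n g) :=
  Algebra.adjoin ℝ
    (genSet n g ∪
      {m | ∃ w ∈ Submonoid.closure (genSet n g), m = (Matrix.trace w) • (1 : MatP n g)})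

/-- The center C_n of the trace ring: the scalar matrices in TT_n. -/
def centerSet (n g : ℕ) : Set (MatP n g) :=
  {c | c ∈ traceRing n g ∧ ∃ p : PolyRing n g, c = p • (1 : MatP n g)}

/-- Evaluation of a matrix of polynomials at a g-tuple X of n×n real matrices. -/
def evalMat (n g : ℕ) (X : Fin g → Matrix (Fin n) (Fin n) ℝ) (h : MatP n g) :
    Matrix (Fin n) (Fin n) ℝ :=
  h.map (MvPolynomial.eval fun v => X v.1 v.2.1 v.2.2)

/-- The semialgebraic set K_S determined by S. -/
def KSet (n g : ℕ) (S : Set (MatP n g)) : Set (Fin g → Matrix (Fin n) (Fin n) ℝ) :=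
  {X | ∀ s ∈ S, (evalMat n g X s).PosSemidef}

/-- Cyclic quadratic module in Sym TT_n. -/
def IsCyclicQM (n g : ℕ) (Q : Set (MatP n g)) : Prop :=
  (∀ q ∈ Q, q ∈ traceRing n g ∧ qᵀ = q) ∧
  (1 : MatP n g) ∈ Q ∧
  (∀ a ∈ Q, ∀ b ∈ Q, a + b ∈ Q) ∧
  (∀ h ∈ traceRing n g, ∀ q ∈ Q, h * q * hᵀ ∈ Q) ∧
  (∀ q ∈ Q, (Matrix.trace q) • (1 : MatP n g) ∈ Q)

/-- Cyclic preordering: a cyclic quadratic module whose intersection with the center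
is closed under multiplication. -/
def IsCyclicPreordering (n g : ℕ) (T : Set (MatP n g)) : Prop :=
  IsCyclicQM n g T ∧
  ∀ a ∈ T ∩ centerSet n g, ∀ b ∈ T ∩ centerSet n g, a * b ∈ T

/-- The smallest cyclic preordering T_S^tr containing S. -/
def TtrS (n g : ℕ) (S : Set (MatP n g)) : Set (MatP n g) :=
  {a | ∀ T : Set (MatP n g), IsCyclicPreordering n g T → S ⊆ T → a ∈ T}

section
open Matrix

/-- A proper preordering of a commutative ring. -/
structure IsPreordering {A : Type*} [CommRing A] (T : Set A) : Prop where
  add_mem : ∀ a ∈ T, ∀ b ∈ T, a + b ∈ T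
  mul_mem : ∀ a ∈ T, ∀ b ∈ T, a * b ∈ T
  sq_mem : ∀ a, a * a ∈ T
  neg_one_notMem : (-1 : A) ∉ T

namespace IsPreordering

variable {A : Type*} [CommRing A] {T : Set A}

theorem zero_mem (h : IsPreordering T) : (0 : A) ∈ T := by simpa using h.sq_mem 0

theorem one_mem (h : IsPreordering T) : (1 : A) ∈ T := by simpa using h.sq_mem 1

theorem exists_maximal (h : IsPreordering T) :
    ∃ P, T ⊆ P ∧ Maximal (fun P : Set A => IsPreordering P) P := by
  refine zorn_subset_nonempty {P : Set A | IsPreordering P} ?_ T h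
  intro c hc hchain hne
  obtain ⟨P0, hP0⟩ := hne
  refine ⟨⋃₀ c, ⟨?_, ?_, ?_, ?_⟩, fun s hs => Set.subset_sUnion_of_mem hs⟩
  · rintro a ⟨P, hP, ha⟩ b ⟨Q, hQ, hb⟩
    rcases hchain.total hP hQ with hPQ | hPQ
    · exact ⟨Q, hQ, (hc hQ).add_mem _ (hPQ ha) _ hb⟩
    · exact ⟨P, hP, (hc hP).add_mem _ ha _ (hPQ hb)⟩
  · rintro a ⟨P, hP, ha⟩ b ⟨Q, hQ, hb⟩
    rcases hchain.total hP hQ with hPQ | hPQ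
    · exact ⟨Q, hQ, (hc hQ).mul_mem _ (hPQ ha) _ hb⟩
    · exact ⟨P, hP, (hc hP).mul_mem _ ha _ (hPQ hb)⟩
  · exact fun a => ⟨P0, hP0, (hc hP0).sq_mem a⟩
  · rintro ⟨P, hP, h1⟩
    exact (hc hP).neg_one_notMem h1

/-- A preordering stays closed under the operations after adjoining an element. -/
theorem adjoin_mem_iff (h : IsPreordering T) (x : A)
    (hx : (-1 : A) ∉ {y | ∃ a ∈ T, ∃ b ∈ T, y = a + x * b}) :
    IsPreordering {y | ∃ a ∈ T, ∃ b ∈ T, y = a + x * b} where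
  add_mem := by
    rintro _ ⟨a, ha, b, hb, rfl⟩ _ ⟨c, hc, d, hd, rfl⟩
    exact ⟨a + c, h.add_mem _ ha _ hc, b + d, h.add_mem _ hb _ hd, by ring⟩
  mul_mem := by
    rintro _ ⟨a, ha, b, hb, rfl⟩ _ ⟨c, hc, d, hd, rfl⟩
    refine ⟨a * c + x * x * (b * d), h.add_mem _ (h.mul_mem _ ha _ hc) _
      (h.mul_mem _ (h.sq_mem x) _ (h.mul_mem _ hb _ hd)), a * d + b * c,
      h.add_mem _ (h.mul_mem _ ha _ hd) _ (h.mul_mem _ hb _ hc), by ring⟩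
  sq_mem := fun a => ⟨a * a, h.sq_mem a, 0, h.zero_mem, by ring⟩
  neg_one_notMem := hx

theorem exists_of_maximal (h : Maximal (fun P : Set A => IsPreordering P) T) {x : A}
    (hx : x ∉ T) : ∃ a ∈ T, ∃ b ∈ T, (-1 : A) = a + x * b := by
  by_contra hcon
  have h1 := adjoin_mem_iff h.prop x hcon
  refine hx (h.le_of_ge h1 ?_ ⟨0, h.prop.zero_mem, 1, h.prop.one_mem, by ring⟩)
  exact fun a ha => ⟨a, ha, 0, h.prop.zero_mem, by ring⟩

theorem total_of_maximal (h : Maximal (fun P : Set A => IsPreordering P) T) (x : A) :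
    x ∈ T ∨ -x ∈ T := by
  by_contra! hcon
  obtain ⟨a, ha, b, hb, hab⟩ := exists_of_maximal h hcon.1
  obtain ⟨c, hc, d, hd, hcd⟩ := exists_of_maximal h hcon.2
  have hT := h.prop
  apply hT.neg_one_notMem
  have : (-1 : A) = a + c + a * c + x * x * (b * d) := by
    have h1 : x * b = -1 - a := by rw [hab]; ring
    have h2 : x * d = 1 + c := by linear_combination hcd
    linear_combination -(x * d) * h1 + (1 + a) * h2
  rw [this]
  exact hT.add_mem _ (hT.add_mem _ (hT.add_mem _ ha _ hc) _ (hT.mul_mem _ ha _ hc)) _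
    (hT.mul_mem _ (hT.sq_mem x) _ (hT.mul_mem _ hb _ hd))

theorem prime_of_maximal (h : Maximal (fun P : Set A => IsPreordering P) T) {x y : A}
    (h1 : x * y ∈ T) (h2 : -(x * y) ∈ T) : (x ∈ T ∧ -x ∈ T) ∨ (y ∈ T ∧ -y ∈ T) := by
  have hT := h.prop
  have key : ∀ u v : A, u ∉ T → v ∉ T → u * v ∈ T → -(u * v) ∈ T → False := by
    intro u v hu hv huv huv'
    obtain ⟨a, ha, b, hb, hab⟩ := exists_of_maximal h hu
    obtain ⟨c, hc, d, hd, hcd⟩ := exists_of_maximal h hv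
    apply hT.neg_one_notMem
    have : (-1 : A) = a + c + a * c + (-(u * v)) * (b * d) := by
      have h1 : u * b = -1 - a := by rw [hab]; ring
      have h2 : v * d = -1 - c := by rw [hcd]; ring
      linear_combination (v * d) * h1 - (1 + a) * h2
    rw [this]
    exact hT.add_mem _ (hT.add_mem _ (hT.add_mem _ ha _ hc) _ (hT.mul_mem _ ha _ hc)) _
      (hT.mul_mem _ huv' _ (hT.mul_mem _ hb _ hd))
  by_contra! hcon
  by_cases hx : x ∈ T
  · have hx' := hcon.1 hx
    by_cases hy : y ∈ T
    · exact key (-x) (-y) hx' (hcon.2 hy) (by simpa using h1) (by simpa using h2)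
    · exact key (-x) y hx' hy (by simpa using h2) (by simpa using h1)
  · by_cases hy : y ∈ T
    · exact key x (-y) hx (hcon.2 hy) (by simpa using h2) (by simpa using h1)
    · exact key x y hx hy h1 h2

/-- The support of a maximal preordering. -/
def support (h : Maximal (fun P : Set A => IsPreordering P) T) : Ideal A where
  carrier := {x | x ∈ T ∧ -x ∈ T}
  zero_mem' := ⟨h.prop.zero_mem, by simpa using h.prop.zero_mem⟩
  add_mem' := by
    rintro a b ⟨h1, h2⟩ ⟨h3, h4⟩
    exact ⟨h.prop.add_mem _ h1 _ h3, by rw [neg_add]; exact h.prop.add_mem _ h2 _ h4⟩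
  smul_mem' := by
    rintro c x ⟨h1, h2⟩
    rcases total_of_maximal h c with hc | hc
    · exact ⟨h.prop.mul_mem _ hc _ h1, by
        have := h.prop.mul_mem _ hc _ h2; simpa using this⟩
    · exact ⟨by have := h.prop.mul_mem _ hc _ h2; simpa using this, by
        have := h.prop.mul_mem _ hc _ h1; simpa using this⟩

theorem support_isPrime (h : Maximal (fun P : Set A => IsPreordering P) T) :
    (support h).IsPrime := by
  refine ⟨?_, fun {x y} hxy => prime_of_maximal h hxy.1 hxy.2⟩
  intro htop
  have : (1 : A) ∈ support h := by rw [htop]; trivial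
  exact h.prop.neg_one_notMem this.2

end IsPreordering

/-- The nonnegative part of an ordered subring of a field. -/
structure IsOrdPart {K : Type*} [Field K] (P : Set K) : Prop where
  add_mem : ∀ a ∈ P, ∀ b ∈ P, a + b ∈ P
  mul_mem : ∀ a ∈ P, ∀ b ∈ P, a * b ∈ P
  one_mem : (1 : K) ∈ P
  pointed : ∀ a ∈ P, -a ∈ P → a = 0
  diff : ∀ a ∈ P, ∀ b ∈ P, a - b ∈ P ∨ b - a ∈ P

namespace IsPreordering

variable {A : Type*} [CommRing A] {T : Set A}

theorem isOrdPart_image (h : Maximal (fun P : Set A => IsPreordering P) T)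
    {K : Type*} [Field K] (f : A →+* K) (hf : ∀ x, f x = 0 ↔ x ∈ T ∧ -x ∈ T) :
    IsOrdPart (f '' T) where
  add_mem := by
    rintro _ ⟨a, ha, rfl⟩ _ ⟨b, hb, rfl⟩
    exact ⟨a + b, h.prop.add_mem _ ha _ hb, map_add _ _ _⟩
  mul_mem := by
    rintro _ ⟨a, ha, rfl⟩ _ ⟨b, hb, rfl⟩
    exact ⟨a * b, h.prop.mul_mem _ ha _ hb, map_mul _ _ _⟩
  one_mem := ⟨1, h.prop.one_mem, map_one _⟩
  pointed := by
    rintro _ ⟨a, ha, rfl⟩ ⟨b, hb, hab⟩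
    have h1 : f (a + b) = 0 := by rw [map_add, hab]; ring
    have hna : -a ∈ T := by
      have := h.prop.add_mem _ hb _ ((hf _).1 h1).2
      simpa using this
    exact (hf a).2 ⟨ha, hna⟩
  diff := by
    rintro _ ⟨a, ha, rfl⟩ _ ⟨b, hb, rfl⟩
    rcases total_of_maximal h (a - b) with hab | hab
    · exact Or.inl ⟨_, hab, map_sub _ _ _⟩
    · exact Or.inr ⟨_, hab, by simp⟩

end IsPreordering
end

section
open Matrix Polynomial

namespace IsOrdPart

variable {K : Type*} [Field K] {P : Set K}

theorem zero_mem (h : IsOrdPart P) : (0 : K) ∈ P := by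
  rcases h.diff 1 h.one_mem 1 h.one_mem with h1 | h1 <;> simpa using h1

theorem exists_maximal (h : IsOrdPart P) :
    ∃ Q, P ⊆ Q ∧ Maximal (fun P : Set K => IsOrdPart P) Q := by
  refine zorn_subset_nonempty {P : Set K | IsOrdPart P} ?_ P h
  intro c hc hchain hne
  obtain ⟨P0, hP0⟩ := hne
  have key : ∀ a b, a ∈ ⋃₀ c → b ∈ ⋃₀ c → ∃ P ∈ c, a ∈ P ∧ b ∈ P := by
    rintro a b ⟨P, hP, ha⟩ ⟨Q, hQ, hb⟩
    rcases hchain.total hP hQ with hPQ | hPQ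
    · exact ⟨Q, hQ, hPQ ha, hb⟩
    · exact ⟨P, hP, ha, hPQ hb⟩
  refine ⟨⋃₀ c, ⟨?_, ?_, ⟨P0, hP0, (hc hP0).one_mem⟩, ?_, ?_⟩,
    fun s hs => Set.subset_sUnion_of_mem hs⟩
  · intro a ha b hb
    obtain ⟨Q, hQ, ha, hb⟩ := key a b ha hb
    exact ⟨Q, hQ, (hc hQ).add_mem _ ha _ hb⟩
  · intro a ha b hb
    obtain ⟨Q, hQ, ha, hb⟩ := key a b ha hb
    exact ⟨Q, hQ, (hc hQ).mul_mem _ ha _ hb⟩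
  · intro a ha hb
    obtain ⟨Q, hQ, ha, hb⟩ := key a (-a) ha hb
    exact (hc hQ).pointed _ ha hb
  · intro a ha b hb
    obtain ⟨Q, hQ, ha, hb⟩ := key a b ha hb
    exact ((hc hQ).diff _ ha _ hb).imp (fun h => ⟨Q, hQ, h⟩) (fun h => ⟨Q, hQ, h⟩)

theorem inv_mem_of_maximal (h : Maximal (fun P : Set K => IsOrdPart P) P) {x : K}
    (hx : x ∈ P) : x⁻¹ ∈ P := by
  have hP := h.prop
  have h1 : IsOrdPart {x | ∃ y ∈ P, y ≠ 0 ∧ x * y ∈ P} := by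
    refine ⟨?_, ?_, ⟨1, hP.one_mem, one_ne_zero, by simpa using hP.one_mem⟩, ?_, ?_⟩
    · rintro a ⟨y, hy, hy0, hay⟩ b ⟨z, hz, hz0, hbz⟩
      refine ⟨y * z, hP.mul_mem _ hy _ hz, mul_ne_zero hy0 hz0, ?_⟩
      have := hP.add_mem _ (hP.mul_mem _ hay _ hz) _ (hP.mul_mem _ hbz _ hy)
      convert this using 1; ring
    · rintro a ⟨y, hy, hy0, hay⟩ b ⟨z, hz, hz0, hbz⟩
      refine ⟨y * z, hP.mul_mem _ hy _ hz, mul_ne_zero hy0 hz0, ?_⟩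
      have := hP.mul_mem _ hay _ hbz
      convert this using 1; ring
    · rintro a ⟨y, hy, hy0, hay⟩ ⟨z, hz, hz0, hbz⟩
      have h2 := hP.pointed (a * y * z) (hP.mul_mem _ hay _ hz) (by
        have := hP.mul_mem _ hbz _ hy
        convert this using 1; ring)
      simpa [hy0, hz0] using h2
    · rintro a ⟨y, hy, hy0, hay⟩ b ⟨z, hz, hz0, hbz⟩
      rcases hP.diff _ (hP.mul_mem _ hay _ hz) _ (hP.mul_mem _ hbz _ hy) with h2 | h2
      · exact Or.inl ⟨y * z, hP.mul_mem _ hy _ hz, mul_ne_zero hy0 hz0, by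
          convert h2 using 1; ring⟩
      · exact Or.inr ⟨y * z, hP.mul_mem _ hy _ hz, mul_ne_zero hy0 hz0, by
          convert h2 using 1; ring⟩
  have h2 := h.le_of_ge h1 (fun a ha => ⟨1, hP.one_mem, one_ne_zero, by simpa using ha⟩)
  by_cases hx0 : x = 0
  · simpa [hx0] using hP.zero_mem
  · exact h2 ⟨x, hx, hx0, by simpa [hx0] using hP.one_mem⟩

/-- The ordered subfield attached to a maximal ordered part. -/
def subfield (h : Maximal (fun P : Set K => IsOrdPart P) P) : Subfield K where
  carrier := {x | x ∈ P ∨ -x ∈ P}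
  zero_mem' := Or.inl h.prop.zero_mem
  one_mem' := Or.inl h.prop.one_mem
  neg_mem' := by
    intro x hx
    simpa [or_comm] using hx
  add_mem' := by
    have hP := h.prop
    rintro a b (ha | ha) (hb | hb)
    · exact Or.inl (hP.add_mem _ ha _ hb)
    · exact (hP.diff _ ha _ hb).imp (fun h => by simpa using h) (fun h => by
        convert h using 1; ring)
    · exact (hP.diff _ hb _ ha).imp (fun h => by simpa [add_comm] using h) (fun h => by
        convert h using 1; ring)
    · exact Or.inr (by rw [neg_add]; exact hP.add_mem _ ha _ hb)
  mul_mem' := by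
    have hP := h.prop
    rintro a b (ha | ha) (hb | hb)
    · exact Or.inl (hP.mul_mem _ ha _ hb)
    · exact Or.inr (by simpa using hP.mul_mem _ ha _ hb)
    · exact Or.inr (by simpa using hP.mul_mem _ ha _ hb)
    · exact Or.inl (by simpa using hP.mul_mem _ ha _ hb)
  inv_mem' := by
    rintro a (ha | ha)
    · exact Or.inl (inv_mem_of_maximal h ha)
    · exact Or.inr (by simpa [inv_neg] using inv_mem_of_maximal h ha)

/-- The cone of nonnegative elements of the ordered subfield. -/
def cone (h : Maximal (fun P : Set K => IsOrdPart P) P) : RingCone (subfield h) where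
  carrier := {x | (x : K) ∈ P}
  zero_mem' := h.prop.zero_mem
  one_mem' := h.prop.one_mem
  add_mem' := fun ha hb => h.prop.add_mem _ ha _ hb
  mul_mem' := fun ha hb => h.prop.mul_mem _ ha _ hb
  eq_zero_of_mem_of_neg_mem' := fun ha hb => Subtype.ext (h.prop.pointed _ ha hb)

open Classical in
/-- The order of the ordered subfield. -/
@[reducible] def linearOrder (h : Maximal (fun P : Set K => IsOrdPart P) P) :
    LinearOrder (subfield h) :=
  haveI : HasMemOrNegMem (cone h) := ⟨fun a => a.2⟩
  LinearOrder.mkOfAddGroupCone (cone h)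

theorem isStrictOrderedRing (h : Maximal (fun P : Set K => IsOrdPart P) P) :
    letI := linearOrder h
    IsStrictOrderedRing (subfield h) := by
  let := linearOrder h
  have : IsOrderedRing (subfield h) := IsOrderedRing.mkOfCone (cone h)
  exact IsOrderedRing.toIsStrictOrderedRing _

theorem nonneg_iff (h : Maximal (fun P : Set K => IsOrdPart P) P) (x : subfield h) :
    letI := linearOrder h
    0 ≤ x ↔ (x : K) ∈ P := by
  let := linearOrder h
  change x - 0 ∈ cone h ↔ _
  rw [sub_zero]
  rfl

end IsOrdPart

/-- Weighted sums of squares of polynomials of degree less than `d`. -/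
def sosDeg (R : Type*) [Field R] [LinearOrder R] (d : ℕ) : AddSubmonoid R[X] :=
  AddSubmonoid.closure {f | ∃ r : R, 0 ≤ r ∧ ∃ q : R[X], q.degree < d ∧ f = C r * (q * q)}

/-- An ordered field without proper algebraic ordered extensions, expressed through
irreducible polynomials. -/
def IsRC (R : Type*) [Field R] [LinearOrder R] : Prop :=
  ∀ p : R[X], Irreducible p → (∀ s ∈ sosDeg R p.natDegree, ¬ p ∣ 1 + s) → p.natDegree = 1

theorem IsOrdPart.isRC {K : Type*} [Field K] [IsAlgClosed K] {P : Set K}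
    (h : Maximal (fun P : Set K => IsOrdPart P) P) :
    letI := linearOrder h
    IsRC (subfield h) := by
  let := linearOrder h
  have := isStrictOrderedRing h
  intro p hp hs
  have := Fact.mk hp
  let T : Set (AdjoinRoot p) := AddSubmonoid.closure
    {f | ∃ r : (subfield h), 0 ≤ r ∧ ∃ z : AdjoinRoot p, f = AdjoinRoot.of p r * (z * z)}
  have hT : IsPreordering T := by
    refine ⟨fun a ha b hb => AddSubmonoid.add_mem _ ha hb, ?_, ?_, ?_⟩
    · intro a ha b hb
      induction ha using AddSubmonoid.closure_induction with
      | zero => rw [zero_mul]; exact AddSubmonoid.zero_mem (AddSubmonoid.closure _)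
      | add x y _ _ hx hy => rw [add_mul]; exact AddSubmonoid.add_mem _ hx hy
      | mem x hx =>
        obtain ⟨r, hr, z, rfl⟩ := hx
        induction hb using AddSubmonoid.closure_induction with
        | zero => rw [mul_zero]; exact AddSubmonoid.zero_mem (AddSubmonoid.closure _)
        | add x y _ _ hx hy => rw [mul_add]; exact AddSubmonoid.add_mem _ hx hy
        | mem x hx =>
          obtain ⟨r', hr', z', rfl⟩ := hx
          exact AddSubmonoid.subset_closure ⟨r * r', mul_nonneg hr hr', z * z', by
            rw [map_mul]; ring⟩
    · exact fun a => AddSubmonoid.subset_closure ⟨1, zero_le_one, a, by simp⟩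
    · intro hneg
      have key : ∀ x ∈ T, ∃ s ∈ sosDeg (subfield h) p.natDegree, AdjoinRoot.mk p s = x := by
        intro x hx
        induction hx using AddSubmonoid.closure_induction with
        | zero => exact ⟨0, AddSubmonoid.zero_mem _, map_zero _⟩
        | add x y _ _ hx hy =>
          obtain ⟨s, hs, rfl⟩ := hx
          obtain ⟨t, ht, rfl⟩ := hy
          exact ⟨s + t, AddSubmonoid.add_mem _ hs ht, map_add _ _ _⟩
        | mem x hx =>
          obtain ⟨r, hr, z, rfl⟩ := hx
          obtain ⟨q, rfl⟩ := AdjoinRoot.mk_surjective z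
          refine ⟨C r * ((q % p) * (q % p)), AddSubmonoid.subset_closure ⟨r, hr, q % p, ?_, rfl⟩,
            ?_⟩
          · rw [← degree_eq_natDegree hp.ne_zero]
            exact EuclideanDomain.mod_lt q hp.ne_zero
          · have : AdjoinRoot.mk p (q % p) = AdjoinRoot.mk p q := by
              rw [AdjoinRoot.mk_eq_mk]
              exact ⟨-(q / p), by
                have := EuclideanDomain.div_add_mod q p
                linear_combination this⟩
            rw [map_mul, map_mul, this, AdjoinRoot.mk_C]
      obtain ⟨s, hs1, hs2⟩ := key _ hneg
      apply hs s hs1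
      rw [← AdjoinRoot.mk_eq_zero, map_add, hs2, map_one]; ring
  obtain ⟨Q, hTQ, hQ⟩ := hT.exists_maximal
  obtain ⟨α, hα⟩ := IsAlgClosed.exists_eval₂_eq_zero (subfield h).subtype p
    (by
      have := degree_pos_of_irreducible hp
      exact this.ne')
  let f : AdjoinRoot p →+* K := AdjoinRoot.lift (subfield h).subtype α hα
  have hf : ∀ x, f x = 0 ↔ x ∈ Q ∧ -x ∈ Q := by
    intro x
    rw [map_eq_zero]
    constructor
    · rintro rfl
      exact ⟨hQ.prop.zero_mem, by simpa using hQ.prop.zero_mem⟩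
    · intro hx
      by_contra hne
      have h1 : x ∈ IsPreordering.support hQ := hx
      have h2 := (IsPreordering.support hQ).mul_mem_right x⁻¹ h1
      rw [mul_inv_cancel₀ hne] at h2
      exact hQ.prop.neg_one_notMem h2.2
  have hPQ := IsPreordering.isOrdPart_image hQ f hf
  have hle : P ⊆ f '' Q := by
    intro x hx
    refine ⟨AdjoinRoot.of p ⟨x, Or.inl hx⟩, hTQ (AddSubmonoid.subset_closure
      ⟨⟨x, Or.inl hx⟩, (nonneg_iff h _).2 hx, 1, by simp⟩), ?_⟩
    simp [f, AdjoinRoot.lift_of]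
  have hge := h.le_of_ge hPQ hle
  have hαR : α ∈ (subfield h) := by
    rcases IsPreordering.total_of_maximal hQ (AdjoinRoot.root p) with h1 | h1
    · have := hge ⟨_, h1, rfl⟩
      rw [AdjoinRoot.lift_root] at this
      exact Or.inl this
    · have := hge ⟨_, h1, rfl⟩
      rw [map_neg, AdjoinRoot.lift_root] at this
      exact Or.inr this
  have hroot : p.IsRoot (⟨α, hαR⟩ : (subfield h)) := by
    have h1 : (subfield h).subtype (p.eval ⟨α, hαR⟩) = 0 := by
      rw [← Polynomial.eval₂_at_apply]; exact hα
    exact (map_eq_zero _).1 h1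
  exact natDegree_eq_of_degree_eq_some (degree_eq_one_of_irreducible_of_root hp hroot)
end

section
open Matrix Polynomial

/-- The intermediate value property for polynomials. -/
def PolyIVT (R : Type*) [Field R] [LinearOrder R] : Prop :=
  ∀ (f : R[X]) (a b : R), a < b → f.eval a * f.eval b < 0 → ∃ c, a < c ∧ c < b ∧ f.eval c = 0

section

variable {R : Type*} [Field R] [LinearOrder R] [IsStrictOrderedRing R]

theorem sosDeg_eval_nonneg {d : ℕ} {s : R[X]} (hs : s ∈ sosDeg R d) (x : R) : 0 ≤ s.eval x := by
  induction hs using AddSubmonoid.closure_induction with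
  | zero => simp
  | add a b _ _ ha hb => rw [eval_add]; exact add_nonneg ha hb
  | mem f hf =>
    obtain ⟨r, hr, q, -, rfl⟩ := hf
    simpa using mul_nonneg hr (mul_self_nonneg _)

theorem sosDeg_natDegree_le {d : ℕ} {s : R[X]} (hs : s ∈ sosDeg R d) :
    s.natDegree ≤ 2 * (d - 1) := by
  induction hs using AddSubmonoid.closure_induction with
  | zero => simp
  | add a b _ _ ha hb => exact (natDegree_add_le _ _).trans (max_le ha hb)
  | mem f hf =>
    obtain ⟨r, hr, q, hq, rfl⟩ := hf
    have h1 : q.natDegree ≤ d - 1 := by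
      by_cases h0 : q = 0
      · simp [h0]
      · have := (natDegree_lt_iff_degree_lt h0).2 hq
        omega
    calc _ ≤ (q * q).natDegree := natDegree_C_mul_le _ _
      _ ≤ q.natDegree + q.natDegree := natDegree_mul_le
      _ ≤ _ := by omega

theorem IsRC.polyIVT (hR : IsRC R) : PolyIVT R := by
  have key : ∀ (d : ℕ) (f : R[X]) (a b : R), f.natDegree = d → a < b →
      f.eval a * f.eval b < 0 → ∃ c, a < c ∧ c < b ∧ f.eval c = 0 := by
    intro d
    induction d using Nat.strong_induction_on with
    | _ d ih =>
    intro f a b hd hab hf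
    have hf0 : f ≠ 0 := by rintro rfl; simp at hf
    have hd0 : d ≠ 0 := by
      rintro rfl
      rw [natDegree_eq_zero] at hd
      obtain ⟨c, rfl⟩ := hd
      simp only [eval_C] at hf
      nlinarith [mul_self_nonneg c]
    have hnu : ¬ IsUnit f := by
      intro hu
      exact hd0 (hd ▸ natDegree_eq_zero_of_isUnit hu)
    by_cases hirr : Irreducible f
    · by_cases hlin : f.natDegree = 1
      · obtain ⟨m, hm, q, rfl⟩ := natDegree_eq_one.1 hlin
        simp only [eval_add, eval_mul, eval_C, eval_X] at hf ⊢
        obtain ⟨c, rfl⟩ : ∃ c, q = -(m * c) := ⟨-q / m, by field_simp⟩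
        have h1 : 0 < m * m := mul_self_pos.2 hm
        have h2 : (a - c) * (b - c) < 0 := by
          by_contra! h
          nlinarith [mul_nonneg h1.le h]
        refine ⟨c, ?_, ?_, by ring⟩
        · by_contra! h
          nlinarith [mul_nonneg (sub_nonneg.2 h) (sub_nonneg.2 (h.trans hab.le))]
        · by_contra! h
          nlinarith [mul_nonneg (sub_nonneg.2 h) (sub_nonneg.2 (hab.le.trans h))]
      · have := mt (hR f hirr) hlin
        push Not at this
        obtain ⟨s, hs, h, hh⟩ := this
        have hpos : ∀ x, 0 < f.eval x * h.eval x := by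
          intro x
          rw [← eval_mul, ← hh, eval_add, eval_one]
          have := sosDeg_eval_nonneg hs x
          linarith
        have hh0 : h ≠ 0 := by
          rintro rfl
          simpa using hpos 0
        have hdeg : h.natDegree < d := by
          have h1 := natDegree_mul hf0 hh0
          rw [← hh] at h1
          have h2 := natDegree_add_le 1 s
          have h3 := sosDeg_natDegree_le hs
          have h4 : (1 : R[X]).natDegree = 0 := natDegree_one
          rw [h4, Nat.zero_max] at h2
          omega
        obtain ⟨c, h1, h2, h3⟩ := ih _ hdeg h a b rfl hab (by
          have h1 := mul_pos (hpos a) (hpos b)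
          by_contra! h2
          nlinarith [mul_nonneg h2 (neg_nonneg.2 hf.le)])
        have := hpos c
        rw [h3] at this
        simp at this
    · have hfac : ∃ u v, f = u * v ∧ ¬ IsUnit u ∧ ¬ IsUnit v := by
        by_contra! hcon
        apply hirr
        refine ⟨hnu, fun u v huv => ?_⟩
        by_contra! h
        exact h.2 (hcon u v huv h.1)
      obtain ⟨u, v, rfl, hu, hv⟩ := hfac
      have hu0 := left_ne_zero_of_mul hf0
      have hv0 := right_ne_zero_of_mul hf0
      have hud : u.natDegree ≠ 0 := fun h => hu (by
        rw [Polynomial.isUnit_iff_degree_eq_zero, degree_eq_natDegree hu0, h]; rfl)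
      have hvd : v.natDegree ≠ 0 := fun h => hv (by
        rw [Polynomial.isUnit_iff_degree_eq_zero, degree_eq_natDegree hv0, h]; rfl)
      have hm := natDegree_mul hu0 hv0
      simp only [eval_mul] at hf ⊢
      rcases lt_or_ge (u.eval a * u.eval b) 0 with h1 | h1
      · obtain ⟨c, h1, h2, h3⟩ := ih _ (by omega) u a b rfl hab h1
        exact ⟨c, h1, h2, by simp [h3]⟩
      · obtain ⟨c, h1, h2, h3⟩ := ih _ (by omega) v a b rfl hab (by
          by_contra! h2
          nlinarith [mul_nonneg h1 h2])
        exact ⟨c, h1, h2, by simp [h3]⟩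
  exact fun f a b => key _ f a b rfl

theorem PolyIVT.exists_sqrt (hR : PolyIVT R) {x : R} (hx : 0 ≤ x) : ∃ y, 0 ≤ y ∧ y * y = x := by
  rcases hx.eq_or_lt with rfl | hx
  · exact ⟨0, le_rfl, by simp⟩
  · obtain ⟨c, h1, -, h3⟩ := hR (X ^ 2 - C x) 0 (1 + x) (by linarith) (by
      simp only [eval_sub, eval_pow, eval_X, eval_C]
      nlinarith [mul_pos hx hx, mul_pos (mul_pos hx hx) hx])
    simp only [eval_sub, eval_pow, eval_X, eval_C] at h3
    exact ⟨c, h1.le, by linear_combination h3⟩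

/-- An irreducible polynomial killed by a nonzero positive functional is linear. -/
theorem IsRC.natDegree_eq_one (hR : IsRC R) {p : R[X]} (hp : Irreducible p) (l : R[X] →ₗ[R] R)
    (h0 : ∀ h, l (p * h) = 0) (hsq : ∀ f, 0 ≤ l (f * f)) (h1 : 0 < l 1) : p.natDegree = 1 := by
  refine hR p hp fun s hs => ?_
  rintro ⟨h, hh⟩
  have h2 : 0 ≤ l s := by
    clear hh
    induction hs using AddSubmonoid.closure_induction with
    | zero => simp
    | add a b _ _ ha hb => rw [map_add]; exact add_nonneg ha hb
    | mem f hf =>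
      obtain ⟨r, hr, q, -, rfl⟩ := hf
      rw [← smul_eq_C_mul, map_smul]
      exact mul_nonneg hr (hsq q)
  have h3 := h0 h
  rw [← hh, map_add] at h3
  linarith

end

/-- A proper preordering is pulled back from the nonnegative cone of an ordered field `R`
satisfying `IsRC`. -/
theorem IsPreordering.exists_hom.{u} {A : Type u} [CommRing A] {T : Set A} (hT : IsPreordering T) :
    ∃ (R : Type u) (_ : Field R) (_ : LinearOrder R) (_ : IsStrictOrderedRing R) (f : A →+* R),
      IsRC R ∧ ∀ t ∈ T, 0 ≤ f t := by
  obtain ⟨Q, hTQ, hQ⟩ := hT.exists_maximal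
  have := IsPreordering.support_isPrime hQ
  let F := FractionRing (A ⧸ IsPreordering.support hQ)
  let K := AlgebraicClosure F
  let f : A →+* K := ((algebraMap F K).comp (algebraMap (A ⧸ IsPreordering.support hQ) F)).comp
    (Ideal.Quotient.mk _)
  have hf : ∀ x, f x = 0 ↔ x ∈ Q ∧ -x ∈ Q := by
    intro x
    simp only [f, RingHom.comp_apply]
    rw [map_eq_zero, IsFractionRing.to_map_eq_zero_iff, Ideal.Quotient.eq_zero_iff_mem]
    rfl
  obtain ⟨P, hP1, hP⟩ := (IsPreordering.isOrdPart_image hQ f hf).exists_maximal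
  let := IsOrdPart.linearOrder hP
  have := IsOrdPart.isStrictOrderedRing hP
  have hmem : ∀ x, f x ∈ IsOrdPart.subfield hP := by
    intro x
    rcases IsPreordering.total_of_maximal hQ x with h | h
    · exact Or.inl (hP1 ⟨x, h, rfl⟩)
    · exact Or.inr (hP1 ⟨-x, h, map_neg _ _⟩)
  refine ⟨IsOrdPart.subfield hP, inferInstance, inferInstance, inferInstance,
    f.codRestrict _ hmem, IsOrdPart.isRC hP, fun t ht => ?_⟩
  exact (IsOrdPart.nonneg_iff hP _).2 (show f t ∈ P from hP1 ⟨t, hTQ ht, rfl⟩)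
end

section
open Matrix Polynomial

section Rolle

variable {R : Type*} [Field R] [LinearOrder R] [IsStrictOrderedRing R]

theorem PolyIVT.sign_eq (hR : PolyIVT R) {f : R[X]} {a b : R}
    (h : ∀ c, a ≤ c → c ≤ b → f.eval c ≠ 0) (hab : a ≤ b) : 0 < f.eval a * f.eval b := by
  rcases hab.eq_or_lt with rfl | hab
  · exact mul_self_pos.2 (h a le_rfl le_rfl)
  · by_contra! h1
    rcases h1.lt_or_eq with h1 | h1
    · obtain ⟨c, h2, h3, h4⟩ := hR f a b hab h1
      exact h c h2.le h3.le h4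
    · rcases mul_eq_zero.1 h1 with h2 | h2
      · exact h a le_rfl hab.le h2
      · exact h b hab.le le_rfl h2

/-- Rolle's theorem for adjacent roots. -/
theorem PolyIVT.rolle_adjacent (hR : PolyIVT R) {f : R[X]} (hf : f ≠ 0) {a b : R} (hab : a < b)
    (ha : f.eval a = 0) (hb : f.eval b = 0) (h : ∀ c, a < c → c < b → f.eval c ≠ 0) :
    ∃ c, a < c ∧ c < b ∧ (derivative f).eval c = 0 := by
  obtain ⟨q, hq, hqa⟩ := exists_eq_pow_rootMultiplicity_mul_and_not_dvd f hf a
  set m := rootMultiplicity a f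
  have hm : m ≠ 0 := (rootMultiplicity_pos hf).2 ha |>.ne'
  have hq0 : q ≠ 0 := by rintro rfl; simp at hqa
  obtain ⟨r, hr, hrb⟩ := exists_eq_pow_rootMultiplicity_mul_and_not_dvd q hq0 b
  set l := rootMultiplicity b q
  have hbq : q.eval b = 0 := by
    rw [hq] at hb
    simpa [sub_eq_zero, hab.ne', hm] using hb
  have hl : l ≠ 0 := (rootMultiplicity_pos hq0).2 hbq |>.ne'
  have hrb' : r.eval b ≠ 0 := fun h0 => hrb (dvd_iff_isRoot.2 h0)
  have hra' : r.eval a ≠ 0 := fun h0 => hqa (dvd_iff_isRoot.2 (by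
    rw [IsRoot, hr]; simp [h0]))
  have hpos : 0 < r.eval a * r.eval b := by
    refine hR.sign_eq (fun c h1 h2 h0 => ?_) hab.le
    rcases h1.eq_or_lt with rfl | h1
    · exact hra' h0
    rcases h2.eq_or_lt with rfl | h2
    · exact hrb' h0
    exact h c h1 h2 (by rw [hq, hr]; simp [h0])
  obtain ⟨m, hm'⟩ : ∃ m', m = m' + 1 := ⟨m - 1, by omega⟩
  obtain ⟨l, hl'⟩ : ∃ l', l = l' + 1 := ⟨l - 1, by omega⟩
  rw [hl'] at hr
  rw [hm', hr] at hq
  -- the derivative without the outer factors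
  let D : R[X] := C ((m : R) + 1) * (X - C b) * r + C ((l : R) + 1) * (X - C a) * r
    + (X - C a) * (X - C b) * derivative r
  have hD : derivative f = (X - C a) ^ m * (X - C b) ^ l * D := by
    rw [hq]
    simp only [derivative_mul, derivative_X_sub_C_pow, D]
    simp only [Nat.add_sub_cancel, Nat.cast_add, Nat.cast_one, map_add, map_one, map_natCast]
    ring
  obtain ⟨c, h1, h2, h3⟩ := hR D a b hab (by
    have e1 : D.eval a = ((m : R) + 1) * (a - b) * r.eval a := by simp [D]
    have e2 : D.eval b = ((l : R) + 1) * (b - a) * r.eval b := by simp [D]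
    rw [e1, e2]
    have e3 : 0 < ((m : R) + 1) * ((l : R) + 1) * ((b - a) * (b - a)) :=
      mul_pos (by positivity) (mul_self_pos.2 (sub_pos.2 hab).ne')
    nlinarith [mul_pos e3 hpos])
  exact ⟨c, h1, h2, by rw [hD]; simp [h3]⟩

/-- Rolle's theorem for polynomials. -/
theorem PolyIVT.rolle (hR : PolyIVT R) {f : R[X]} (hf : f ≠ 0) {a b : R} (hab : a < b)
    (ha : f.eval a = 0) (hb : f.eval b = 0) :
    ∃ c, a < c ∧ c < b ∧ (derivative f).eval c = 0 := by
  classical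
  let s := f.roots.toFinset.filter (fun c => a < c)
  have hs : ∀ c, c ∈ s ↔ f.eval c = 0 ∧ a < c := by simp [s, hf]
  obtain ⟨c, hc, hmin⟩ := s.exists_min_image id ⟨b, (hs b).2 ⟨hb, hab⟩⟩
  have hc' := (hs c).1 hc
  obtain ⟨d, h1, h2, h3⟩ := hR.rolle_adjacent hf hc'.2 ha hc'.1 (fun d h1 h2 h3 =>
    absurd (hmin d ((hs d).2 ⟨h3, h1⟩)) (not_le.2 h2))
  exact ⟨d, h1, h2.trans_le (hmin b ((hs b).2 ⟨hb, hab⟩)), h3⟩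

end Rolle

section Cuts

variable {k R Ω : Type*} [Field k] [LinearOrder k] [IsStrictOrderedRing k]
  [Field R] [LinearOrder R] [IsStrictOrderedRing R]
  [Field Ω] [LinearOrder Ω] [IsStrictOrderedRing Ω]

/-- In the same gap between roots, signs agree. -/
theorem sign_in_gap (hR : PolyIVT R) {i : k →+* R} (hi : StrictMono i) {h : k[X]}
    (hroots : ∀ y, h.eval₂ i y = 0 → y ∈ Set.range i) {m : k} {y : R}
    (hm : ∀ c, h.eval c = 0 → (i c < y ∧ c < m) ∨ (y < i c ∧ m < c)) :
    0 ≤ h.eval₂ i y ↔ 0 ≤ h.eval m := by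
  have hne : ∀ w, (∃ a b, (a = y ∧ b = i m ∨ a = i m ∧ b = y) ∧ a ≤ w ∧ w ≤ b) →
      (h.map i).eval w ≠ 0 := by
    rintro w ⟨a, b, hab, h1, h2⟩ h0
    rw [eval_map] at h0
    obtain ⟨c, rfl⟩ := hroots w h0
    have h0' : h.eval c = 0 := by
      rw [eval₂_at_apply] at h0; exact (map_eq_zero _).1 h0
    rcases hab with ⟨rfl, rfl⟩ | ⟨rfl, rfl⟩
    · rcases hm c h0' with h3 | h3
      · exact absurd h3.1 (not_lt.2 h1)
      · exact absurd (hi h3.2) (not_lt.2 h2)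
    · rcases hm c h0' with h3 | h3
      · exact absurd (hi h3.2) (not_lt.2 h1)
      · exact absurd h3.1 (not_lt.2 h2)
  have hpos : 0 < (h.map i).eval y * (h.map i).eval (i m) := by
    rcases le_total y (i m) with h1 | h1
    · exact hR.sign_eq (fun w h2 h3 => hne w ⟨_, _, Or.inl ⟨rfl, rfl⟩, h2, h3⟩) h1
    · rw [mul_comm]
      exact hR.sign_eq (fun w h2 h3 => hne w ⟨_, _, Or.inr ⟨rfl, rfl⟩, h2, h3⟩) h1
  rw [eval_map, eval_map, eval₂_at_apply] at hpos
  have h2 : 0 ≤ i (h.eval m) ↔ 0 ≤ h.eval m := by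
    rw [← map_zero i]; exact hi.le_iff_le
  rw [← h2]
  rcases mul_pos_iff.1 hpos with h3 | h3
  · exact ⟨fun _ => h3.2.le, fun _ => h3.1.le⟩
  · exact ⟨fun h => absurd h (not_le.2 h3.1), fun h => absurd h (not_le.2 h3.2)⟩

theorem exists_same_gap {i : k →+* R} (hi : StrictMono i) {h : k[X]} (hh : h ≠ 0) {y : R}
    (hy : y ∉ Set.range i) : ∃ m, ∀ c, h.eval c = 0 → (i c < y ∧ c < m) ∨ (y < i c ∧ m < c) := by
  classical
  obtain ⟨m, h1, h2⟩ := Order.exists_between_finsets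
    (lo := h.roots.toFinset.filter (fun c => i c < y))
    (hi := h.roots.toFinset.filter (fun c => y < i c)) (by
      intro a ha b hb
      simp only [Finset.mem_filter] at ha hb
      exact hi.lt_iff_lt.1 (ha.2.trans hb.2))
  refine ⟨m, fun c hc => ?_⟩
  rcases lt_trichotomy (i c) y with h3 | h3 | h3
  · exact Or.inl ⟨h3, h1 c (by simp [hh, hc, h3])⟩
  · exact absurd ⟨c, h3⟩ hy
  · exact Or.inr ⟨h3, h2 c (by simp [hh, hc, h3])⟩

theorem sign_of_same_cut (hR : PolyIVT R) (hΩ : PolyIVT Ω) {i : k →+* R} (hi : StrictMono i)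
    {j : k →+* Ω} (hj : StrictMono j) {h : k[X]}
    (h1 : ∀ y, h.eval₂ i y = 0 → y ∈ Set.range i) (h2 : ∀ y, h.eval₂ j y = 0 → y ∈ Set.range j)
    {y : R} {z : Ω} (hy : y ∉ Set.range i) (hz : z ∉ Set.range j)
    (hyz : ∀ c, i c < y ↔ j c < z) : 0 ≤ h.eval₂ i y ↔ 0 ≤ h.eval₂ j z := by
  by_cases hh : h = 0
  · simp [hh]
  obtain ⟨m, hm⟩ := exists_same_gap hi hh hy
  rw [sign_in_gap hR hi h1 hm, sign_in_gap hΩ hj h2 (m := m)]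
  intro c hc
  refine (hm c hc).imp (fun h => ⟨(hyz c).1 h.1, h.2⟩) (fun h => ⟨?_, h.2⟩)
  refine lt_of_le_of_ne (not_lt.1 fun h3 => absurd ((hyz c).2 h3) (not_lt.2 h.1.le)) ?_
  rintro rfl
  exact hz ⟨c, rfl⟩

/-- A root of a polynomial over `k` is bounded by elements of `k`. -/
theorem exists_root_bound {i : k →+* R} (hi : StrictMono i) {g : k[X]} (hg : g ≠ 0) {y : R}
    (hy : g.eval₂ i y = 0) : ∃ b, i (-b) < y ∧ y < i b := by
  let d := g.natDegree
  let S : R := ∑ l ∈ Finset.range d, |i (g.coeff l / g.leadingCoeff)|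
  have hiabs : ∀ x, |i x| = i |x| := fun x => by
    rcases le_total 0 x with h | h
    · rw [abs_of_nonneg h, abs_of_nonneg (by rw [← map_zero i]; exact hi.monotone h)]
    · rw [abs_of_nonpos h, abs_of_nonpos (by rw [← map_zero i]; exact hi.monotone h), map_neg]
  have hS : S = i (∑ l ∈ Finset.range d, |g.coeff l / g.leadingCoeff|) := by
    simp only [S, hiabs, map_sum]
  have hS0 : 0 ≤ S := Finset.sum_nonneg fun _ _ => abs_nonneg _
  have key : |y| < 2 + S := by
    by_contra! hcon
    have hy1 : 1 ≤ |y| := by linarith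
    have hlc : i g.leadingCoeff ≠ 0 := by simpa using hg
    have h1 : y ^ d = - ∑ l ∈ Finset.range d, i (g.coeff l / g.leadingCoeff) * y ^ l := by
      rw [eval₂_eq_sum_range, Finset.sum_range_succ] at hy
      have : ∑ l ∈ Finset.range d, i (g.coeff l / g.leadingCoeff) * y ^ l =
          (i g.leadingCoeff)⁻¹ * ∑ l ∈ Finset.range d, i (g.coeff l) * y ^ l := by
        rw [Finset.mul_sum]
        refine Finset.sum_congr rfl fun l _ => ?_
        rw [map_div₀]; field_simp
      rw [this, eq_neg_of_add_eq_zero_left hy, coeff_natDegree]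
      field_simp
      rfl
    have hd : d ≠ 0 := by
      intro hd
      rw [hd] at h1
      simp at h1
    have h2 : |y| ^ d ≤ S * |y| ^ (d - 1) := by
      rw [← abs_pow, h1, abs_neg, Finset.sum_mul]
      refine (Finset.abs_sum_le_sum_abs _ _).trans (Finset.sum_le_sum fun l hl => ?_)
      rw [abs_mul, abs_pow]
      refine mul_le_mul_of_nonneg_left (pow_le_pow_right₀ hy1 ?_) (abs_nonneg _)
      have := Finset.mem_range.1 hl
      omega
    have h3 : |y| ^ d = |y| * |y| ^ (d - 1) := by
      rw [← pow_succ']; congr 1; omega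
    rw [h3] at h2
    have := le_of_mul_le_mul_right h2 (by positivity)
    linarith
  refine ⟨2 + ∑ l ∈ Finset.range d, |g.coeff l / g.leadingCoeff|, ?_, ?_⟩
  · rw [map_neg, map_add, ← hS, map_ofNat]
    exact (abs_lt.1 key).1
  · rw [map_add, ← hS, map_ofNat]
    exact (abs_lt.1 key).2

/-- Between consecutive critical points there is at most one root. -/
theorem root_unique_in_gap (hR : PolyIVT R) {i : k →+* R} (hi : StrictMono i) {g : k[X]}
    (hg : g ≠ 0) {u v : k} (hgap : ∀ c, u < c → c < v → (derivative g).eval c ≠ 0)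
    (hroot : ∀ w, (derivative g).eval₂ i w = 0 → w ∈ Set.range i) {a b : R}
    (h3 : i u ≤ a) (h4 : a < b) (h5 : b ≤ i v) (h6 : g.eval₂ i a = 0) (h7 : g.eval₂ i b = 0) :
    False := by
  obtain ⟨w, h8, h9, h10⟩ := hR.rolle (f := g.map i)
    ((Polynomial.map_ne_zero_iff i.injective).2 hg) h4
    (by rwa [eval_map]) (by rwa [eval_map])
  rw [derivative_map, eval_map] at h10
  obtain ⟨c, rfl⟩ := hroot w h10
  rw [eval₂_at_apply] at h10
  exact hgap c (hi.lt_iff_lt.1 (h3.trans_lt h8)) (hi.lt_iff_lt.1 (h9.trans_le h5))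
    ((map_eq_zero _).1 h10)

theorem lt_root_iff (hR : PolyIVT R) {i : k →+* R} (hi : StrictMono i) {g : k[X]} {u v : k}
    (huniq : ∀ a b, i u ≤ a → a < b → b ≤ i v → g.eval₂ i a = 0 → g.eval₂ i b = 0 → False)
    {y : R} (hu : i u < y) (hv : y < i v) (hy : g.eval₂ i y = 0) (hyi : y ∉ Set.range i)
    (hneg : g.eval u * g.eval v < 0) {c : k} (huc : u ≤ c) (hcv : c ≤ v) :
    i c < y ↔ 0 < g.eval u * g.eval c := by
  have hpos : ∀ x, 0 < i x ↔ 0 < x := fun x => by rw [← map_zero i, hi.lt_iff_lt]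
  constructor
  · intro h
    rw [← hpos, map_mul, ← eval₂_at_apply, ← eval₂_at_apply, ← eval_map, ← eval_map]
    refine hR.sign_eq (fun w h1 h2 h3 => ?_) (hi.monotone huc)
    rw [eval_map] at h3
    exact huniq w y h1 (h2.trans_lt h) hv.le h3 hy
  · intro h
    by_contra hcon
    have h1 : y < i c := lt_of_le_of_ne (not_lt.1 hcon) fun h => hyi ⟨c, h.symm⟩
    have h2 : 0 < g.eval c * g.eval v := by
      rw [← hpos, map_mul, ← eval₂_at_apply, ← eval₂_at_apply, ← eval_map, ← eval_map]
      refine hR.sign_eq (fun w h1' h2 h3 => ?_) (hi.monotone hcv)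
      rw [eval_map] at h3
      exact huniq y w hu.le (h1.trans_le h1') h2 hy h3
    nlinarith [mul_pos h h2, mul_self_nonneg (g.eval c)]

/-- Two ordered embeddings of `k` that admit no common simple extension. -/
def MaxPair (i : k →+* R) (j : k →+* Ω) : Prop :=
  ∀ y z, (∀ g : k[X], 0 ≤ g.eval₂ i y ↔ 0 ≤ g.eval₂ j z) → ∃ c, i c = y ∧ j c = z

theorem MaxPair.symm {i : k →+* R} {j : k →+* Ω} (h : MaxPair i j) : MaxPair j i := by
  intro y z hyz
  obtain ⟨c, h1, h2⟩ := h z y fun g => (hyz g).symm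
  exact ⟨c, h2, h1⟩

theorem MaxPair.root_mem_of_lt (hR : PolyIVT R) (hΩ : PolyIVT Ω) {i : k →+* R}
    (hi : StrictMono i) {j : k →+* Ω} (hj : StrictMono j) (hij : MaxPair i j) {g : k[X]}
    (hg : g ≠ 0) (h1 : ∀ h : k[X], h ≠ 0 → h.natDegree < g.natDegree →
      ∀ y, h.eval₂ i y = 0 → y ∈ Set.range i)
    (h2 : ∀ h : k[X], h ≠ 0 → h.natDegree < g.natDegree →
      ∀ y, h.eval₂ j y = 0 → y ∈ Set.range j) {y : R} (hy : g.eval₂ i y = 0) :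
    y ∈ Set.range i := by
  classical
  by_contra hyi
  have hd0 : g.natDegree ≠ 0 := by
    intro h0
    obtain ⟨c, rfl⟩ := natDegree_eq_zero.1 h0
    simp at hy
    simp [hy] at hg
  set g' := derivative g
  have hg'0 : g' ≠ 0 := by
    intro h0
    exact hd0 (natDegree_eq_zero_of_derivative_eq_zero h0)
  have hg'd : g'.natDegree < g.natDegree := natDegree_derivative_lt hd0
  have hgi : g.map i ≠ 0 := (Polynomial.map_ne_zero_iff i.injective).2 hg
  have hgj : g.map j ≠ 0 := (Polynomial.map_ne_zero_iff j.injective).2 hg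
  obtain ⟨b, hb1, hb2⟩ := exists_root_bound hi hg hy
  -- the gap between critical points
  obtain ⟨u, hu, humax⟩ := (insert (-b)
    (g'.roots.toFinset.filter fun c => i c < y)).exists_max_image
    id ⟨_, Finset.mem_insert_self _ _⟩
  obtain ⟨v, hv, hvmin⟩ := (insert b (g'.roots.toFinset.filter fun c => y < i c)).exists_min_image
    id ⟨_, Finset.mem_insert_self _ _⟩
  have huy : i u < y := by
    rcases Finset.mem_insert.1 hu with rfl | h
    · exact hb1
    · exact (Finset.mem_filter.1 h).2
  have hyv : y < i v := by
    rcases Finset.mem_insert.1 hv with rfl | h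
    · exact hb2
    · exact (Finset.mem_filter.1 h).2
  have huv : u < v := hi.lt_iff_lt.1 (huy.trans hyv)
  have hgap : ∀ c, u < c → c < v → g'.eval c ≠ 0 := by
    intro c h3 h4 h5
    rcases lt_trichotomy (i c) y with h6 | h6 | h6
    · exact absurd (humax c (Finset.mem_insert_of_mem (by simp [hg'0, h5, h6]))) (not_le.2 h3)
    · exact hyi ⟨c, h6⟩
    · exact absurd (hvmin c (Finset.mem_insert_of_mem (by simp [hg'0, h5, h6]))) (not_le.2 h4)
  have uniqi := fun a b h3 h4 h5 h6 h7 =>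
    root_unique_in_gap hR hi hg hgap (h1 g' hg'0 hg'd) (a := a) (b := b) h3 h4 h5 h6 h7
  have uniqj := fun a b h3 h4 h5 h6 h7 =>
    root_unique_in_gap hΩ hj hg hgap (h2 g' hg'0 hg'd) (a := a) (b := b) h3 h4 h5 h6 h7
  have hneg : g.eval u * g.eval v < 0 := by
    obtain ⟨q, hq⟩ : X - C y ∣ g.map i := dvd_iff_isRoot.2 (by rwa [IsRoot, eval_map])
    have hqy : q.eval y ≠ 0 := by
      intro h0
      apply hyi
      refine h1 g' hg'0 hg'd y ?_
      rw [← eval_map, ← derivative_map, hq]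
      simp [h0]
    have hqpos : 0 < q.eval (i u) * q.eval (i v) := by
      refine hR.sign_eq (fun w h3 h4 h5 => ?_) (huy.trans hyv).le
      have hw : g.eval₂ i w = 0 := by rw [← eval_map, hq]; simp [h5]
      rcases lt_trichotomy w y with h6 | rfl | h6
      · exact uniqi w y h3 h6 hyv.le hw hy
      · exact hqy h5
      · exact uniqi y w huy.le h6 h4 hy hw
    have h3 : i (g.eval u * g.eval v) < i 0 := by
      rw [map_mul, ← eval₂_at_apply, ← eval₂_at_apply, ← eval_map, ← eval_map, hq, map_zero]
      simp only [eval_mul, eval_sub, eval_X, eval_C]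
      have h4 : 0 < (y - i u) * (i v - y) := mul_pos (sub_pos.2 huy) (sub_pos.2 hyv)
      nlinarith [mul_pos h4 hqpos]
    exact hi.lt_iff_lt.1 h3
  obtain ⟨z, hz1, hz2, hz⟩ := hΩ (g.map j) (j u) (j v) (hj huv) (by
    rw [eval_map, eval_map, eval₂_at_apply, eval₂_at_apply, ← map_mul, ← map_zero j]
    exact hj hneg)
  rw [eval_map] at hz
  have hzj : z ∉ Set.range j := by
    rintro ⟨c, rfl⟩
    rw [eval₂_at_apply, map_eq_zero] at hz
    have hc : g.eval₂ i (i c) = 0 := by rw [eval₂_at_apply, hz, map_zero]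
    have h3 := hj.lt_iff_lt.1 hz1
    have h4 := hj.lt_iff_lt.1 hz2
    rcases lt_trichotomy (i c) y with h5 | h5 | h5
    · exact uniqi _ y (hi h3).le h5 hyv.le hc hy
    · exact hyi ⟨c, h5⟩
    · exact uniqi y _ huy.le h5 (hi h4).le hy hc
  have hcut : ∀ c, i c < y ↔ j c < z := by
    intro c
    rcases lt_or_ge c u with h3 | h3
    · exact ⟨fun _ => (hj h3).trans hz1, fun _ => (hi h3).trans huy⟩
    rcases lt_or_ge v c with h4 | h4
    · exact ⟨fun h => absurd (hyv.trans (hi h4)) h.not_gt,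
        fun h => absurd (hz2.trans (hj h4)) h.not_gt⟩
    rw [lt_root_iff hR hi uniqi huy hyv hy hyi hneg h3 h4,
      lt_root_iff hΩ hj uniqj hz1 hz2 hz hzj hneg h3 h4]
  obtain ⟨c, hc, -⟩ := hij y z (fun h => by
    have e1 : h.eval₂ i y = (h % g).eval₂ i y := by
      conv_lhs => rw [← EuclideanDomain.div_add_mod h g]
      simp [eval₂_add, eval₂_mul, hy]
    have e2 : h.eval₂ j z = (h % g).eval₂ j z := by
      conv_lhs => rw [← EuclideanDomain.div_add_mod h g]
      simp [eval₂_add, eval₂_mul, hz]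
    rw [e1, e2]
    by_cases h0 : h % g = 0
    · simp [h0]
    have hdeg : (h % g).natDegree < g.natDegree :=
      natDegree_lt_natDegree h0 (EuclideanDomain.mod_lt h hg)
    exact sign_of_same_cut hR hΩ hi hj (h1 _ h0 hdeg) (h2 _ h0 hdeg) hyi hzj hcut)
  exact hyi ⟨c, hc⟩

theorem MaxPair.root_mem (hR : PolyIVT R) (hΩ : PolyIVT Ω) {i : k →+* R}
    (hi : StrictMono i) {j : k →+* Ω} (hj : StrictMono j) (hij : MaxPair i j) {g : k[X]}
    (hg : g ≠ 0) : (∀ y, g.eval₂ i y = 0 → y ∈ Set.range i) ∧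
      (∀ y, g.eval₂ j y = 0 → y ∈ Set.range j) := by
  induction hd : g.natDegree using Nat.strong_induction_on generalizing g with
  | _ d ih =>
  subst hd
  exact ⟨fun y => hij.root_mem_of_lt hR hΩ hi hj hg (fun h h0 hlt => (ih _ hlt h0 rfl).1)
      (fun h h0 hlt => (ih _ hlt h0 rfl).2),
    fun y => hij.symm.root_mem_of_lt hΩ hR hj hi hg (fun h h0 hlt => (ih _ hlt h0 rfl).2)
      (fun h h0 hlt => (ih _ hlt h0 rfl).1)⟩

end Cuts
end

section
open Matrix Polynomial

/-- A subring of a product of ordered fields on which both coordinates have the same signs. -/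
def CoherentSubring {R Ω : Type*} [Field R] [LinearOrder R] [Field Ω] [LinearOrder Ω]
    (Γ : Subring (R × Ω)) : Prop :=
  ∀ x ∈ Γ, 0 ≤ x.1 ↔ 0 ≤ x.2

namespace CoherentSubring

variable {R Ω : Type*} [Field R] [LinearOrder R] [IsStrictOrderedRing R]
  [Field Ω] [LinearOrder Ω] [IsStrictOrderedRing Ω] {Γ : Subring (R × Ω)}

theorem eq_zero_iff (h : CoherentSubring Γ) {x : R × Ω} (hx : x ∈ Γ) : x.1 = 0 ↔ x.2 = 0 := by
  have h1 := h x hx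
  have h2 := h (-x) (neg_mem hx)
  simp only [Prod.fst_neg, Prod.snd_neg, Left.nonneg_neg_iff] at h2
  rw [le_antisymm_iff, le_antisymm_iff, h1, h2]

theorem exists_maximal (h : CoherentSubring Γ) :
    ∃ Γ', Γ ≤ Γ' ∧ Maximal (fun Γ : Subring (R × Ω) => CoherentSubring Γ) Γ' := by
  refine zorn_le_nonempty₀ {Γ : Subring (R × Ω) | CoherentSubring Γ} ?_ Γ h
  intro c hc hchain y hy
  refine ⟨sSup c, ?_, fun z hz => le_sSup hz⟩
  intro x hx
  obtain ⟨Δ, hΔ, hx⟩ := (Subring.mem_sSup_of_directedOn ⟨y, hy⟩ hchain.directedOn).1 hx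
  exact hc hΔ x hx

theorem unique (h : CoherentSubring Γ) {x : R} {y z : Ω} (hy : (x, y) ∈ Γ) (hz : (x, z) ∈ Γ) :
    y = z := by
  have := (h.eq_zero_iff (sub_mem hy hz)).1 (by simp)
  simpa [sub_eq_zero] using this

theorem inv_mem (h : Maximal (fun Γ : Subring (R × Ω) => CoherentSubring Γ) Γ) {x : R × Ω}
    (hx : x ∈ Γ) : x⁻¹ ∈ Γ := by
  by_cases hx0 : x.1 = 0
  · have hx1 := (h.prop.eq_zero_iff hx).1 hx0
    have : x = 0 := Prod.ext hx0 hx1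
    rw [this]
    convert Γ.zero_mem using 1
    ext <;> simp
  have hx1 : x.2 ≠ 0 := fun h0 => hx0 ((h.prop.eq_zero_iff hx).2 h0)
  let Δ : Subring (R × Ω) :=
    { carrier := {w | ∃ d ∈ Γ, d.1 ≠ 0 ∧ w * d ∈ Γ}
      zero_mem' := ⟨1, one_mem _, by simp, by simp⟩
      one_mem' := ⟨1, one_mem _, by simp, by simp⟩
      neg_mem' := by
        rintro w ⟨d, hd, hd0, hw⟩
        exact ⟨d, hd, hd0, by rw [neg_mul]; exact neg_mem hw⟩
      add_mem' := by
        rintro w w' ⟨d, hd, hd0, hw⟩ ⟨e, he, he0, hw'⟩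
        refine ⟨d * e, mul_mem hd he, by simp [hd0, he0], ?_⟩
        convert add_mem (mul_mem hw he) (mul_mem hw' hd) using 1; ring
      mul_mem' := by
        rintro w w' ⟨d, hd, hd0, hw⟩ ⟨e, he, he0, hw'⟩
        refine ⟨d * e, mul_mem hd he, by simp [hd0, he0], ?_⟩
        convert mul_mem hw hw' using 1; ring }
  have hΔ : CoherentSubring Δ := by
    rintro w ⟨d, hd, hd0, hw⟩
    have hd1 : d.2 ≠ 0 := fun h0 => hd0 ((h.prop.eq_zero_iff hd).2 h0)
    have h1 := h.prop _ (mul_mem hw hd)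
    simp only [Prod.fst_mul, Prod.snd_mul, mul_assoc] at h1
    rwa [mul_nonneg_iff_of_pos_right (mul_self_pos.2 hd0),
      mul_nonneg_iff_of_pos_right (mul_self_pos.2 hd1)] at h1
  refine h.le_of_ge hΔ (fun w hw => ⟨1, one_mem _, by simp, by simpa using hw⟩)
    ⟨x, hx, hx0, ?_⟩
  convert one_mem Γ using 1
  ext <;> simp [hx0, hx1]

/-- The first projection of a maximal coherent subring. -/
def fstField (h : Maximal (fun Γ : Subring (R × Ω) => CoherentSubring Γ) Γ) : Subfield R where
  carrier := {x | ∃ y, (x, y) ∈ Γ}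
  zero_mem' := ⟨0, zero_mem Γ⟩
  one_mem' := ⟨1, one_mem Γ⟩
  neg_mem' := fun ⟨y, hy⟩ => ⟨-y, neg_mem hy⟩
  add_mem' := fun ⟨y, hy⟩ ⟨z, hz⟩ => ⟨y + z, add_mem hy hz⟩
  mul_mem' := fun ⟨y, hy⟩ ⟨z, hz⟩ => ⟨y * z, mul_mem hy hz⟩
  inv_mem' := fun x ⟨y, hy⟩ => ⟨y⁻¹, inv_mem h hy⟩

/-- A maximal coherent subring is the graph of this embedding. -/
def sndHom (h : Maximal (fun Γ : Subring (R × Ω) => CoherentSubring Γ) Γ) :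
    fstField h →+* Ω where
  toFun x := x.2.choose
  map_zero' := h.prop.unique (fstField h).zero_mem.choose_spec (zero_mem Γ)
  map_one' := h.prop.unique (fstField h).one_mem.choose_spec (one_mem Γ)
  map_add' x y := h.prop.unique (x + y).2.choose_spec
    (add_mem x.2.choose_spec y.2.choose_spec)
  map_mul' x y := h.prop.unique (x * y).2.choose_spec
    (mul_mem x.2.choose_spec y.2.choose_spec)

theorem sndHom_mem (h : Maximal (fun Γ : Subring (R × Ω) => CoherentSubring Γ) Γ)
    (x : fstField h) : ((x : R), sndHom h x) ∈ Γ := x.2.choose_spec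

theorem sndHom_strictMono (h : Maximal (fun Γ : Subring (R × Ω) => CoherentSubring Γ) Γ) :
    StrictMono (sndHom h) := by
  refine Monotone.strictMono_of_injective (fun x y hxy => ?_) (sndHom h).injective
  have := (h.prop _ (sndHom_mem h (y - x))).1 (by simpa using hxy)
  simpa using this

theorem maxPair (h : Maximal (fun Γ : Subring (R × Ω) => CoherentSubring Γ) Γ) :
    MaxPair (fstField h).subtype (sndHom h) := by
  intro y z hyz
  let F : (fstField h)[X] →+* R × Ω :=
    (eval₂RingHom (fstField h).subtype y).prod (eval₂RingHom (sndHom h) z)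
  have h1 : CoherentSubring F.range := by
    rintro _ ⟨g, rfl⟩
    exact hyz g
  have h2 : F.range ≤ Γ := by
    refine h.le_of_ge h1 ?_
    rintro ⟨x, w⟩ hx
    refine ⟨C ⟨x, w, hx⟩, ?_⟩
    have : sndHom h ⟨x, w, hx⟩ = w := h.prop.unique (sndHom_mem h _) hx
    simp [F, this]
  have h3 : (y, z) ∈ Γ := h2 ⟨X, by simp [F]⟩
  exact ⟨⟨y, z, h3⟩, rfl, h.prop.unique (sndHom_mem h _) h3⟩

end CoherentSubring

/-- Finite polynomial systems over `A` solvable in `B` are solvable in `A`. -/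
def SolvesDown {A B : Type*} [CommRing A] [CommRing B] (e : A →+* B) : Prop :=
  ∀ (σ : Type) (_ : Finite σ) (F : Finset (MvPolynomial σ A)) (y : σ → B),
    (∀ f ∈ F, MvPolynomial.eval₂ e y f = 0) → ∃ x : σ → A, ∀ f ∈ F, MvPolynomial.eval x f = 0

theorem SolvesDown.comp {A B D : Type*} [CommRing A] [CommRing B] [CommRing D] {e : A →+* B}
    {e' : B →+* D} (he : SolvesDown e) (he' : SolvesDown e') : SolvesDown (e'.comp e) := by
  classical
  intro σ hσ F y hy
  obtain ⟨x, hx⟩ := he' σ hσ (F.image (MvPolynomial.map e)) y (by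
    intro f hf
    obtain ⟨f', hf', rfl⟩ := Finset.mem_image.1 hf
    rw [MvPolynomial.eval₂_map]
    exact hy f' hf')
  refine he σ hσ F x fun f hf => ?_
  have := hx _ (Finset.mem_image_of_mem _ hf)
  rwa [MvPolynomial.eval_map] at this

section Germ

open Filter

variable {ι Ω : Type*} [Field Ω] [LinearOrder Ω] [IsStrictOrderedRing Ω] (U : Ultrafilter ι)

/-- The constant embedding into an ultrapower. -/
def germConst : Ω →+* Germ (U : Filter ι) Ω := (Germ.coeRingHom _).comp (Pi.constRingHom ι Ω)

theorem solvesDown_germConst : SolvesDown (germConst (Ω := Ω) U) := by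
  intro σ hσ F y hy
  have : ∀ s, ∃ w : ι → Ω, (w : Germ (U : Filter ι) Ω) = y s := fun s =>
    Quotient.exists_rep (y s)
  choose w hw using this
  have key : ∀ f, MvPolynomial.eval₂ (germConst U) y f =
      ((fun t => MvPolynomial.eval (fun s => w s t) f : ι → Ω) : Germ (U : Filter ι) Ω) := by
    intro f
    have : MvPolynomial.eval₂Hom (germConst U) y = (Germ.coeRingHom (U : Filter ι)).comp
        (RingHom.pi fun t => MvPolynomial.eval (fun s => w s t)) := by
      refine MvPolynomial.ringHom_ext (fun r => ?_) (fun s => ?_)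
      · simp [germConst]
        exact Eventually.of_forall fun t => (MvPolynomial.eval_C (f := fun s => w s t) r).symm
      · simp only [MvPolynomial.coe_eval₂Hom, MvPolynomial.eval₂_X, ← hw]
        simp
        exact Eventually.of_forall fun t => (MvPolynomial.eval_X (f := fun s => w s t) s).symm
    exact congrArg (fun g => g f) this
  have h1 : ∀ᶠ t in (U : Filter ι), ∀ f ∈ F, MvPolynomial.eval (fun s => w s t) f = 0 := by
    rw [eventually_all_finset]
    intro f hf
    have := hy f hf
    rw [key] at this
    exact Germ.coe_eq.1 this
  obtain ⟨t, ht⟩ := h1.exists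
  exact ⟨_, ht⟩

theorem PolyIVT.germ (hΩ : PolyIVT Ω) : PolyIVT (Germ (U : Filter ι) Ω) := by
  intro f a b hab hf
  obtain ⟨a, rfl⟩ := Quotient.exists_rep a
  obtain ⟨b, rfl⟩ := Quotient.exists_rep b
  have : ∀ l, ∃ w : ι → Ω, (w : Germ (U : Filter ι) Ω) = f.coeff l := fun s =>
    Quotient.exists_rep (f.coeff s)
  choose w hw using this
  let p : ι → Polynomial Ω := fun t => ∑ l ∈ Finset.range (f.natDegree + 1), C (w l t) * X ^ l
  have key : ∀ c : ι → Ω, f.eval (c : Germ (U : Filter ι) Ω) =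
      ((fun t => (p t).eval (c t) : ι → Ω) : Germ (U : Filter ι) Ω) := by
    intro c
    rw [eval_eq_sum_range]
    have : (fun t => (p t).eval (c t)) = ∑ l ∈ Finset.range (f.natDegree + 1), w l * c ^ l := by
      ext t
      simp [p, eval_finsetSum]
    rw [this]
    change _ = Germ.coeRingHom (U : Filter ι) _
    rw [map_sum]
    refine Finset.sum_congr rfl fun l _ => ?_
    rw [map_mul, map_pow, ← hw]
    rfl
  change ((a : ι → Ω) : Germ (U : Filter ι) Ω) < (b : ι → Ω) at hab
  change f.eval ((a : ι → Ω) : Germ (U : Filter ι) Ω) * f.eval ((b : ι → Ω) : Germ (U : Filter ι) Ω)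
    < ((0 : ι → Ω) : Germ (U : Filter ι) Ω) at hf
  rw [key, key, ← Germ.coe_mul, Germ.coe_lt] at hf
  rw [Germ.coe_lt] at hab
  have h1 : ∀ᶠ t in (U : Filter ι), ∃ c, a t < c ∧ c < b t ∧ (p t).eval c = 0 := by
    filter_upwards [hab, hf] with t h1 h2
    exact hΩ _ _ _ h1 h2
  classical
  let c : ι → Ω := fun t =>
    if h : ∃ c, a t < c ∧ c < b t ∧ (p t).eval c = 0 then h.choose else 0
  have h2 : ∀ᶠ t in (U : Filter ι), a t < c t ∧ c t < b t ∧ (p t).eval (c t) = 0 := by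
    filter_upwards [h1] with t ht
    simp only [c, dif_pos ht]
    exact ht.choose_spec
  refine ⟨(c : Germ (U : Filter ι) Ω), Germ.coe_lt.2 (h2.mono fun t h => h.1),
    Germ.coe_lt.2 (h2.mono fun t h => h.2.1), ?_⟩
  rw [key]
  exact Germ.coe_eq.2 (h2.mono fun t h => h.2.2)

end Germ

theorem CoherentSubring.exists_adjoin {R : Type*} {Ω : Type} [Field R] [LinearOrder R]
    [IsStrictOrderedRing R] [Field Ω] [LinearOrder Ω] [IsStrictOrderedRing Ω]
    (hR : PolyIVT R) (hΩ : PolyIVT Ω) {Γ : Subring (R × Ω)} (hΓ : CoherentSubring Γ) (a : R) :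
    ∃ (Ω' : Type) (_ : Field Ω') (_ : LinearOrder Ω') (_ : IsStrictOrderedRing Ω')
      (e : Ω →+* Ω') (Γ' : Subring (R × Ω')), PolyIVT Ω' ∧ SolvesDown e ∧ CoherentSubring Γ' ∧
      (∀ x ∈ Γ, (x.1, e x.2) ∈ Γ') ∧ ∃ b, (a, b) ∈ Γ' := by
  obtain ⟨Δ, hΓΔ, hΔ⟩ := hΓ.exists_maximal
  by_cases ha : a ∈ CoherentSubring.fstField hΔ
  · refine ⟨Ω, inferInstance, inferInstance, inferInstance, RingHom.id _, Δ, hΩ, ?_, hΔ.prop,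
      fun x hx => hΓΔ hx, ha⟩
    intro σ _ F y hy
    exact ⟨y, hy⟩
  set k := CoherentSubring.fstField hΔ
  let i : k →+* R := k.subtype
  have hi : StrictMono i := fun x y hxy => hxy
  let j : k →+* Ω := CoherentSubring.sndHom hΔ
  have hj : StrictMono j := CoherentSubring.sndHom_strictMono hΔ
  have hai : a ∉ Set.range i := by
    rintro ⟨c, rfl⟩
    exact ha c.2
  have hroots := fun {g : k[X]} (hg : g ≠ 0) =>
    (CoherentSubring.maxPair hΔ).root_mem hR hΩ hi hj hg
  classical
  let B : k → Set Ω := fun c => {z | (i c < a → j c < z) ∧ (a < i c → z < j c)}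
  obtain ⟨U, hU⟩ := Ultrafilter.exists_ultrafilter_of_finite_inter_nonempty (Set.range B) (by
    intro T hT
    obtain ⟨t, rfl⟩ : ∃ t : Finset k, t.image B = T := by
      rw [← Set.image_univ, Finset.subset_set_image_iff] at hT
      obtain ⟨t, -, ht⟩ := hT
      exact ⟨t, ht⟩
    obtain ⟨m, h1, h2⟩ := Order.exists_between_finsets
      (lo := t.filter (fun c => i c < a)) (hi := t.filter (fun c => a < i c)) (by
        intro x hx y hy
        exact hi.lt_iff_lt.1 ((Finset.mem_filter.1 hx).2.trans (Finset.mem_filter.1 hy).2))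
    refine ⟨j m, ?_⟩
    simp only [Finset.coe_image, Set.sInter_image, Set.mem_iInter]
    intro c hc
    exact ⟨fun h => hj (h1 c (Finset.mem_filter.2 ⟨hc, h⟩)),
      fun h => hj (h2 c (Finset.mem_filter.2 ⟨hc, h⟩))⟩)
  have hB : ∀ c, ∀ᶠ z in (U : Filter Ω), (i c < a → j c < z) ∧ (a < i c → z < j c) :=
    fun c => hU ⟨c, rfl⟩
  let ω : Filter.Germ (U : Filter Ω) Ω := ((id : Ω → Ω) : Filter.Germ (U : Filter Ω) Ω)
  let e : Ω →+* Filter.Germ (U : Filter Ω) Ω := germConst U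
  have hω : ∀ h : k[X], h.eval₂ (e.comp j) ω =
      ((fun z => h.eval₂ j z : Ω → Ω) : Filter.Germ (U : Filter Ω) Ω) := by
    intro h
    have : eval₂RingHom (e.comp j) ω = (Filter.Germ.coeRingHom (U : Filter Ω)).comp
        (RingHom.pi fun z => eval₂RingHom j z) := by
      refine Polynomial.ringHom_ext (fun r => ?_) ?_
      · simp only [coe_eval₂RingHom, eval₂_C]
        refine Filter.Germ.coe_eq.2 (Filter.Eventually.of_forall fun t => ?_)
        exact (eval₂_C j t).symm
      · simp only [coe_eval₂RingHom, eval₂_X]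
        refine Filter.Germ.coe_eq.2 (Filter.Eventually.of_forall fun t => ?_)
        exact (eval₂_X j t).symm
    exact congrArg (fun g => g h) this
  let F : k[X] →+* R × Filter.Germ (U : Filter Ω) Ω :=
    (eval₂RingHom i a).prod (eval₂RingHom (e.comp j) ω)
  refine ⟨Filter.Germ (U : Filter Ω) Ω, inferInstance, inferInstance, inferInstance, e, F.range,
    hΩ.germ U, solvesDown_germConst U, ?_, ?_, ω, X, by simp [F]⟩
  · rintro _ ⟨h, rfl⟩
    change 0 ≤ h.eval₂ i a ↔ 0 ≤ h.eval₂ (e.comp j) ω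
    by_cases h0 : h = 0
    · simp [h0]
    obtain ⟨m, hm⟩ := exists_same_gap hi h0 hai
    rw [hω, sign_in_gap hR hi (hroots h0).1 hm]
    have h1 : ∀ᶠ z in (U : Filter Ω), 0 ≤ h.eval₂ j z ↔ 0 ≤ h.eval m := by
      have h2 : ∀ᶠ z in (U : Filter Ω), ∀ c ∈ h.roots.toFinset,
          (i c < a → j c < z) ∧ (a < i c → z < j c) := by
        rw [Filter.eventually_all_finset]
        exact fun c _ => hB c
      filter_upwards [h2] with z hz
      refine sign_in_gap hΩ hj (hroots h0).2 fun c hc => ?_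
      have := hz c (by simp [h0, hc])
      exact (hm c hc).imp (fun h => ⟨this.1 h.1, h.2⟩) (fun h => ⟨this.2 h.1, h.2⟩)
    change _ ↔ ((0 : Ω → Ω) : Filter.Germ (U : Filter Ω) Ω) ≤ _
    rw [Filter.Germ.coe_le]
    constructor
    · intro h2
      exact h1.mono fun z hz => hz.2 h2
    · intro h2
      obtain ⟨z, hz, hz'⟩ := (h1.and h2).exists
      exact hz.1 hz'
  · rintro ⟨x, y⟩ hx
    have hx' := hΓΔ hx
    refine ⟨C ⟨x, y, hx'⟩, ?_⟩
    have : j ⟨x, y, hx'⟩ = y := hΔ.prop.unique (CoherentSubring.sndHom_mem hΔ _) hx'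
    simp only [F, RingHom.prod_apply, coe_eval₂RingHom, eval₂_C, RingHom.comp_apply, this]
    rfl

theorem polyIVT_real : PolyIVT ℝ := by
  intro f a b hab hf
  rcases mul_neg_iff.1 hf with ⟨h1, h2⟩ | ⟨h1, h2⟩
  · obtain ⟨c, hc, h0⟩ := intermediate_value_Ioo' hab.le f.continuous.continuousOn ⟨h2, h1⟩
    exact ⟨c, hc.1, hc.2, h0⟩
  · obtain ⟨c, hc, h0⟩ := intermediate_value_Ioo hab.le f.continuous.continuousOn ⟨h1, h2⟩
    exact ⟨c, hc.1, hc.2, h0⟩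

/-- The Artin–Lang transfer principle: finite real polynomial systems solvable in `R` are
solvable in `ℝ`. -/
theorem PolyIVT.solvesDown {R : Type*} [Field R] [LinearOrder R] [IsStrictOrderedRing R]
    (hR : PolyIVT R) (φ : ℝ →+* R) : SolvesDown φ := by
  have key : ∀ l : List R, ∃ (Ω : Type) (_ : Field Ω) (_ : LinearOrder Ω)
      (_ : IsStrictOrderedRing Ω) (e : ℝ →+* Ω) (Γ : Subring (R × Ω)), PolyIVT Ω ∧ SolvesDown e ∧
      CoherentSubring Γ ∧ (∀ r, (φ r, e r) ∈ Γ) ∧ ∀ a ∈ l, ∃ b, (a, b) ∈ Γ := by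
    intro l
    induction l with
    | nil =>
      refine ⟨ℝ, inferInstance, inferInstance, inferInstance, RingHom.id ℝ,
        (φ.prod (RingHom.id ℝ)).range, polyIVT_real, fun σ _ F y hy => ⟨y, hy⟩, ?_,
        fun r => ⟨r, rfl⟩, by simp⟩
      rintro _ ⟨r, rfl⟩
      change 0 ≤ φ r ↔ 0 ≤ r
      constructor
      · intro h
        by_contra! hr
        have h1 : φ r = -(φ (√(-r)) * φ (√(-r))) := by
          rw [← map_mul, Real.mul_self_sqrt (by linarith), map_neg, neg_neg]
        have h2 : φ r = 0 := le_antisymm (by rw [h1]; simpa using mul_self_nonneg _) h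
        exact hr.ne ((map_eq_zero _).1 h2)
      · intro h
        rw [← Real.mul_self_sqrt h, map_mul]
        exact mul_self_nonneg _
    | cons a l ih =>
      obtain ⟨Ω, _, _, _, e, Γ, hΩ, he, hΓ, hr, hl⟩ := ih
      obtain ⟨Ω', _, _, _, e', Γ', hΩ', he', hΓ', hx, b, hb⟩ := hΓ.exists_adjoin hR hΩ a
      refine ⟨Ω', inferInstance, inferInstance, inferInstance, e'.comp e, Γ', hΩ', he.comp he',
        hΓ', fun r => hx _ (hr r), ?_⟩
      intro c hc
      rcases List.mem_cons.1 hc with rfl | hc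
      · exact ⟨b, hb⟩
      · obtain ⟨d, hd⟩ := hl c hc
        exact ⟨_, hx _ hd⟩
  intro σ hσ F y hy
  have := Fintype.ofFinite σ
  obtain ⟨Ω, _, _, _, e, Γ, hΩ, he, hΓ, hr, hl⟩ := key (Finset.univ.toList.map y)
  have : ∀ s, ∃ b, (y s, b) ∈ Γ := fun s => hl _ (List.mem_map.2 ⟨s, by simp, rfl⟩)
  choose z hz using this
  refine he σ hσ F z fun f hf => ?_
  have h1 : (MvPolynomial.eval₂ φ y f, MvPolynomial.eval₂ e z f) ∈ Γ := by
    clear hf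
    induction f using MvPolynomial.induction_on with
    | C r => simpa using hr r
    | add p q hp hq => simpa using add_mem hp hq
    | mul_X p s hp => simpa using mul_mem hp (hz s)
  exact (hΓ.eq_zero_iff h1).1 (hy f hf)
end

section
open Matrix Polynomial

/-- `f` and `p` satisfy Newton's identities: `f` plays the role of the elementary symmetric
functions, `p` the role of the power sums. -/
def IsNewton {B : Type*} [CommRing B] (f p : ℕ → B) : Prop :=
  f 0 = 1 ∧ ∀ m : ℕ, ((m : B) + 1) * f (m + 1) =
    ∑ i ∈ Finset.range (m + 1), (-1) ^ i * f (m - i) * p (i + 1)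

namespace IsNewton

variable {B : Type*} [CommRing B] {f p : ℕ → B}

theorem mem {K : Type*} [Field K] [CharZero K] [Algebra K B] (h : IsNewton f p)
    (D : Subalgebra K B) (m : ℕ) (hp : ∀ i < m, p (i + 1) ∈ D) : f m ∈ D := by
  induction m using Nat.strong_induction_on with
  | _ m ih =>
    cases m with
    | zero => rw [h.1]; exact D.one_mem
    | succ m =>
      have e : f (m + 1) = ((m : K) + 1)⁻¹ • (((m : B) + 1) * f (m + 1)) := by
        have : ((m : B) + 1) = algebraMap K B ((m : K) + 1) := by simp
        rw [this, ← Algebra.smul_def, smul_smul, inv_mul_cancel₀ (Nat.cast_add_one_ne_zero m),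
          one_smul]
      rw [e, h.2 m]
      refine D.smul_mem (D.sum_mem fun i hi =>
        D.mul_mem (D.mul_mem ?_ ?_) (hp i (Finset.mem_range.1 hi))) _
      · exact D.pow_mem (D.neg_mem D.one_mem) i
      · exact ih _ (by omega) fun j hj => hp j (by omega)

end IsNewton

variable {B : Type*} [CommRing B] {ι : Type*} [Fintype ι] [DecidableEq ι]

/-- The polynomial `det (1 + t M)`. -/
def detOneAdd (M : Matrix ι ι B) : B[X] := det (1 + (X : B[X]) • M.map C)

theorem detOneAdd_natDegree_le (M : Matrix ι ι B) :
    (detOneAdd M).natDegree ≤ Fintype.card ι := by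
  have := natDegree_det_X_add_C_le M (1 : Matrix ι ι B)
  rwa [Matrix.map_one _ C.map_zero C.map_one, add_comm] at this

theorem detOneAdd_coeff_zero (M : Matrix ι ι B) : (detOneAdd M).coeff 0 = 1 := by
  rw [detOneAdd, det_one_add_X_smul]
  simp [sq]

theorem detOneAdd_derivative (M : Matrix ι ι B) :
    ((derivative (detOneAdd M) : B[X]) : PowerSeries B) =
      (detOneAdd M : PowerSeries B) * PowerSeries.mk fun i => (-1) ^ i * trace (M ^ (i + 1)) := by
  let N : Matrix ι ι (PowerSeries B) := M.map (PowerSeries.C (R := B))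
  let x : (PowerSeries B) := PowerSeries.X
  let G : Matrix ι ι (PowerSeries B) :=
    Matrix.of fun a b => PowerSeries.mk fun k => (-1) ^ k * (M ^ k) a b
  have hGN : G * N = Matrix.of fun a b => PowerSeries.mk fun k => (-1) ^ k * (M ^ (k + 1)) a b := by
    ext a b k
    simp only [Matrix.mul_apply, map_sum, G, N, Matrix.of_apply, Matrix.map_apply,
      PowerSeries.coeff_mul_C, PowerSeries.coeff_mk, pow_succ M, Finset.mul_sum, mul_assoc]
  have hNG : N * G = G * N := by
    rw [hGN]
    ext a b k
    simp only [Matrix.mul_apply, map_sum, G, N, Matrix.of_apply, Matrix.map_apply,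
      PowerSeries.coeff_C_mul, PowerSeries.coeff_mk, pow_succ' M, Finset.mul_sum]
    exact Finset.sum_congr rfl fun c _ => by ring
  have hinv : (1 + x • N) * G = 1 := by
    rw [add_mul, one_mul, smul_mul_assoc, hNG, hGN]
    ext a b k
    cases k with
    | zero =>
      by_cases hab : a = b
      · subst hab; simp [G, x]
      · simp [G, x, hab]
    | succ k =>
      by_cases hab : a = b
      · subst hab
        simp [G, x, PowerSeries.coeff_succ_X_mul, PowerSeries.coeff_one]; ring
      · simp [G, x, hab, PowerSeries.coeff_succ_X_mul]; ring
  let E : (PowerSeries B)[X] := (detOneAdd M).map (PowerSeries.C (R := B))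
  have hE : E = det (1 + (X : (PowerSeries B)[X]) • N.map C) := by
    simp only [E, detOneAdd, ← coe_mapRingHom, RingHom.map_det]
    congr 1
    ext a b : 2
    simp [N, Matrix.one_apply, apply_ite]
  have hev : ∀ q : B[X], (q.map (PowerSeries.C (R := B))).eval x = (q : (PowerSeries B)) := by
    intro q
    rw [eval_map]
    induction q using Polynomial.induction_on' with
    | add p q hp hq => simp [eval₂_add, hp, hq]
    | monomial n a =>
      rw [eval₂_monomial, ← C_mul_X_pow_eq_monomial]
      simp [x]
  have h1 : E.comp (C x + X) = det ((1 + x • N).map C) *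
      det (1 + (X : (PowerSeries B)[X]) • (G * N).map C) := by
    have e0 : E.comp (C x + X) = det (1 + (C x + X : (PowerSeries B)[X]) • N.map C) := by
      rw [hE, ← coe_compRingHom_apply, RingHom.map_det]
      congr 1
      ext a b : 2
      by_cases hab : a = b
      · subst hab; simp; ring
      · simp [hab]; ring
    rw [e0, ← det_mul]
    congr 1
    have e1 : (1 + x • N).map (C : (PowerSeries B) →+* (PowerSeries B)[X]) = 1 + C x • N.map C := by
      ext a b : 2
      simp [Matrix.one_apply, apply_ite]
    have e2 : (1 + x • N).map (C : (PowerSeries B) →+* (PowerSeries B)[X]) *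
        (G * N).map C = N.map C := by
      rw [← Matrix.map_mul, ← mul_assoc, hinv, one_mul]
    rw [mul_add, mul_one, Matrix.mul_smul, e2, e1, add_smul, add_assoc]
  have h2 := congrArg (fun q => (derivative q).eval 0) h1
  have h3 : (1 + x • N).det = (detOneAdd M : PowerSeries B) := by
    rw [← hev, show (detOneAdd M).map PowerSeries.C = E from rfl, hE, ← coe_evalRingHom,
      RingHom.map_det]
    congr 1
    ext a b : 2
    by_cases hab : a = b
    · subst hab; simp [mul_comm x]
    · simp [hab, mul_comm x]
  have h5 : det ((1 + x • N).map (C : _ →+* (PowerSeries B)[X])) = C (det (1 + x • N)) := by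
    rw [RingHom.map_det]; rfl
  rw [h5, h3] at h2
  simp only [derivative_comp, derivative_mul, derivative_C, zero_mul, zero_add, eval_mul, eval_C,
    derivative_det_one_add_X_smul, derivative_add, derivative_X, eval_comp, eval_add, eval_X,
    add_zero, one_mul] at h2
  rw [derivative_map, hev] at h2
  rw [h2, hGN]
  congr 1
  ext k
  simp [trace, Finset.mul_sum]

theorem isNewton_of_derivative_eq {q : B[X]} {p : ℕ → B} (h0 : q.coeff 0 = 1)
    (h : ((derivative q : B[X]) : PowerSeries B) =
      (q : PowerSeries B) * PowerSeries.mk fun i => (-1) ^ i * p (i + 1)) :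
    IsNewton q.coeff p := by
  refine ⟨h0, fun m => ?_⟩
  have := congrArg (PowerSeries.coeff m) h
  rw [Polynomial.coeff_coe, coeff_derivative, mul_comm (q : PowerSeries B), PowerSeries.coeff_mul,
    Finset.Nat.sum_antidiagonal_eq_sum_range_succ_mk] at this
  rw [mul_comm, this]
  refine Finset.sum_congr rfl fun i hi => ?_
  simp only [PowerSeries.coeff_mk, Polynomial.coeff_coe]
  ring

/-- Newton's identities for the characteristic polynomial of a matrix. -/
theorem isNewton_detOneAdd (M : Matrix ι ι B) :
    IsNewton (detOneAdd M).coeff (fun i => trace (M ^ i)) :=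
  isNewton_of_derivative_eq (detOneAdd_coeff_zero M) (detOneAdd_derivative M)

theorem detOneAdd_neg (M : Matrix ι ι B) : detOneAdd (-M) = M.charpolyRev := by
  rw [detOneAdd, Matrix.charpolyRev]
  congr 1
  ext a b : 2
  simp [sub_eq_add_neg]

theorem charpoly_coeff_eq_detOneAdd [Nontrivial B] (M : Matrix ι ι B) {k : ℕ}
    (hk : k ≤ Fintype.card ι) :
    M.charpoly.coeff k = (detOneAdd (-M)).coeff (Fintype.card ι - k) := by
  rw [detOneAdd_neg, ← reverse_charpoly, coeff_reverse, charpoly_natDegree_eq_dim,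
    revAt_le (Nat.sub_le _ _), Nat.sub_sub_self hk]

theorem pow_card_eq_neg_sum [Nontrivial B] (M : Matrix ι ι B) :
    M ^ Fintype.card ι = -∑ k ∈ Finset.range (Fintype.card ι), M.charpoly.coeff k • M ^ k := by
  have h := aeval_self_charpoly M
  rw [aeval_eq_sum_range, charpoly_natDegree_eq_dim, Finset.sum_range_succ] at h
  have h1 : M.charpoly.coeff (Fintype.card ι) = 1 := by
    have := (charpoly_monic M).coeff_natDegree
    rwa [charpoly_natDegree_eq_dim] at this
  rw [h1, one_smul] at h
  exact eq_neg_of_add_eq_zero_right h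

/-- The determinant of an alternating matrix over a field is a square. -/
theorem isSquare_det_of_transpose_eq_neg {F : Type*} [Field F] (h2 : (2 : F) ≠ 0) :
    ∀ (n : ℕ) (M : Matrix (Fin n) (Fin n) F), Mᵀ = -M → IsSquare M.det := by
  intro n
  induction n using Nat.strong_induction_on with
  | _ n ih =>
    intro M hM
    have hs : ∀ i j, M i j = -M j i := fun i j => by
      have := congrFun (congrFun hM j) i
      simpa using this
    have hd : ∀ i, M i i = 0 := fun i => by
      have := hs i i
      have : 2 * M i i = 0 := by linear_combination this
      exact (mul_eq_zero.1 this).resolve_left h2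
    match n with
    | 0 => simp
    | 1 => rw [det_fin_one, hd]; exact ⟨0, by simp⟩
    | m + 2 =>
      by_cases h0 : ∃ j, M 0 j ≠ 0
      swap
      · push Not at h0
        rw [det_eq_zero_of_row_eq_zero 0 h0]
        exact ⟨0, by simp⟩
      obtain ⟨j, hj⟩ := h0
      have hj0 : j ≠ 0 := fun h => hj (h ▸ hd 0)
      let e : Fin 2 ⊕ Fin m ≃ Fin (m + 2) :=
        (finSumFinEquiv.trans (finCongr (add_comm 2 m))).trans (Equiv.swap 1 j)
      have e0 : e (Sum.inl 0) = 0 := by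
        have h1 : finCongr (add_comm 2 m) (finSumFinEquiv (Sum.inl (0 : Fin 2))) = 0 := by
          ext; simp
        simp only [e, Equiv.trans_apply, h1]
        exact Equiv.swap_apply_of_ne_of_ne (by simp) hj0.symm
      have e1 : e (Sum.inl 1) = j := by
        have h1 : finCongr (add_comm 2 m) (finSumFinEquiv (Sum.inl (1 : Fin 2))) = 1 := by
          ext; simp
        simp only [e, Equiv.trans_apply, h1]
        exact Equiv.swap_apply_left _ _
      let N := M.submatrix e e
      have hN : Nᵀ = -N := by rw [transpose_submatrix, hM]; rfl
      rw [← det_submatrix_equiv_self e M]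
      change IsSquare N.det
      rw [← fromBlocks_toBlocks N] at hN ⊢
      rw [fromBlocks_transpose, fromBlocks_neg, fromBlocks_inj] at hN
      obtain ⟨hA, hC, hB, hD⟩ := hN
      have hdet : N.toBlocks₁₁.det = M 0 j * M 0 j := by
        rw [det_fin_two]
        simp only [toBlocks₁₁, of_apply, N, submatrix_apply, e0, e1, hd]
        rw [hs j 0]; ring
      have hu : IsUnit N.toBlocks₁₁.det := by
        rw [hdet]; exact (mul_ne_zero hj hj).isUnit
      let := N.toBlocks₁₁.invertibleOfIsUnitDet hu
      rw [det_fromBlocks₁₁, hdet]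
      refine IsSquare.mul ⟨_, rfl⟩ (ih m (by omega) _ ?_)
      have hi : (⅟N.toBlocks₁₁)ᵀ = -⅟N.toBlocks₁₁ := by
        rw [invOf_eq_nonsing_inv, transpose_nonsing_inv, hA]
        apply inv_eq_left_inv
        rw [neg_mul_neg, nonsing_inv_mul _ hu]
      rw [transpose_sub, transpose_mul, transpose_mul, hC, hi, hD, hB]
      simp [Matrix.mul_assoc, sub_eq_add_neg, add_comm]

/-- For skew matrices `x` and `y`, the characteristic polynomial of `x * y` is a square. -/
theorem exists_detOneAdd_mul_eq_sq [IsDomain B] [IsIntegrallyClosed B[X]] [Algebra ℚ B] {n : ℕ}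
    {x y : Matrix (Fin n) (Fin n) B} (hx : xᵀ = -x) (hy : yᵀ = -y) :
    ∃ q : B[X], detOneAdd (x * y) = q * q ∧ q.coeff 0 = 1 := by
  have : CharZero B := algebraRat.charZero B
  let F := FractionRing B[X]
  have h2 : (2 : F) ≠ 0 := by
    have : (2 : F) = algebraMap B[X] F 2 := (map_ofNat _ 2).symm
    rw [this, Ne, FaithfulSMul.algebraMap_eq_zero_iff]
    exact two_ne_zero
  let M : Matrix (Fin n ⊕ Fin n) (Fin n ⊕ Fin n) B[X] :=
    fromBlocks (y.map C) (-1) 1 ((X : B[X]) • x.map C)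
  have hM : Mᵀ = -M := by
    simp only [M, fromBlocks_transpose, fromBlocks_neg, transpose_neg, transpose_one, neg_neg,
      transpose_smul, ← smul_neg]
    congr 1
    · rw [← transpose_map, hy]; ext; simp
    · congr 1; rw [← transpose_map, hx]; ext; simp
  have hdet : detOneAdd (x * y) = M.det := by
    let U : Matrix (Fin n ⊕ Fin n) (Fin n ⊕ Fin n) B[X] := fromBlocks 1 1 0 1
    let L : Matrix (Fin n ⊕ Fin n) (Fin n ⊕ Fin n) B[X] := fromBlocks 1 0 (-1) 1
    have e : M * U * L * U = fromBlocks 1 (y.map C) (-((X : B[X]) • x.map C)) 1 := by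
      simp [M, U, L, fromBlocks_multiply]
    have h := congrArg det e
    have hU : U.det = 1 := by simp [U]
    have hL : L.det = 1 := by simp [L]
    rw [det_mul, det_mul, det_mul, hU, hL, det_fromBlocks_one₁₁, mul_one, mul_one, mul_one] at h
    rw [h, detOneAdd, Matrix.map_mul]
    simp
  let N : Matrix (Fin (n + n)) (Fin (n + n)) F :=
    (M.submatrix finSumFinEquiv.symm finSumFinEquiv.symm).map (algebraMap B[X] F)
  have hN : Nᵀ = -N := by
    simp only [N, ← transpose_map, transpose_submatrix, hM]
    ext; simp
  obtain ⟨r, hr⟩ := isSquare_det_of_transpose_eq_neg h2 _ N hN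
  have hr' : algebraMap B[X] F (detOneAdd (x * y)) = r * r := by
    rw [← hr, hdet, ← det_submatrix_equiv_self finSumFinEquiv.symm M, RingHom.map_det]; rfl
  obtain ⟨q, hq⟩ := IsIntegrallyClosed.exists_algebraMap_eq_of_isIntegral_pow (R := B[X])
    (x := r) (n := 2) two_pos (by rw [sq, ← hr']; exact isIntegral_algebraMap)
  have hqq : detOneAdd (x * y) = q * q := by
    apply FaithfulSMul.algebraMap_injective B[X] F
    rw [hr', map_mul, hq]
  have h0 := congrArg (fun p => p.coeff 0) hqq
  simp only [detOneAdd_coeff_zero, mul_coeff_zero] at h0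
  rcases mul_self_eq_one_iff.1 h0.symm with h | h
  · exact ⟨q, hqq, h⟩
  · exact ⟨-q, by rw [hqq]; ring, by simp [h]⟩

theorem exists_isNewton_half [IsDomain B] [IsIntegrallyClosed B[X]] [Algebra ℚ B] {n : ℕ}
    {x y : Matrix (Fin n) (Fin n) B} (hx : xᵀ = -x) (hy : yᵀ = -y) {p : ℕ → B}
    (hp : ∀ i, 2 * p i = trace ((x * y) ^ i)) :
    ∃ f, IsNewton f p ∧ ∀ m, n < 2 * m → f m = 0 := by
  have : CharZero B := algebraRat.charZero B
  obtain ⟨q, hq, h0⟩ := exists_detOneAdd_mul_eq_sq hx hy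
  have hq0 : q ≠ 0 := by rintro rfl; simp at h0
  refine ⟨q.coeff, isNewton_of_derivative_eq h0 ?_, fun m hm => ?_⟩
  · have h := detOneAdd_derivative (x * y)
    rw [hq] at h
    have hP : (PowerSeries.mk fun i => (-1) ^ i * trace ((x * y) ^ (i + 1))) =
        2 * PowerSeries.mk fun i => (-1) ^ i * p (i + 1) := by
      ext k
      rw [two_mul, map_add]
      simp only [PowerSeries.coeff_mk, ← hp]
      ring
    rw [hP, derivative_mul] at h
    have hne : (2 : PowerSeries B) * (q : PowerSeries B) ≠ 0 := by
      refine mul_ne_zero ?_ (by simpa using hq0)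
      intro h2
      have := congrArg (PowerSeries.coeff 0) h2
      rw [← one_add_one_eq_two] at this
      simp at this
    apply mul_left_cancel₀ hne
    simp only [Polynomial.coe_add, Polynomial.coe_mul] at h
    linear_combination h
  · apply coeff_eq_zero_of_natDegree_lt
    have h := detOneAdd_natDegree_le (x * y)
    rw [hq, natDegree_mul hq0 hq0, Fintype.card_fin] at h
    omega

end

section
open Matrix

section Orthonormal

variable {R E : Type*} [Field R] [LinearOrder R] [IsStrictOrderedRing R] [AddCommGroup E]
  [Module R E]

/-- A finite family that is orthonormal for the bilinear form `B`. -/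
def OrthoFam (B : LinearMap.BilinForm R E) {k : ℕ} (v : Fin k → E) : Prop :=
  ∀ i j, B (v i) (v j) = if i = j then 1 else 0

theorem OrthoFam.coeff {B : LinearMap.BilinForm R E} {k : ℕ} {v : Fin k → E} (h : OrthoFam B v)
    (c : Fin k → R) (j : Fin k) : B (∑ i, c i • v i) (v j) = c j := by
  simp [map_sum, h _ j]

theorem OrthoFam.linearIndependent {B : LinearMap.BilinForm R E} {k : ℕ} {v : Fin k → E}
    (h : OrthoFam B v) : LinearIndependent R v := by
  rw [Fintype.linearIndependent_iff]
  intro c hc i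
  rw [← h.coeff c i, hc]; simp

theorem exists_maximal_orthoFam (hR : PolyIVT R) {B : LinearMap.BilinForm R E}
    (hs : ∀ x y, B x y = B y x) (hp : ∀ x, 0 ≤ B x x) (V : Submodule R E) (N : ℕ)
    (hN : ∀ (k : ℕ) (v : Fin k → E), (∀ i, v i ∈ V) → OrthoFam B v → k ≤ N) :
    ∃ (k : ℕ) (v : Fin k → E), (∀ i, v i ∈ V) ∧ OrthoFam B v ∧
      ∀ x ∈ V, B (x - ∑ i, B x (v i) • v i) (x - ∑ i, B x (v i) • v i) = 0 := by
  classical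
  let P : ℕ → Prop := fun k => ∃ v : Fin k → E, (∀ i, v i ∈ V) ∧ OrthoFam B v
  have hP0 : P 0 := ⟨Fin.elim0, fun i => i.elim0, fun i => i.elim0⟩
  obtain ⟨v, hv, ho⟩ : P (Nat.findGreatest P N) := Nat.findGreatest_spec (Nat.zero_le N) hP0
  refine ⟨_, v, hv, ho, fun x hx => ?_⟩
  set z := x - ∑ i, B x (v i) • v i with hz
  by_contra hne
  have hzV : z ∈ V := V.sub_mem hx (V.sum_mem fun i _ => V.smul_mem _ (hv i))
  obtain ⟨s, -, hss⟩ := hR.exists_sqrt (hp z)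
  have hs0 : s ≠ 0 := by rintro rfl; exact hne (by rw [← hss]; simp)
  have hzv : ∀ i, B z (v i) = 0 := fun i => by
    rw [hz, map_sub, LinearMap.sub_apply, ho.coeff, sub_self]
  have hk : P (Nat.findGreatest P N + 1) := by
    refine ⟨Fin.cons (s⁻¹ • z) v, fun i => ?_, fun i j => ?_⟩
    · refine Fin.cases ?_ (fun i => ?_) i
      · simpa using V.smul_mem _ hzV
      · simpa using hv i
    · refine Fin.cases ?_ (fun i => ?_) i <;> refine Fin.cases ?_ (fun j => ?_) j
      · simp only [Fin.cons_zero, map_smul, LinearMap.smul_apply, smul_eq_mul, if_true, ← hss]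
        field_simp
      · simp [hzv, (Fin.succ_ne_zero j).symm]
      · rw [hs]; simp [hzv]
      · simpa using ho i j
  have hle : Nat.findGreatest P N + 1 ≤ N := by
    obtain ⟨w, hw, hw'⟩ := hk
    exact hN _ w hw hw'
  have := Nat.le_findGreatest hle hk
  omega

end Orthonormal

section Numeric

variable {R : Type*} [Field R] [CharZero R] {f p : ℕ → R}

theorem IsNewton.exists_nat_of_const (h : IsNewton f p) {c : R} (hp : ∀ i, p (i + 1) = c)
    {n : ℕ} (hf : ∀ m, n < m → f m = 0) : ∃ m : ℕ, c = m := by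
  by_contra! hc
  have h1 : f 1 = c := by
    have := h.2 0
    simpa [h.1, hp] using this
  have hrec : ∀ m : ℕ, ((m : R) + 2) * f (m + 2) = (c - (m + 1)) * f (m + 1) := by
    intro m
    have a := h.2 (m + 1)
    have b := h.2 m
    rw [Finset.sum_range_succ'] at a
    have e : ∑ i ∈ Finset.range (m + 1), (-1) ^ (i + 1) * f (m + 1 - (i + 1)) * p (i + 1 + 1) =
        -∑ i ∈ Finset.range (m + 1), (-1) ^ i * f (m - i) * p (i + 1) := by
      rw [← Finset.sum_neg_distrib]
      refine Finset.sum_congr rfl fun i _ => ?_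
      rw [hp, hp, Nat.add_sub_add_right]; ring
    rw [e, ← b, hp] at a
    push_cast at a
    simp only [pow_zero, one_mul] at a
    linear_combination a
  have hne : ∀ m : ℕ, f (m + 1) ≠ 0 := by
    intro m
    induction m with
    | zero => rw [h1]; simpa using hc 0
    | succ m ih =>
      intro h0
      have := hrec m
      rw [h0, mul_zero] at this
      rcases mul_eq_zero.1 this.symm with h2 | h2
      · exact hc (m + 1) (by push_cast; linear_combination h2)
      · exact ih h2
  exact hne n (hf _ (Nat.lt_succ_self n))

theorem IsNewton.exists_even_of_alternating (h : IsNewton f p) {c : R} (h1 : p 1 = 0)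
    (h2 : p 2 = -c) (hp : ∀ i, p (i + 3) = -p (i + 1)) {n : ℕ} (hf : ∀ m, n < m → f m = 0) :
    ∃ m : ℕ, c = 2 * m := by
  by_contra! hc
  have hrec : ∀ m : ℕ, ((m : R) + 2) * f (m + 2) = (c - m) * f m := by
    intro m
    have a := h.2 (m + 1)
    rw [Finset.sum_range_succ', Finset.sum_range_succ'] at a
    have e : ∑ i ∈ Finset.range m, (-1) ^ (i + 1 + 1) * f (m + 1 - (i + 1 + 1)) * p (i + 1 + 1 + 1)
        = - ((m : R) * f m) := by
      cases m with
      | zero => simp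
      | succ m =>
        push_cast
        rw [h.2 m, ← Finset.sum_neg_distrib]
        refine Finset.sum_congr rfl fun i _ => ?_
        rw [show i + 1 + 1 + 1 = i + 3 from rfl, hp]
        ring
    rw [e] at a
    push_cast at a
    simp only [h1, h2, pow_one, mul_zero, add_zero] at a
    norm_num at a
    linear_combination a
  have hne : ∀ m : ℕ, f (2 * m) ≠ 0 := by
    intro m
    induction m with
    | zero => rw [mul_zero, h.1]; exact one_ne_zero
    | succ m ih =>
      intro h0
      have := hrec (2 * m)
      rw [show 2 * m + 2 = 2 * (m + 1) by ring, h0, mul_zero] at this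
      rcases mul_eq_zero.1 this.symm with h2 | h2
      · exact hc m (by push_cast at h2; linear_combination h2)
      · exact ih h2
  exact hne (n + 1) (hf _ (by omega))

end Numeric

/-- `τ` is a faithful positive trace on an algebra with involution `st`. -/
structure PosTrace {R A : Type*} [Field R] [LinearOrder R] [Ring A] [Algebra R A]
    (st : A →ₗ[R] A) (τ : A →ₗ[R] R) : Prop where
  st_st : ∀ a, st (st a) = a
  st_mul : ∀ a b, st (a * b) = st b * st a
  tr_st : ∀ a, τ (st a) = τ a
  tr_comm : ∀ a b, τ (a * b) = τ (b * a)
  pos : ∀ a, a ≠ 0 → 0 < τ (a * st a)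

/-- A minimal symmetric idempotent. -/
structure IsMinIdem {R A : Type*} [Field R] [Ring A] [Algebra R A]
    (st : A →ₗ[R] A) (e : A) : Prop where
  ne_zero : e ≠ 0
  mul_self : e * e = e
  st_self : st e = e
  scalar : ∀ a, st a = a → ∃ r : R, e * a * e = r • e

end

section
open Matrix

section Inner
variable {R A : Type*} [Field R] [Ring A] [Algebra R A]

/-- The bilinear form `τ (x * st y)`. -/
def stInner (st : A →ₗ[R] A) (τ : A →ₗ[R] R) : LinearMap.BilinForm R A :=
  LinearMap.mk₂ R (fun x y => τ (x * st y)) (by simp [add_mul]) (by simp) (by simp [mul_add])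
    (by simp)

@[simp] theorem stInner_apply (st : A →ₗ[R] A) (τ : A →ₗ[R] R) (x y : A) :
    stInner st τ x y = τ (x * st y) := rfl

/-- The corner `e A f`. -/
def corner (R : Type*) {A : Type*} [Field R] [Ring A] [Algebra R A] (e f : A) :
    Submodule R A where
  carrier := {x | e * x = x ∧ x * f = x}
  add_mem' := fun ha hb => ⟨by rw [mul_add, ha.1, hb.1], by rw [add_mul, ha.2, hb.2]⟩
  zero_mem' := by simp
  smul_mem' := fun c x hx => ⟨by rw [mul_smul_comm, hx.1], by rw [smul_mul_assoc, hx.2]⟩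

/-- `V` has an orthonormal basis of size `d`. -/
def HasOrthoBasis [LinearOrder R] [IsStrictOrderedRing R] (st : A →ₗ[R] A) (τ : A →ₗ[R] R)
    (V : Submodule R A) (d : ℕ) : Prop :=
  ∃ v : Fin d → A, (∀ i, v i ∈ V) ∧ OrthoFam (stInner st τ) v ∧ ∀ x ∈ V, ∃ c : Fin d → R,
    x = ∑ i, c i • v i

end Inner

variable {R A : Type*} [Field R] [LinearOrder R] [IsStrictOrderedRing R] [Ring A] [Algebra R A]
  {st : A →ₗ[R] A} {τ : A →ₗ[R] R}

namespace PosTrace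

theorem st_one (h : PosTrace st τ) : st 1 = 1 := by
  have e := h.st_mul 1 (st 1)
  rw [one_mul, h.st_st, one_mul] at e
  exact e.symm

theorem nonneg (h : PosTrace st τ) (a : A) : 0 ≤ τ (a * st a) := by
  by_cases ha : a = 0
  · simp [ha]
  · exact (h.pos a ha).le

theorem eq_zero_of_st_mul (h : PosTrace st τ) {a : A} (ha : st a * a = 0) : a = 0 := by
  by_contra hne
  have := h.pos a hne
  rw [h.tr_comm, ha, map_zero] at this
  exact this.false

theorem tr_eq_zero (h : PosTrace st τ) {a : A} (ha : st a = -a) : τ a = 0 := by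
  have := h.tr_st a
  rw [ha, map_neg] at this
  linarith

theorem hasOrthoBasis_of_weighted (hR : PolyIVT R) {V : Submodule R A}
    {d : ℕ} {k : R}
    (hk : 0 < k) (w : Fin d → A) (hw : ∀ i, w i ∈ V)
    (ho : ∀ i j, τ (w i * st (w j)) = if i = j then k else 0)
    (hspan : ∀ x ∈ V, ∃ c : Fin d → R, x = ∑ i, c i • w i) : HasOrthoBasis st τ V d := by
  obtain ⟨s, -, hs⟩ := hR.exists_sqrt hk.le
  have hs0 : s ≠ 0 := by rintro rfl; simp at hs; exact hk.ne hs
  refine ⟨fun i => s⁻¹ • w i, fun i => V.smul_mem _ (hw i), fun i j => ?_, fun x hx => ?_⟩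
  · rw [map_smul, LinearMap.map_smul, LinearMap.smul_apply, stInner_apply, ho]
    split_ifs
    · rw [← hs, smul_eq_mul, smul_eq_mul]; field_simp
    · simp
  · obtain ⟨c, hc⟩ := hspan x hx
    refine ⟨fun i => c i * s, ?_⟩
    rw [hc]
    exact Finset.sum_congr rfl fun i _ => by
      rw [smul_smul, mul_assoc, mul_inv_cancel₀ hs0, mul_one]

theorem minIdem_tr_pos (h : PosTrace st τ) {e : A} (he : IsMinIdem st e) : 0 < τ e := by
  have := h.pos e he.ne_zero
  rwa [he.st_self, he.mul_self] at this

theorem corner_scalar {e : A} (he : IsMinIdem st e) {x : A}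
    (hx : x ∈ corner R e e)
    (hs : st x = x) : ∃ r : R, x = r • e := by
  obtain ⟨r, hr⟩ := he.scalar x hs
  exact ⟨r, by rw [← hr, hx.1, hx.2]⟩

theorem mem_corner_mul {e f g x y : A} (hx : x ∈ corner R e f) (hy : y ∈ corner R f g) :
    x * y ∈ corner R e g :=
  ⟨by rw [← mul_assoc, hx.1], by rw [mul_assoc, hy.2]⟩

theorem mem_corner_st (h : PosTrace st τ) {e f x : A} (he : st e = e) (hf : st f = f)
    (hx : x ∈ corner R e f) :
    st x ∈ corner R f e :=
  ⟨by conv_rhs => rw [← hx.2, h.st_mul, hf], by conv_rhs => rw [← hx.1, h.st_mul, he]⟩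

/-- A nonzero skew element of the corner of a minimal idempotent can be normalized. -/
theorem exists_normalized (h : PosTrace st τ) (hR : PolyIVT R) {e : A} (he : IsMinIdem st e) {v : A}
    (hv : v ∈ corner R e e) (hs : st v = -v) (h0 : v ≠ 0) :
    ∃ s : R, s ≠ 0 ∧ (s • v) * (s • v) = -e := by
  obtain ⟨r, hr⟩ := corner_scalar he
    (mem_corner_mul hv (h.mem_corner_st he.st_self he.st_self hv))
    (by rw [h.st_mul, h.st_st])
  have hpos := h.pos v h0
  rw [hr, map_smul, smul_eq_mul] at hpos
  have hr0 : 0 < r := by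
    have := h.minIdem_tr_pos he
    exact (mul_pos_iff_of_pos_right this).1 hpos
  obtain ⟨s, -, hss⟩ := hR.exists_sqrt hr0.le
  have hs0 : s ≠ 0 := by rintro rfl; simp at hss; exact hr0.ne hss
  refine ⟨s⁻¹, inv_ne_zero hs0, ?_⟩
  have hvv : v * v = -(r • e) := by rw [← hr, hs]; simp
  rw [smul_mul_assoc, mul_smul_comm, smul_smul, hvv, smul_neg, smul_smul, ← hss]
  congr 1
  rw [show s⁻¹ * s⁻¹ * (s * s) = 1 by field_simp, one_smul]

/-- Subtract from a skew `v` a multiple of `I` to make it anticommute with `I`. -/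
theorem exists_anticomm (h : PosTrace st τ) {e I v : A} (he : IsMinIdem st e)
    (hI : I ∈ corner R e e)
    (hIs : st I = -I) (hv : v ∈ corner R e e) (hvs : st v = -v) :
    ∃ t : R, I * v + v * I = (2 * t) • e := by
  obtain ⟨r, hr⟩ := corner_scalar he (x := I * v + v * I)
    ((corner R e e).add_mem (mem_corner_mul hI hv) (mem_corner_mul hv hI))
    (by rw [map_add, h.st_mul, h.st_mul, hIs, hvs, neg_mul_neg, neg_mul_neg, add_comm])
  exact ⟨r / 2, by rw [hr]; congr 1; ring⟩

theorem mem_corner_self {e : A} (he : IsMinIdem st e) : e ∈ corner R e e :=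
  ⟨he.mul_self, he.mul_self⟩

theorem skew_part (h : PosTrace st τ) {e x : A} (he : IsMinIdem st e) (hx : x ∈ corner R e e) :
    ∃ (r : R) (v : A), v ∈ corner R e e ∧ st v = -v ∧ x = r • e + v := by
  have hsx := h.mem_corner_st he.st_self he.st_self hx
  obtain ⟨r, hr⟩ := corner_scalar he (x := (2⁻¹ : R) • (x + st x))
    (Submodule.smul_mem _ _ (Submodule.add_mem _ hx hsx))
    (by rw [map_smul, map_add, h.st_st, add_comm])
  refine ⟨r, (2⁻¹ : R) • (x - st x), Submodule.smul_mem _ _ (Submodule.sub_mem _ hx hsx), ?_, ?_⟩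
  · rw [map_smul, map_sub, h.st_st, ← smul_neg, neg_sub]
  · rw [← hr]; module

theorem exists_corner_basis (h : PosTrace st τ) (hR : PolyIVT R) {n : ℕ}
    (hI1 : ∀ a : A, ∃ f : ℕ → R, IsNewton f (fun i => τ (a ^ i)) ∧ ∀ m, n < m → f m = 0)
    (hI2 : ∀ (x y : A), st x = -x → st y = -y → ∃ f : ℕ → R,
      IsNewton f (fun i => τ ((x * y) ^ i) / 2) ∧ ∀ m, n < m → f m = 0)
    {e : A} (he : IsMinIdem st e) :
    ∃ d m : ℕ, 0 < d ∧ HasOrthoBasis st τ (corner R e e) d ∧ τ e = m * d := by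
  have hk := h.minIdem_tr_pos he
  have hec := mem_corner_self he
  by_cases h1 : ∀ v ∈ corner R e e, st v = -v → v = 0
  · obtain ⟨f, hf, hf0⟩ := hI1 e
    have hep : ∀ i, e ^ (i + 1) = e := fun i => by
      induction i with
      | zero => simp
      | succ i ih => rw [pow_succ, ih, he.mul_self]
    obtain ⟨m, hm⟩ := hf.exists_nat_of_const (c := τ e) (fun i => by simp only [hep]) hf0
    refine ⟨1, m, one_pos, hasOrthoBasis_of_weighted hR hk ![e] ?_ ?_ ?_, by rw [hm]; simp⟩
    · intro i; fin_cases i; exact hec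
    · intro i j; fin_cases i; fin_cases j; simp [he.st_self, he.mul_self]
    · intro x hx
      obtain ⟨r, v, hv, hvs, rfl⟩ := h.skew_part he hx
      exact ⟨![r], by simp [h1 v hv hvs]⟩
  push Not at h1
  obtain ⟨I₀, hI₀, hI₀s, hI₀0⟩ := h1
  obtain ⟨s, hs0, hII⟩ := h.exists_normalized hR he hI₀ hI₀s hI₀0
  generalize hIdef : s • I₀ = I at hII
  have hI : I ∈ corner R e e := hIdef ▸ Submodule.smul_mem _ _ hI₀
  have hIs : st I = -I := by rw [← hIdef, map_smul, hI₀s, smul_neg]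
  have hIpow : ∀ K ∈ corner R e e, K * K = -e → ∀ i, K ^ (i + 3) = -K ^ (i + 1) := by
    intro K hK hKK i
    have : K ^ 3 = -K := by rw [pow_succ, sq, hKK, neg_mul, hK.1]
    induction i with
    | zero => simpa using this
    | succ i ih => rw [show i + 1 + 3 = (i + 3) + 1 from rfl, pow_succ, ih, neg_mul, ← pow_succ]
  by_cases h2 : ∀ v ∈ corner R e e, st v = -v → I * v + v * I = 0 → v = 0
  · obtain ⟨f, hf, hf0⟩ := hI1 I
    obtain ⟨m, hm⟩ := hf.exists_even_of_alternating (c := τ e) (by simp [h.tr_eq_zero hIs])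
      (by simp only [sq, hII, map_neg]) (fun i => by simp only [hIpow I hI hII, map_neg]) hf0
    refine ⟨2, m, two_pos, hasOrthoBasis_of_weighted hR hk ![e, I] ?_ ?_ ?_,
      by rw [hm]; push_cast; ring⟩
    · intro i; fin_cases i
      exacts [hec, hI]
    · intro i j
      fin_cases i <;> fin_cases j <;>
        simp [he.st_self, he.mul_self, hIs, hII, hI.1, hI.2, h.tr_eq_zero hIs]
    · intro x hx
      obtain ⟨r, v, hv, hvs, rfl⟩ := h.skew_part he hx
      obtain ⟨t, ht⟩ := h.exists_anticomm he hI hIs hv hvs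
      have := h2 (v + t • I) (Submodule.add_mem _ hv (Submodule.smul_mem _ _ hI))
        (by rw [map_add, map_smul, hvs, hIs]; module)
        (by
          have e1 : I * (v + t • I) + (v + t • I) * I = (I * v + v * I) + (2 * t) • (I * I) := by
            simp only [mul_add, add_mul, mul_smul_comm, smul_mul_assoc]; module
          rw [e1, ht, hII]; simp)
      refine ⟨![r, -t], ?_⟩
      simp only [Fin.sum_univ_two, cons_val_zero, cons_val_one]
      rw [← sub_eq_zero]
      rw [← this]
      module
  push Not at h2
  obtain ⟨J₀, hJ₀, hJ₀s, hIJ₀, hJ₀0⟩ := h2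
  obtain ⟨s', hs'0, hJJ⟩ := h.exists_normalized hR he hJ₀ hJ₀s hJ₀0
  generalize hJdef : s' • J₀ = J at hJJ
  have hJ : J ∈ corner R e e := hJdef ▸ Submodule.smul_mem _ _ hJ₀
  have hJs : st J = -J := by rw [← hJdef, map_smul, hJ₀s, smul_neg]
  have hJI : J * I = -(I * J) := by
    rw [← hJdef, smul_mul_assoc, mul_smul_comm, ← smul_neg, ← eq_neg_of_add_eq_zero_right hIJ₀]
  have hK : I * J ∈ corner R e e := mem_corner_mul hI hJ
  have hKs : st (I * J) = -(I * J) := by rw [h.st_mul, hIs, hJs, neg_mul_neg, hJI]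
  have hIK : I * (I * J) = -J := by rw [← mul_assoc, hII, neg_mul, hJ.1]
  have hKI : I * J * I = J := by rw [mul_assoc, hJI, mul_neg, hIK, neg_neg]
  have hKJ : I * J * J = -I := by rw [mul_assoc, hJJ, mul_neg, hI.2]
  have hJK : J * (I * J) = I := by rw [← mul_assoc, hJI, neg_mul, hKJ, neg_neg]
  have hKK : I * J * (I * J) = -e := by rw [← mul_assoc, hKI, hJJ]
  generalize hKdef : I * J = K at hK hKs hIK hKI hKJ hJK hKK hJI
  obtain ⟨f, hf, hf0⟩ := hI2 I J hIs hJs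
  rw [hKdef] at hf
  obtain ⟨m, hm⟩ := hf.exists_even_of_alternating (c := τ e / 2) (by simp [h.tr_eq_zero hKs])
    (by simp only [sq, hKK, map_neg, neg_div])
    (fun i => by simp only [hIpow K hK hKK, map_neg, neg_div]) hf0
  refine ⟨4, m, by norm_num, hasOrthoBasis_of_weighted hR hk ![e, I, J, K] ?_ ?_ ?_,
    by push_cast; linarith⟩
  · intro i; fin_cases i
    exacts [hec, hI, hJ, hK]
  · intro i j
    fin_cases i <;> fin_cases j <;>
      simp [he.st_self, he.mul_self, hIs, hII, hI.1, hI.2, h.tr_eq_zero hIs, hJs, hJJ, hJ.1, hJ.2,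
        h.tr_eq_zero hJs, hKs, hKK, hK.1, hK.2, h.tr_eq_zero hKs, hKdef, hJI, hIK, hKI, hJK, hKJ]
  · intro x hx
    obtain ⟨r, v, hv, hvs, rfl⟩ := h.skew_part he hx
    obtain ⟨a, ha⟩ := h.exists_anticomm he hI hIs hv hvs
    obtain ⟨b, hb⟩ := h.exists_anticomm he hJ hJs hv hvs
    obtain ⟨c, hc⟩ := h.exists_anticomm he hK hKs hv hvs
    obtain ⟨w, hw⟩ : ∃ w, w = v + a • I + b • J + c • K := ⟨_, rfl⟩
    have hwc : w ∈ corner R e e := by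
      rw [hw]
      exact Submodule.add_mem _ (Submodule.add_mem _ (Submodule.add_mem _ hv
        (Submodule.smul_mem _ _ hI)) (Submodule.smul_mem _ _ hJ)) (Submodule.smul_mem _ _ hK)
    have hwI : w * I = -(I * w) := by
      have : I * w + w * I = (I * v + v * I) + (2 * a) • (I * I) + b • (I * J + J * I) +
          c • (I * K + K * I) := by
        rw [hw]; simp only [mul_add, add_mul, mul_smul_comm, smul_mul_assoc]; module
      rw [ha, hII, hJI, hIK, hKI, hKdef] at this
      exact eq_neg_of_add_eq_zero_right (by rw [this]; simp)
    have hwJ : w * J = -(J * w) := by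
      have : J * w + w * J = (J * v + v * J) + a • (J * I + I * J) + (2 * b) • (J * J) +
          c • (J * K + K * J) := by
        rw [hw]; simp only [mul_add, add_mul, mul_smul_comm, smul_mul_assoc]; module
      rw [hb, hJJ, hJI, hJK, hKJ, hKdef] at this
      exact eq_neg_of_add_eq_zero_right (by rw [this]; simp)
    have hwK : w * K = -(K * w) := by
      have : K * w + w * K = (K * v + v * K) + a • (K * I + I * K) + b • (K * J + J * K) +
          (2 * c) • (K * K) := by
        rw [hw]; simp only [mul_add, add_mul, mul_smul_comm, smul_mul_assoc]; module
      rw [hc, hIK, hJK, hKI, hKJ, hKK] at this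
      exact eq_neg_of_add_eq_zero_right (by rw [this]; simp)
    have hwK' : w * K = K * w := by
      rw [← hKdef, ← mul_assoc, hwI, neg_mul, mul_assoc, hwJ, mul_neg, neg_neg, mul_assoc]
    have hKw : K * w = 0 := by
      have : (2 : R) • (K * w) = 0 := by
        rw [two_smul]; nth_rw 1 [← hwK']; rw [hwK]; simp
      exact (smul_eq_zero.1 this).resolve_left two_ne_zero
    have hw0 : w = 0 := by
      have : K * (K * w) = -w := by rw [← mul_assoc, hKK, neg_mul, hwc.1]
      rw [hKw, mul_zero] at this
      simpa using this.symm
    refine ⟨![r, -a, -b, -c], ?_⟩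
    simp only [Fin.sum_univ_four, cons_val]
    rw [← sub_eq_zero, ← hw0, hw]
    module

end PosTrace
end

section
open Matrix Polynomial

variable {R A : Type*} [Field R] [LinearOrder R] [IsStrictOrderedRing R] [Ring A] [Algebra R A]
  {st : A →ₗ[R] A} {τ : A →ₗ[R] R}

namespace PosTrace

theorem st_aeval (h : PosTrace st τ) {a : A} (ha : st a = a) (f : R[X]) :
    st (aeval a f) = aeval a f := by
  have hpow : ∀ n : ℕ, st (a ^ n) = a ^ n := fun n => by
    induction n with
    | zero => rw [pow_zero, h.st_one]
    | succ n ih => rw [pow_succ, h.st_mul, ha, ih, ← pow_succ, pow_succ']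
  rw [aeval_eq_sum_range, map_sum]
  simp only [map_smul, hpow]

theorem exists_eigen_idem (h : PosTrace st τ) [Module.Finite R A] (hR : IsRC R) {e a : A}
    (he0 : e ≠ 0)
    (hee : e * e = e) (hes : st e = e) (hac : a ∈ corner R e e) (ha : st a = a) :
    ∃ (c : R) (f : A), f ≠ 0 ∧ f * f = f ∧ st f = f ∧ f ∈ corner R e e ∧ a * f = c • f ∧
      f * a = c • f := by
  have hcomm : ∀ f : R[X], aeval a f * e = e * aeval a f := fun f => by
    have : Commute a e := by rw [Commute, SemiconjBy, hac.1, hac.2]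
    rw [aeval_eq_sum_range, Finset.sum_mul, Finset.mul_sum]
    exact Finset.sum_congr rfl fun i _ => by
      rw [smul_mul_assoc, mul_smul_comm, (this.pow_left i).eq]
  let I : Ideal R[X] :=
    { carrier := {f | aeval a f * e = 0}
      add_mem' := fun {x y} hx hy => by
        simp only [Set.mem_ofPred_eq] at hx hy ⊢
        rw [map_add, add_mul, hx, hy, add_zero]
      zero_mem' := by simp
      smul_mem' := fun c x hx => by
        simp only [Set.mem_ofPred_eq] at hx ⊢
        rw [smul_eq_mul, map_mul, mul_assoc, hx, mul_zero] }
  obtain ⟨p, hp⟩ := (IsPrincipalIdealRing.principal I).principal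
  have hmem : ∀ f, aeval a f * e = 0 ↔ p ∣ f := fun f => by
    rw [← Ideal.mem_span_singleton, ← Ideal.submodule_span_eq, ← hp]; rfl
  have hp0 : p ≠ 0 := by
    rintro rfl
    have h1 := (hmem (minpoly R a)).1 (by simp)
    exact minpoly.ne_zero (Algebra.IsIntegral.isIntegral a) (zero_dvd_iff.1 h1)
  have hpu : ¬ IsUnit p := fun hu => he0 (by
    have := (hmem 1).2 (hu.dvd)
    simpa using this)
  obtain ⟨q, hq, r, rfl⟩ := WfDvdMonoid.exists_irreducible_factor hpu hp0
  have hr0 : r ≠ 0 := right_ne_zero_of_mul hp0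
  set b := aeval a r * e with hb
  have hb0 : b ≠ 0 := fun h0 => by
    have h1 : q * r ∣ 1 * r := by rw [one_mul]; exact (hmem r).1 h0
    exact hq.not_isUnit (isUnit_of_dvd_one ((mul_dvd_mul_iff_right hr0).1 h1))
  have hbs : st b = b := by rw [hb, h.st_mul, hes, h.st_aeval ha, hcomm]
  have hbc : b ∈ corner R e e :=
    ⟨by rw [hb, hcomm, ← mul_assoc, hee], by rw [hb, mul_assoc, hee]⟩
  have hbcomm : ∀ f : R[X], aeval a f * b = b * aeval a f := fun f => by
    rw [hb, mul_assoc, ← hcomm, ← mul_assoc, ← mul_assoc, ← map_mul, ← map_mul, mul_comm]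
  have hdeg : q.natDegree = 1 := by
    refine hR.natDegree_eq_one hq
      ((τ ∘ₗ LinearMap.mulRight R (b * b)) ∘ₗ (aeval a).toLinearMap) (fun f => ?_) (fun f => ?_) ?_
    · have : aeval a (q * f) * b = 0 := by
        rw [hb, ← mul_assoc, ← map_mul, hmem]
        exact ⟨f, by ring⟩
      simp only [LinearMap.comp_apply, AlgHom.toLinearMap_apply, LinearMap.mulRight_apply]
      rw [← mul_assoc, this, zero_mul, map_zero]
    · have := h.nonneg (aeval a f * b)
      have e1 : aeval a f * b * (b * aeval a f) = aeval a (f * f) * (b * b) := by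
        rw [map_mul, ← hbcomm, mul_assoc, ← mul_assoc b, ← hbcomm]
        simp only [mul_assoc]
      rw [h.st_mul, hbs, h.st_aeval ha, e1] at this
      exact this
    · have := h.pos b hb0
      rw [hbs] at this
      simpa using this
  obtain ⟨c, hc⟩ : ∃ c, q.IsRoot c :=
    exists_root_of_degree_eq_one ((degree_eq_iff_natDegree_eq_of_pos one_pos).2 hdeg)
  have hdvd : q ∣ X - C c := by
    rw [← dvd_iff_isRoot] at hc
    exact ((irreducible_X_sub_C c).associated_of_dvd hq hc).symm.dvd
  have hab : a * b = c • b := by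
    have e1 := (hmem ((X - C c) * r)).2 (mul_dvd_mul_right hdvd r)
    rw [map_mul, mul_assoc, ← hb, map_sub, aeval_X, aeval_C, sub_mul, ← Algebra.smul_def] at e1
    exact sub_eq_zero.1 e1
  have hfb : ∀ f : R[X], aeval a f * b = f.eval c • b := fun f => by
    have hpow : ∀ n : ℕ, a ^ n * b = c ^ n • b := fun n => by
      induction n with
      | zero => simp
      | succ n ih => rw [pow_succ, mul_assoc, hab, mul_smul_comm, ih, smul_smul, pow_succ']
    rw [aeval_eq_sum_range, Finset.sum_mul, eval_eq_sum_range, Finset.sum_smul]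
    exact Finset.sum_congr rfl fun i _ => by rw [smul_mul_assoc, hpow, smul_smul]
  have hbb : b * b = r.eval c • b := by
    conv_lhs => rw [hb, mul_assoc, ← hb, hbc.1, hfb]
  have hrc : r.eval c ≠ 0 := fun h0 => by
    rw [h0, zero_smul] at hbb
    exact hb0 (h.eq_zero_of_st_mul (by rw [hbs, hbb]))
  have hba : b * a = c • b := by
    have := hbcomm X
    rw [aeval_X] at this
    rw [← this, hab]
  refine ⟨c, (r.eval c)⁻¹ • b, smul_ne_zero (inv_ne_zero hrc) hb0, ?_, ?_,
    Submodule.smul_mem _ _ hbc, ?_, ?_⟩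
  · rw [smul_mul_assoc, mul_smul_comm, hbb, smul_smul, smul_smul, mul_assoc,
      inv_mul_cancel₀ hrc, mul_one]
  · rw [map_smul, hbs]
  · rw [mul_smul_comm, hab, smul_comm]
  · rw [smul_mul_assoc, hba, smul_comm]

/-- `u` is a family of orthogonal minimal symmetric idempotents summing up to `e`. -/
structure MinDecomp {ι : Type} [Fintype ι] (st : A →ₗ[R] A) (u : ι → A) (e : A) : Prop where
  min : ∀ i, IsMinIdem st (u i)
  ortho : ∀ i j, i ≠ j → u i * u j = 0
  sum : ∑ i, u i = e

theorem MinDecomp.mul_left {ι : Type} [Fintype ι] {u : ι → A} {e : A} (hu : MinDecomp st u e)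
    (i : ι) : u i * e = u i := by
  rw [← hu.sum, Finset.mul_sum, Finset.sum_eq_single i (fun j _ hj => hu.ortho i j hj.symm)
    (by simp), (hu.min i).mul_self]

theorem MinDecomp.mul_right {ι : Type} [Fintype ι] {u : ι → A} {e : A} (hu : MinDecomp st u e)
    (i : ι) : e * u i = u i := by
  rw [← hu.sum, Finset.sum_mul, Finset.sum_eq_single i (fun j _ hj => hu.ortho j i hj)
    (by simp), (hu.min i).mul_self]

theorem exists_minDecomp (h : PosTrace st τ) [Module.Finite R A] (hR : IsRC R) :
    ∀ (N : ℕ) (e a : A), Module.finrank R (corner R e e) ≤ N → e * e = e → st e = e →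
      a ∈ corner R e e → st a = a → ∃ (ι : Type) (_ : Fintype ι) (u : ι → A) (c : ι → R),
        MinDecomp st u e ∧ a = ∑ i, c i • u i := by
  intro N
  have hzero : ∀ a ∈ corner R (0 : A) 0, ∃ (ι : Type) (_ : Fintype ι) (u : ι → A) (c : ι → R),
      MinDecomp st u 0 ∧ a = ∑ i, c i • u i := fun a ha =>
    ⟨Empty, inferInstance, Empty.elim, Empty.elim, ⟨nofun, nofun, by simp⟩,
      by rw [← ha.1]; simp⟩
  induction N with
  | zero =>
    intro e a hN hee hes hac ha
    have hbot : corner R e e = ⊥ := Submodule.finrank_eq_zero.1 (Nat.le_zero.1 hN)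
    have he0 : e = 0 := by
      have : e ∈ corner R e e := ⟨hee, hee⟩
      rwa [hbot, Submodule.mem_bot] at this
    subst he0
    exact hzero a hac
  | succ N ih =>
    intro e a hN hee hes hac ha
    by_cases he0 : e = 0
    · subst he0
      exact hzero a hac
    have sub : ∀ f : A, f ≠ e → e * f = f → f * e = f →
        Module.finrank R (corner R f f) ≤ N := fun f hfe h1 h2 => by
      have hlt : corner R f f < corner R e e := by
        refine lt_of_le_of_ne (fun x hx => ⟨?_, ?_⟩) fun heq => hfe ?_
        · rw [← hx.1, ← mul_assoc, h1]
        · rw [← hx.2, mul_assoc, h2]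
        · have : e ∈ corner R f f := heq ▸ ⟨hee, hee⟩
          rw [← h2, this.1]
      have := Submodule.finrank_lt_finrank_of_lt hlt
      omega
    have split : ∀ (f : A) (c : R), f ≠ 0 → f ≠ e → f * f = f → st f = f → f ∈ corner R e e →
        a * f = c • f → f * a = c • f → ∃ (ι : Type) (_ : Fintype ι) (u : ι → A) (c : ι → R),
        MinDecomp st u e ∧ a = ∑ i, c i • u i := by
      intro f c hf0 hfe hff hfs hfc haf hfa
      obtain ⟨ι₁, _, u₁, c₁, hu₁, hc₁⟩ := ih f (c • f) (sub f hfe hfc.1 hfc.2) hff hfs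
        (Submodule.smul_mem _ _ ⟨hff, hff⟩) (by rw [map_smul, hfs])
      obtain ⟨ι₂, _, u₂, c₂, hu₂, hc₂⟩ := ih (e - f) (a - c • f)
        (sub (e - f) (by simpa using hf0) (by rw [mul_sub, hee, hfc.1])
          (by rw [sub_mul, hee, hfc.2]))
        (by rw [sub_mul, mul_sub, mul_sub, hee, hfc.1, hfc.2, hff]; simp)
        (by rw [map_sub, hes, hfs])
        ⟨by rw [sub_mul, mul_sub, mul_sub, hac.1, hfa, mul_smul_comm, mul_smul_comm, hfc.1, hff]
            simp,
          by rw [sub_mul, mul_sub, mul_sub, hac.2, haf, smul_mul_assoc, smul_mul_assoc, hfc.2, hff]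
             simp⟩
        (by rw [map_sub, map_smul, ha, hfs])
      have h12 : f * (e - f) = 0 := by rw [mul_sub, hfc.2, hff, sub_self]
      have h21 : (e - f) * f = 0 := by rw [sub_mul, hfc.1, hff, sub_self]
      refine ⟨ι₁ ⊕ ι₂, inferInstance, Sum.elim u₁ u₂, Sum.elim c₁ c₂, ⟨?_, ?_, ?_⟩, ?_⟩
      · rintro (i | i)
        exacts [hu₁.min i, hu₂.min i]
      · rintro (i | i) (j | j) hij
        · exact hu₁.ortho i j fun h' => hij (congrArg _ h')
        · rw [Sum.elim_inl, Sum.elim_inr, ← hu₁.mul_left, ← hu₂.mul_right, mul_assoc,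
            ← mul_assoc f, h12, zero_mul, mul_zero]
        · rw [Sum.elim_inl, Sum.elim_inr, ← hu₂.mul_left, ← hu₁.mul_right, mul_assoc,
            ← mul_assoc (e - f), h21, zero_mul, mul_zero]
        · exact hu₂.ortho i j fun h' => hij (congrArg _ h')
      · simp [hu₁.sum, hu₂.sum]
      · simp [← hc₁, ← hc₂]
    obtain ⟨c, f, hf0, hff, hfs, hfc, haf, hfa⟩ := h.exists_eigen_idem hR he0 hee hes hac ha
    by_cases hfe : f = e
    swap
    · exact split f c hf0 hfe hff hfs hfc haf hfa
    subst hfe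
    have hac' : a = c • f := by rw [← haf, hac.2]
    by_cases hmin : ∀ x, st x = x → ∃ r : R, f * x * f = r • f
    · exact ⟨Unit, inferInstance, fun _ => f, fun _ => c,
        ⟨fun _ => ⟨hf0, hff, hfs, hmin⟩, fun i j hij => absurd rfl hij, by simp⟩, by simpa⟩
    push Not at hmin
    obtain ⟨x, hx, hxr⟩ := hmin
    have hbc : f * x * f ∈ corner R f f :=
      ⟨by rw [← mul_assoc, ← mul_assoc, hff], by rw [mul_assoc, hff]⟩
    obtain ⟨c', f', hf'0, hff', hfs', hfc', hbf', -⟩ := h.exists_eigen_idem hR he0 hee hes hbc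
      (by rw [h.st_mul, h.st_mul, hx, hfs, mul_assoc])
    refine split f' c hf'0 ?_ hff' hfs' hfc' (by rw [hac', smul_mul_assoc, hfc'.1])
      (by rw [hac', mul_smul_comm, hfc'.2])
    rintro rfl
    exact hxr c' (by rw [← hbf', hbc.2])

end PosTrace
end

section
open Matrix

variable {R A : Type*} [Field R] [LinearOrder R] [IsStrictOrderedRing R] [Ring A] [Algebra R A]
  {st : A →ₗ[R] A} {τ : A →ₗ[R] R}

namespace PosTrace

theorem stInner_comm (h : PosTrace st τ) (x y : A) : stInner st τ x y = stInner st τ y x := by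
  rw [stInner_apply, stInner_apply, ← h.tr_st, h.st_mul, h.st_st]

theorem stInner_self_eq_zero (h : PosTrace st τ) {x : A} (hx : stInner st τ x x = 0) : x = 0 := by
  by_contra hne
  exact (h.pos x hne).ne' hx

theorem exists_partialIsometry (h : PosTrace st τ) (hR : PolyIVT R) {f e x : A}
    (hf : IsMinIdem st f)
    (he : IsMinIdem st e) (hx : x ∈ corner R f e) (hx0 : x ≠ 0) :
    ∃ u ∈ corner R f e, st u * u = e ∧ u * st u = f := by
  have hsx := h.mem_corner_st hf.st_self he.st_self hx
  obtain ⟨r, hr⟩ := corner_scalar he (mem_corner_mul hsx hx) (by rw [h.st_mul, h.st_st])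
  have hpos := h.pos x hx0
  rw [h.tr_comm, hr, map_smul, smul_eq_mul] at hpos
  have hr0 : 0 < r := (mul_pos_iff_of_pos_right (h.minIdem_tr_pos he)).1 hpos
  obtain ⟨s, -, hss⟩ := hR.exists_sqrt hr0.le
  have hs0 : s ≠ 0 := by rintro rfl; simp at hss; exact hr0.ne hss
  have huc : s⁻¹ • x ∈ corner R f e := Submodule.smul_mem _ _ hx
  have hu1 : st (s⁻¹ • x) * (s⁻¹ • x) = e := by
    rw [map_smul, smul_mul_assoc, mul_smul_comm, hr, smul_smul, smul_smul, ← hss,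
      show s⁻¹ * s⁻¹ * (s * s) = 1 by field_simp, one_smul]
  generalize s⁻¹ • x = u at huc hu1
  refine ⟨u, huc, hu1, ?_⟩
  obtain ⟨t, ht⟩ := corner_scalar hf
    (mem_corner_mul huc (h.mem_corner_st hf.st_self he.st_self huc)) (by rw [h.st_mul, h.st_st])
  have hu0 : u ≠ 0 := by
    rintro rfl
    exact he.ne_zero (by rw [← hu1, mul_zero])
  have : (t - 1) • u = 0 := by
    rw [sub_smul, one_smul, sub_eq_zero]
    calc t • u = t • f * u := by rw [smul_mul_assoc, huc.1]
      _ = u := by rw [← ht, mul_assoc, hu1, huc.2]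
  rw [ht, sub_eq_zero.1 ((smul_eq_zero.1 this).resolve_right hu0), one_smul]

theorem corner_ne_bot_symm (h : PosTrace st τ) {f e : A} (hf : IsMinIdem st f) (he : IsMinIdem st e)
    (hfe : corner R f e ≠ ⊥) : corner R e f ≠ ⊥ := by
  obtain ⟨x, hx, hx0⟩ := Submodule.exists_mem_ne_zero_of_ne_bot hfe
  refine fun hb => hx0 ?_
  have := h.mem_corner_st hf.st_self he.st_self hx
  rw [hb, Submodule.mem_bot] at this
  rw [← h.st_st x, this, map_zero]

theorem corner_ne_bot_trans (h : PosTrace st τ) (hR : PolyIVT R) {f e g : A} (hf : IsMinIdem st f)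
    (he : IsMinIdem st e) (hfe : corner R f e ≠ ⊥) (heg : corner R e g ≠ ⊥) :
    corner R f g ≠ ⊥ := by
  obtain ⟨x, hx, hx0⟩ := Submodule.exists_mem_ne_zero_of_ne_bot hfe
  obtain ⟨y, hy, hy0⟩ := Submodule.exists_mem_ne_zero_of_ne_bot heg
  obtain ⟨u, hu, hu1, -⟩ := h.exists_partialIsometry hR hf he hx hx0
  refine fun hb => hy0 ?_
  have := mem_corner_mul hu hy
  rw [hb, Submodule.mem_bot] at this
  rw [← hy.1, ← hu1, mul_assoc, this, mul_zero]

theorem exists_rep (h : PosTrace st τ) [Module.Finite R A] (hR : PolyIVT R) {e : A}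
    (he : IsMinIdem st e) {d : ℕ}
    (hd : HasOrthoBasis st τ (corner R e e) d) :
    ∃ (k : ℕ) (ρ : A →ₐ[R] Matrix (Fin k) (Fin k) R), (∀ a, ρ (st a) = (ρ a)ᵀ) ∧
      ∀ f, IsMinIdem st f → (corner R f e = ⊥ → trace (ρ f) = 0) ∧
        (corner R f e ≠ ⊥ → trace (ρ f) = d ∧ τ f = τ e) := by
  obtain ⟨k, v, hv, hvo, hmax⟩ := exists_maximal_orthoFam hR (B := stInner st τ) h.stInner_comm
    h.nonneg (corner R 1 e) (Module.finrank R A) fun k v _ hv => by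
      simpa using hv.linearIndependent.fintype_card_le_finrank
  have hexp : ∀ x ∈ corner R 1 e, x = ∑ i, stInner st τ x (v i) • v i := fun x hx =>
    sub_eq_zero.1 (h.stInner_self_eq_zero (hmax x hx))
  have hmul : ∀ a x, x ∈ corner R 1 e → a * x ∈ corner R 1 e := fun a x hx =>
    ⟨one_mul _, by rw [mul_assoc, hx.2]⟩
  let ρ₀ : A →ₗ[R] Matrix (Fin k) (Fin k) R :=
    { toFun := fun a => of fun i j => stInner st τ (a * v j) (v i)
      map_add' := fun a b => by ext i j; simp [add_mul]
      map_smul' := fun r a => by ext i j; simp }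
  let ρ : A →ₐ[R] Matrix (Fin k) (Fin k) R := AlgHom.ofLinearMap ρ₀
    (by ext i j; simp only [ρ₀, LinearMap.coe_mk, AddHom.coe_mk, of_apply, one_mul, hvo j i,
          one_apply]; simp only [eq_comm])
    (fun a b => by
      ext i j
      simp only [ρ₀, LinearMap.coe_mk, AddHom.coe_mk, of_apply, mul_apply]
      rw [mul_assoc]
      conv_lhs => rw [hexp _ (hmul b _ (hv j))]
      rw [Finset.mul_sum, map_sum, LinearMap.sum_apply]
      exact Finset.sum_congr rfl fun l _ => by
        rw [mul_smul_comm, map_smul, LinearMap.smul_apply, smul_eq_mul, mul_comm])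
  have hρ : ∀ a i j, ρ a i j = τ (a * v j * st (v i)) := fun a i j => rfl
  refine ⟨k, ρ, fun a => ?_, fun f hf => ?_⟩
  · ext i j
    rw [transpose_apply, hρ, hρ, ← h.tr_st, h.st_mul, h.st_st, h.st_mul, h.st_st, ← mul_assoc,
      h.tr_comm, ← mul_assoc]
  have hfv : ∀ i, f * v i ∈ corner R f e := fun i =>
    ⟨by rw [← mul_assoc, hf.mul_self], by rw [mul_assoc, (hv i).2]⟩
  refine ⟨fun hb => ?_, fun hb => ?_⟩
  · refine Finset.sum_eq_zero fun i _ => ?_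
    have := hfv i
    rw [hb, Submodule.mem_bot] at this
    rw [diag_apply, hρ, this, zero_mul, map_zero]
  obtain ⟨x, hx, hx0⟩ := Submodule.exists_mem_ne_zero_of_ne_bot hb
  obtain ⟨u, hu, hu1, hu2⟩ := h.exists_partialIsometry hR hf he hx hx0
  refine ⟨?_, by rw [← hu2, h.tr_comm, hu1]⟩
  obtain ⟨w₀, hw₀, hw₀o, hw₀s⟩ := hd
  obtain ⟨w, hwdef⟩ : ∃ w : Fin d → A, ∀ j, w j = u * w₀ j := ⟨_, fun _ => rfl⟩
  have hw : ∀ j, w j ∈ corner R f e := fun j => hwdef j ▸ mem_corner_mul hu (hw₀ j)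
  have hwo : OrthoFam (stInner st τ) w := fun i j => by
    rw [← hw₀o i j, stInner_apply, stInner_apply, hwdef, hwdef, h.st_mul, ← mul_assoc, h.tr_comm,
      ← mul_assoc, ← mul_assoc, hu1, (hw₀ i).1]
  have hws : ∀ x ∈ corner R f e, x = ∑ j, stInner st τ x (w j) • w j := fun x hx => by
    obtain ⟨c, hc⟩ := hw₀s _ (mem_corner_mul (h.mem_corner_st hf.st_self he.st_self hu) hx)
    have hxc : x = ∑ j, c j • w j := by
      rw [← hx.1, ← hu2, mul_assoc, hc, Finset.mul_sum]
      exact Finset.sum_congr rfl fun j _ => by rw [mul_smul_comm, hwdef]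
    conv_lhs => rw [hxc]
    refine Finset.sum_congr rfl fun j _ => ?_
    conv_rhs => rw [hxc, hwo.coeff]
  have hpars : ∀ i, ρ f i i = ∑ j, stInner st τ (v i) (w j) * stInner st τ (w j) (v i) :=
    fun i => by
      have e1 : ∀ j, stInner st τ (f * v i) (w j) = stInner st τ (v i) (w j) := fun j => by
        rw [stInner_apply, stInner_apply, mul_assoc, h.tr_comm, mul_assoc]
        congr 2
        conv_rhs => rw [← (hw j).1, h.st_mul, hf.st_self]
      rw [hρ, hws _ (hfv i), ← stInner_apply, map_sum, LinearMap.sum_apply]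
      exact Finset.sum_congr rfl fun j _ => by
        rw [map_smul, LinearMap.smul_apply, smul_eq_mul, e1]
  simp only [trace, diag_apply, hpars]
  rw [Finset.sum_comm]
  have : ∀ j, ∑ i, stInner st τ (v i) (w j) * stInner st τ (w j) (v i) = 1 := fun j => by
    have e1 := hwo j j
    rw [if_pos rfl] at e1
    rw [← e1]
    have e2 := congrArg (fun y => stInner st τ (w j) y) (hexp (w j) ⟨one_mul _, (hw j).2⟩)
    simp only [map_sum, map_smul, smul_eq_mul] at e2
    rw [e2]
    exact Finset.sum_congr rfl fun i _ => by rw [h.stInner_comm (v i)]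
  rw [Finset.sum_congr rfl fun j _ => this j]
  simp

end PosTrace

/-- Representation theorem. -/
theorem PosTrace.exists_matrix_rep (h : PosTrace st τ) [Module.Finite R A] (hR : IsRC R) {n : ℕ}
    (h1 : τ 1 = n)
    (hI1 : ∀ a : A, ∃ f : ℕ → R, IsNewton f (fun i => τ (a ^ i)) ∧ ∀ m, n < m → f m = 0)
    (hI2 : ∀ (x y : A), st x = -x → st y = -y → ∃ f : ℕ → R,
      IsNewton f (fun i => τ ((x * y) ^ i) / 2) ∧ ∀ m, n < m → f m = 0) :
    ∃ ρ : A →ₐ[R] Matrix (Fin n) (Fin n) R, (∀ a, ρ (st a) = (ρ a)ᵀ) ∧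
      ∀ a, trace (ρ a) = τ a := by
  classical
  have hIVT := hR.polyIVT
  obtain ⟨ι, _, u, -, hu, -⟩ := h.exists_minDecomp hR _ 1 0 le_rfl (one_mul _) h.st_one
    (Submodule.zero_mem _) (map_zero _)
  choose d m hd0 hd hm using fun i => h.exists_corner_basis hIVT hI1 hI2 (hu.min i)
  choose k ρ hρt hρf using fun i => h.exists_rep hIVT (hu.min i) (hd i)
  let s : Setoid ι :=
    { r := fun i j => corner R (u i) (u j) ≠ ⊥
      iseqv :=
        { refl := fun i hb => (hu.min i).ne_zero (by
            have := mem_corner_self (hu.min i)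
            rwa [hb, Submodule.mem_bot] at this)
          symm := fun {i j} => h.corner_ne_bot_symm (hu.min i) (hu.min j)
          trans := fun {i j l} => h.corner_ne_bot_trans hIVT (hu.min i) (hu.min j) } }
  have hfin : Fintype (Quotient s) := Fintype.ofFinite _
  let I := Σ c : Quotient s, Fin (m c.out)
  let σ₀ : A →ₗ[R] Matrix (Σ x : I, Fin (k x.1.out)) (Σ x : I, Fin (k x.1.out)) R :=
    { toFun := fun a => blockDiagonal' fun x : I => ρ x.1.out a
      map_add' := fun a b => by
        rw [← blockDiagonal'_add]; congr 1; funext x; rw [map_add]; rfl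
      map_smul' := fun r a => by
        rw [RingHom.id_apply, ← blockDiagonal'_smul]; congr 1; funext x; rw [map_smul]; rfl }
  let σ : A →ₐ[R] Matrix (Σ x : I, Fin (k x.1.out)) (Σ x : I, Fin (k x.1.out)) R :=
    AlgHom.ofLinearMap σ₀
      (by
        simp only [σ₀, LinearMap.coe_mk, AddHom.coe_mk, map_one]
        exact blockDiagonal'_one)
      (fun a b => by
        simp only [σ₀, LinearMap.coe_mk, AddHom.coe_mk, map_mul]
        exact blockDiagonal'_mul _ _)
  have hσ : ∀ a, σ a = blockDiagonal' fun x : I => ρ x.1.out a := fun a => rfl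
  have hσt : ∀ a, σ (st a) = (σ a)ᵀ := fun a => by
    rw [hσ, hσ, blockDiagonal'_transpose]
    simp only [hρt]
  have hσtr : ∀ a, trace (σ a) = ∑ c : Quotient s, m c.out * trace (ρ c.out a) := fun a => by
    rw [hσ, trace_blockDiagonal', Fintype.sum_sigma]
    refine Finset.sum_congr rfl fun c _ => ?_
    change ∑ _x : Fin (m c.out), trace (ρ c.out a) = _
    simp
  have hmin : ∀ f, IsMinIdem st f → trace (σ f) = τ f := fun f hf => by
    obtain ⟨i, hi⟩ : ∃ i, corner R f (u i) ≠ ⊥ := by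
      by_contra! hb
      refine hf.ne_zero ?_
      rw [← mul_one f, ← hu.sum, Finset.mul_sum]
      refine Finset.sum_eq_zero fun i _ => ?_
      have : f * u i ∈ corner R f (u i) :=
        ⟨by rw [← mul_assoc, hf.mul_self], by rw [mul_assoc, (hu.min i).mul_self]⟩
      rwa [hb, Submodule.mem_bot] at this
    have hout : corner R (u i) (u (Quotient.mk s i).out) ≠ ⊥ :=
      Setoid.symm (Quotient.mk_out (s := s) i)
    have hne := h.corner_ne_bot_trans hIVT hf (hu.min i) hi hout
    rw [hσtr, Finset.sum_eq_single (Quotient.mk s i)]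
    · obtain ⟨e1, e2⟩ := (hρf (Quotient.mk s i).out f hf).2 hne
      rw [e1, e2, hm]
    · intro c _ hc
      rw [(hρf c.out f hf).1, mul_zero]
      by_contra hb
      refine hc ?_
      rw [← Quotient.out_eq c]
      exact Quotient.sound (s := s) (h.corner_ne_bot_trans hIVT (hu.min _) hf
        (h.corner_ne_bot_symm hf (hu.min _) hb) hi)
    · simp
  have hsym : ∀ a, st a = a → trace (σ a) = τ a := fun a ha => by
    obtain ⟨ι', _, u', c', hu', rfl⟩ := h.exists_minDecomp hR _ 1 a le_rfl (one_mul _) h.st_one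
      ⟨one_mul _, mul_one _⟩ ha
    simp only [map_sum, map_smul, trace_sum, trace_smul, hmin _ (hu'.min _)]
  have hall : ∀ a, trace (σ a) = τ a := fun a => by
    have := hsym (a + st a) (by rw [map_add, h.st_st, add_comm])
    rw [map_add, map_add, trace_add, hσt, trace_transpose, h.tr_st] at this
    linarith
  have hcard : Fintype.card (Σ x : I, Fin (k x.1.out)) = n := by
    have := hall 1
    rw [map_one, trace_one, h1] at this
    exact_mod_cast this
  let E := Fintype.equivFinOfCardEq hcard
  refine ⟨(reindexAlgEquiv R R E).toAlgHom.comp σ, fun a => ?_, fun a => ?_⟩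
  · simp [hσt]
  · rw [← hall a]
    simp only [trace, AlgHom.comp_apply]
    exact Fintype.sum_equiv E.symm _ _ fun i => by simp [coe_reindexAlgEquiv]

theorem PosTrace.exists_mul_st (h : PosTrace st τ) [Module.Finite R A] (hR : IsRC R) {q : A}
    (hq : st q = q) (hpos : ∀ a, 0 ≤ τ (a * q * st a)) : ∃ c, q = c * st c := by
  obtain ⟨ι, _, u, c, hu, hc⟩ := h.exists_minDecomp hR _ 1 q le_rfl (one_mul _) h.st_one
      ⟨one_mul _, mul_one _⟩ hq
  classical
  have hc0 : ∀ i, 0 ≤ c i := fun i => by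
    have := hpos (u i)
    rw [hc, Finset.mul_sum, Finset.sum_eq_single i, (hu.min i).st_self, mul_smul_comm,
      (hu.min i).mul_self, smul_mul_assoc, (hu.min i).mul_self, map_smul, smul_eq_mul] at this
    · exact (mul_nonneg_iff_of_pos_right (h.minIdem_tr_pos (hu.min i))).1 this
    · exact fun j _ hj => by rw [mul_smul_comm, hu.ortho i j hj.symm, smul_zero]
    · simp
  choose s hs0 hs using fun i => hR.polyIVT.exists_sqrt (hc0 i)
  refine ⟨∑ i, s i • u i, ?_⟩
  rw [map_sum, Finset.sum_mul_sum, hc]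
  refine Finset.sum_congr rfl fun i _ => ?_
  rw [Finset.sum_eq_single i]
  · rw [map_smul, (hu.min i).st_self, smul_mul_assoc, mul_smul_comm, (hu.min i).mul_self,
      smul_smul, hs]
  · exact fun j _ hj => by
      rw [map_smul, (hu.min j).st_self, smul_mul_assoc, mul_smul_comm, hu.ortho i j hj.symm,
        smul_zero, smul_zero]
  · simp
end

section
open Matrix

universe v

/-- Quotient of an algebra with a positive semidefinite tracial functional by the null space. -/
theorem exists_posTrace_quotient {R : Type v} {H : Type*} [Field R] [LinearOrder R]
    [IsStrictOrderedRing R]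
    [Ring H] [Algebra R H] (hR : PolyIVT R) {st : H →ₗ[R] H} {τ : H →ₗ[R] R}
    (st_st : ∀ a, st (st a) = a) (st_mul : ∀ a b, st (a * b) = st b * st a)
    (tr_st : ∀ a, τ (st a) = τ a) (tr_comm : ∀ a b, τ (a * b) = τ (b * a))
    (nonneg : ∀ a, 0 ≤ τ (a * st a)) (N : ℕ)
    (hN : ∀ (k : ℕ) (v : Fin k → H), OrthoFam (stInner st τ) v → k ≤ N) :
    ∃ (A : Type v) (_ : Ring A) (_ : Algebra R A) (_ : Module.Finite R A) (π : H →ₐ[R] A)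
      (st' : A →ₗ[R] A) (τ' : A →ₗ[R] R), Function.Surjective π ∧ PosTrace st' τ' ∧
      (∀ a, st' (π a) = π (st a)) ∧ ∀ a, τ' (π a) = τ a := by
  have symm : ∀ x y, stInner st τ x y = stInner st τ y x := fun x y => by
    rw [stInner_apply, stInner_apply, ← tr_st, st_mul, st_st]
  obtain ⟨d, u, -, huo, hmax⟩ := exists_maximal_orthoFam hR symm nonneg ⊤ N
    fun k v _ hv => hN k v hv
  have null : ∀ x, stInner st τ x x = 0 → ∀ y, stInner st τ x y = 0 := fun x hx y => by
    by_contra hne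
    have h1 := nonneg ((-(stInner st τ y y + 1) : R) • x + (2 * stInner st τ x y) • y)
    rw [← stInner_apply] at h1
    simp only [map_add, map_smul, LinearMap.add_apply, LinearMap.smul_apply, smul_eq_mul, hx,
      symm y x] at h1
    have h2 := nonneg y
    rw [← stInner_apply] at h2
    have : 0 < (stInner st τ x y) ^ 2 := by positivity
    nlinarith
  have hexp : ∀ x y, stInner st τ x y = ∑ i, stInner st τ x (u i) * stInner st τ (u i) y :=
    fun x y => by
      have := null _ (hmax x trivial) y
      rw [map_sub, LinearMap.sub_apply, sub_eq_zero, map_sum, LinearMap.sum_apply] at this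
      simpa using this
  have hadj : ∀ a x y, stInner st τ (a * x) y = stInner st τ x (st a * y) := fun a x y => by
    rw [stInner_apply, stInner_apply, st_mul, st_st, mul_assoc, tr_comm, mul_assoc]
  let π₀ : H →ₗ[R] Matrix (Fin d) (Fin d) R :=
    { toFun := fun a => of fun i j => stInner st τ (a * u j) (u i)
      map_add' := fun a b => by ext i j; simp [add_mul]
      map_smul' := fun r a => by ext i j; simp }
  let π : H →ₐ[R] Matrix (Fin d) (Fin d) R := AlgHom.ofLinearMap π₀
    (by ext i j; simp only [π₀, LinearMap.coe_mk, AddHom.coe_mk, of_apply, one_mul, huo j i,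
          one_apply]; simp only [eq_comm])
    (fun a b => by
      ext i j
      simp only [π₀, LinearMap.coe_mk, AddHom.coe_mk, of_apply, mul_apply]
      rw [mul_assoc, hadj, hexp]
      exact Finset.sum_congr rfl fun l _ => by rw [← hadj, mul_comm])
  have hπ : ∀ a i j, π a i j = stInner st τ (a * u j) (u i) := fun a i j => rfl
  have hπt : ∀ a, (π a)ᵀ = π (st a) := fun a => by
    ext i j
    rw [transpose_apply, hπ, hπ, hadj, symm]
  let c : Fin d → R := fun i => stInner st τ 1 (u i)
  have hτ : ∀ a, c ⬝ᵥ (π a *ᵥ c) = τ a := fun a => by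
    have h1 : τ a = stInner st τ (a * 1) 1 := by
      have : st 1 = 1 := by
        have e := st_mul 1 (st 1)
        rw [one_mul, st_st, one_mul] at e
        exact e.symm
      rw [stInner_apply, this, mul_one, mul_one]
    rw [h1, hexp]
    refine Finset.sum_congr rfl fun i _ => ?_
    rw [mul_comm, symm (u i) 1]
    refine congrArg (· * c i) ?_
    rw [hadj, hexp]
    change ∑ j, π a i j * c j = _
    exact Finset.sum_congr rfl fun j _ => by rw [hπ, hadj, mul_comm]
  let stA : π.range →ₗ[R] π.range :=
    { toFun := fun m => ⟨(m : Matrix (Fin d) (Fin d) R)ᵀ, by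
        obtain ⟨a, ha⟩ := m.2
        exact ⟨st a, by rw [← ha]; exact (hπt a).symm⟩⟩
      map_add' := fun a b => rfl
      map_smul' := fun r a => rfl }
  let τA : π.range →ₗ[R] R :=
    { toFun := fun m => c ⬝ᵥ ((m : Matrix (Fin d) (Fin d) R) *ᵥ c)
      map_add' := fun a b => by simp [add_mulVec]
      map_smul' := fun r a => by simp [smul_mulVec] }
  have hst : ∀ a, stA (π.rangeRestrict a) = π.rangeRestrict (st a) := fun a =>
    Subtype.ext (hπt a)
  have hτA : ∀ a, τA (π.rangeRestrict a) = τ a := hτ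
  have hsurj := π.rangeRestrict_surjective
  refine ⟨π.range, inferInstance, inferInstance, inferInstance, π.rangeRestrict, stA, τA, hsurj,
    ⟨hsurj.forall.2 fun a => ?_, hsurj.forall₂.2 fun a b => ?_, hsurj.forall.2 fun a => ?_,
      hsurj.forall₂.2 fun a b => ?_, hsurj.forall.2 fun a ha => ?_⟩, hst, hτA⟩
  · rw [hst, hst, st_st]
  · rw [← map_mul, hst, hst, hst, st_mul, map_mul]
  · rw [hst, hτA, hτA, tr_st]
  · rw [← map_mul, ← map_mul, hτA, hτA, tr_comm]
  · rw [hst, ← map_mul, hτA]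
    refine lt_of_le_of_ne (nonneg a) fun h0 => ha (Subtype.ext ?_)
    ext i j
    change π a i j = 0
    have e1 : stInner st τ (a * u j) (u i) = stInner st τ a (u i * st (u j)) := by
      rw [stInner_apply, stInner_apply, st_mul, st_st, mul_assoc]
    rw [hπ, e1, null a h0.symm]

theorem det_mul_transpose_eq_zero {B ι κ : Type*} [CommRing B] [Fintype ι] [DecidableEq ι]
    [Fintype κ] (U : Matrix ι κ B) (h : Fintype.card κ < Fintype.card ι) :
    (U * Uᵀ).det = 0 := by
  classical
  obtain ⟨e⟩ := Function.Embedding.nonempty_of_card_le h.le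
  obtain ⟨i₀, hi₀⟩ : ∃ i, i ∉ Set.range e := by
    by_contra! hs
    exact absurd (Fintype.card_le_of_surjective e hs) (not_le.2 h)
  let V : Matrix ι ι B := of fun i j => if hj : j ∈ Set.range e then U i hj.choose else 0
  have hV : ∀ i k, V i (e k) = U i k := fun i k => by
    have hk : e k ∈ Set.range e := ⟨k, rfl⟩
    simp only [V, of_apply, dif_pos hk, e.injective hk.choose_spec]
  have hVV : U * Uᵀ = V * Vᵀ := by
    ext i j
    simp only [mul_apply, transpose_apply, ← hV]
    rw [← Finset.sum_map Finset.univ e (fun l => V i l * V j l)]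
    refine Finset.sum_subset (Finset.subset_univ _) fun l _ hl => ?_
    have : l ∉ Set.range e := fun ⟨k, hk⟩ => hl (by simp [← hk])
    simp only [V, of_apply, dif_neg this, zero_mul]
  rw [hVV, det_mul, det_eq_zero_of_column_eq_zero i₀ fun i => by
    simp only [V, of_apply, dif_neg hi₀],
    zero_mul]

section Gram
variable {R : Type*} [Field R] [LinearOrder R] [IsStrictOrderedRing R]

/-- A quadratic form with coefficients in a subring that is nonnegative over the subring is
nonnegative. -/
theorem gram_nonneg (C : Subring R) : ∀ (m : ℕ) (G : Fin m → Fin m → R),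
    (∀ i j, G i j ∈ C) → (∀ i j, G i j = G j i) →
    (∀ x : Fin m → R, (∀ i, x i ∈ C) → 0 ≤ ∑ i, ∑ j, x i * x j * G i j) →
    ∀ x : Fin m → R, 0 ≤ ∑ i, ∑ j, x i * x j * G i j := by
  intro m
  induction m with
  | zero => intro G _ _ _ x; simp
  | succ m ih =>
    intro G hG hs hp x
    have hexp : ∀ x : Fin (m + 1) → R, ∑ i, ∑ j, x i * x j * G i j =
        x 0 * x 0 * G 0 0 + 2 * x 0 * (∑ j : Fin m, G 0 j.succ * x j.succ) +
          ∑ i : Fin m, ∑ j : Fin m, x i.succ * x j.succ * G i.succ j.succ := fun x => by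
      simp only [Fin.sum_univ_succ, Finset.sum_add_distrib, hs _ 0]
      rw [two_mul, add_mul, Finset.mul_sum]
      have : ∀ j : Fin m, x j.succ * x 0 * G 0 j.succ = x 0 * x j.succ * G 0 j.succ :=
        fun j => by ring
      simp only [this]
      have : ∀ j : Fin m, x 0 * (G 0 j.succ * x j.succ) = x 0 * x j.succ * G 0 j.succ :=
        fun j => by ring
      simp only [this]
      ring
    have h00 : 0 ≤ G 0 0 := by
      have := hp (Pi.single 0 1) fun i => by
        rw [Pi.single_apply]; split_ifs; exacts [C.one_mem, C.zero_mem]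
      rw [hexp] at this
      simpa [Fin.succ_ne_zero] using this
    rcases h00.eq_or_lt with h0 | h0
    · have hG0 : ∀ j : Fin m, G 0 j.succ = 0 := fun j => by
        by_contra hne
        set a := G 0 j.succ with ha
        set b := G j.succ j.succ with hb
        let y : Fin (m + 1) → R := Fin.cons (-(a * (b + 1))) (Pi.single j (a ^ 2))
        have hy0 : y 0 = -(a * (b + 1)) := rfl
        have hys : ∀ i : Fin m, y i.succ = (Pi.single j (a ^ 2) : Fin m → R) i := fun i => rfl
        have := hp y fun i => by
          refine Fin.cases ?_ (fun i => ?_) i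
          · rw [hy0]
            exact C.neg_mem (C.mul_mem (hG _ _) (C.add_mem (hG _ _) C.one_mem))
          · rw [hys, Pi.single_apply]
            split_ifs
            exacts [C.pow_mem (hG _ _) 2, C.zero_mem]
        rw [hexp, hy0, ← h0] at this
        simp only [hys, Pi.single_apply, mul_ite, mul_zero, ite_mul, zero_mul,
          Finset.sum_ite_eq', Finset.mem_univ, if_true, ← ha, ← hb] at this
        have hbn : 0 ≤ b := by
          have := hp (Pi.single j.succ 1) fun i => by
            rw [Pi.single_apply]; split_ifs; exacts [C.one_mem, C.zero_mem]
          simpa [Pi.single_apply, ← hb] using this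
        have ha4 : 0 < a ^ 4 := by positivity
        nlinarith
      have := ih (fun i j => G i.succ j.succ) (fun i j => hG _ _) (fun i j => hs _ _)
        (fun y hy => by
          have := hp (Fin.cons 0 y) fun i => by
            refine Fin.cases ?_ (fun i => ?_) i
            exacts [C.zero_mem, hy i]
          rw [hexp] at this
          simpa using this) (fun i => x i.succ)
      rw [hexp, ← h0]
      simpa [hG0] using this
    · have key : ∀ x : Fin (m + 1) → R, G 0 0 * ∑ i, ∑ j, x i * x j * G i j =
          (x 0 * G 0 0 + ∑ j : Fin m, G 0 j.succ * x j.succ) ^ 2 +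
          ∑ i : Fin m, ∑ j : Fin m, x i.succ * x j.succ *
            (G 0 0 * G i.succ j.succ - G 0 i.succ * G 0 j.succ) := fun x => by
        have e1 : ∑ i : Fin m, ∑ j : Fin m, x i.succ * x j.succ *
            (G 0 0 * G i.succ j.succ - G 0 i.succ * G 0 j.succ) =
            G 0 0 * (∑ i : Fin m, ∑ j : Fin m, x i.succ * x j.succ * G i.succ j.succ) -
            (∑ j : Fin m, G 0 j.succ * x j.succ) * (∑ j : Fin m, G 0 j.succ * x j.succ) := by
          rw [Finset.sum_mul_sum, Finset.mul_sum, ← Finset.sum_sub_distrib]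
          refine Finset.sum_congr rfl fun i _ => ?_
          rw [Finset.mul_sum, ← Finset.sum_sub_distrib]
          exact Finset.sum_congr rfl fun j _ => by ring
        rw [hexp, e1]
        ring
      have hsub := ih (fun i j => G 0 0 * G i.succ j.succ - G 0 i.succ * G 0 j.succ)
        (fun i j => C.sub_mem (C.mul_mem (hG _ _) (hG _ _)) (C.mul_mem (hG _ _) (hG _ _)))
        (fun i j => by rw [hs i.succ j.succ]; ring)
        (fun y hy => by
          let z : Fin (m + 1) → R := Fin.cons (-∑ j : Fin m, G 0 j.succ * y j)
            (fun j => G 0 0 * y j)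
          have hz0 : z 0 = -∑ j : Fin m, G 0 j.succ * y j := rfl
          have hzs : ∀ i : Fin m, z i.succ = G 0 0 * y i := fun i => rfl
          have hz := hp z fun i => by
            refine Fin.cases ?_ (fun i => ?_) i
            · rw [hz0]
              exact C.neg_mem (C.sum_mem fun j _ => C.mul_mem (hG _ _) (hy j))
            · rw [hzs]
              exact C.mul_mem (hG _ _) (hy i)
          have e1 := key z
          have e2 : z 0 * G 0 0 + ∑ j : Fin m, G 0 j.succ * z j.succ = 0 := by
            simp only [hz0, hzs]
            rw [neg_mul, Finset.sum_mul, neg_add_eq_zero]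
            exact Finset.sum_congr rfl fun j _ => by ring
          have e3 : ∑ i : Fin m, ∑ j : Fin m, z i.succ * z j.succ *
              (G 0 0 * G i.succ j.succ - G 0 i.succ * G 0 j.succ) = G 0 0 ^ 2 *
              ∑ i : Fin m, ∑ j : Fin m, y i * y j *
              (G 0 0 * G i.succ j.succ - G 0 i.succ * G 0 j.succ) := by
            rw [Finset.mul_sum]
            refine Finset.sum_congr rfl fun i _ => ?_
            rw [Finset.mul_sum]
            exact Finset.sum_congr rfl fun j _ => by rw [hzs, hzs]; ring
          rw [e2, e3] at e1
          have := mul_nonneg h0.le hz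
          rw [e1, zero_pow two_ne_zero, zero_add] at this
          exact (mul_nonneg_iff_of_pos_left (by positivity)).1 this) (fun i => x i.succ)
      refine (mul_nonneg_iff_of_pos_left h0).1 ?_
      rw [key]
      exact add_nonneg (sq_nonneg _) hsub

end Gram
end

section
open Matrix Polynomial

universe v

/-- An algebra of matrices over a domain, with a scalar-valued specialization of the traces that is
positive, is represented by matrices over the scalars. -/
theorem exists_rep_of_positive_trace {R : Type v} {B : Type*} [Field R] [LinearOrder R]
    [IsStrictOrderedRing R] [CommRing B] [IsDomain B] [IsIntegrallyClosed B[X]] [Algebra ℚ B]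
    [Algebra R B] (hR : IsRC R) {n : ℕ} (D : Subalgebra R B) (Φ : D →ₐ[R] R)
    (H : Subalgebra R (Matrix (Fin n) (Fin n) B)) (hT : ∀ z ∈ H, zᵀ ∈ H)
    (htr : ∀ z ∈ H, trace z ∈ D) (hDH : ∀ c ∈ D, c • (1 : Matrix (Fin n) (Fin n) B) ∈ H)
    (hpos : ∀ z (hz : z ∈ H), 0 ≤ Φ ⟨trace (z * zᵀ), htr _ (H.mul_mem hz (hT z hz))⟩) :
    ∃ ρ : H →ₐ[R] Matrix (Fin n) (Fin n) R,
      (∀ z (hz : z ∈ H), ρ ⟨zᵀ, hT z hz⟩ = (ρ ⟨z, hz⟩)ᵀ) ∧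
      (∀ z (hz : z ∈ H), trace (ρ ⟨z, hz⟩) = Φ ⟨trace z, htr z hz⟩) ∧
      (∀ c (hc : c ∈ D), ρ ⟨c • 1, hDH c hc⟩ = Φ ⟨c, hc⟩ • (1 : Matrix (Fin n) (Fin n) R)) ∧
      ∀ s (hs : s ∈ H), sᵀ = s →
        (∀ z (hz : z ∈ H), 0 ≤ Φ ⟨trace (z * s * zᵀ),
          htr _ (H.mul_mem (H.mul_mem hz hs) (hT z hz))⟩) →
        ∃ L : Matrix (Fin n) (Fin n) R, ρ ⟨s, hs⟩ = L * Lᵀ := by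
  let st : H →ₗ[R] H :=
    { toFun := fun z => ⟨(z : Matrix (Fin n) (Fin n) B)ᵀ, hT z z.2⟩
      map_add' := fun a b => rfl
      map_smul' := fun r a => rfl }
  let τ : H →ₗ[R] R :=
    { toFun := fun z => Φ ⟨trace (z : Matrix (Fin n) (Fin n) B), htr z z.2⟩
      map_add' := fun a b => by
        rw [← map_add]
        exact congrArg Φ (Subtype.ext (trace_add a.1 b.1))
      map_smul' := fun r a => by
        rw [RingHom.id_apply, ← map_smul]
        exact congrArg Φ (Subtype.ext (trace_smul r a.1)) }
  have hst : ∀ z : H, ((st z : H) : Matrix (Fin n) (Fin n) B) = (z : Matrix (Fin n) (Fin n) B)ᵀ :=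
    fun z => rfl
  have hτ : ∀ z : H, τ z = Φ ⟨trace (z : Matrix (Fin n) (Fin n) B), htr z z.2⟩ := fun z => rfl
  have st_st : ∀ z, st (st z) = z := fun z => rfl
  have st_mul : ∀ a b, st (a * b) = st b * st a := fun a b =>
    Subtype.ext (transpose_mul _ _)
  have tr_st : ∀ a, τ (st a) = τ a := fun a => by
    rw [hτ, hτ]; exact congrArg Φ (Subtype.ext (trace_transpose a.1))
  have tr_comm : ∀ a b, τ (a * b) = τ (b * a) := fun a b => by
    rw [hτ, hτ]
    exact congrArg Φ (Subtype.ext (trace_mul_comm a.1 b.1))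
  have nonneg : ∀ a, 0 ≤ τ (a * st a) := fun a => hpos a a.2
  have hbound : ∀ (k : ℕ) (v : Fin k → H), OrthoFam (stInner st τ) v → k ≤ n * n := by
    intro k v hv
    by_contra! hlt
    let U : Matrix (Fin k) (Fin n × Fin n) B :=
      of fun i x => (v i : Matrix (Fin n) (Fin n) B) x.1 x.2
    let G : Matrix (Fin k) (Fin k) D := of fun i j =>
      ⟨trace ((v i : Matrix (Fin n) (Fin n) B) * (v j : Matrix (Fin n) (Fin n) B)ᵀ),
        htr _ (H.mul_mem (v i).2 (hT _ (v j).2))⟩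
    have hGU : G.map D.val = U * Uᵀ := by
      ext i j
      simp only [G, U, map_apply, of_apply, mul_apply, transpose_apply, Fintype.sum_prod_type,
        trace, diag_apply]
      rfl
    have hdet : G.det = 0 := by
      have : D.val G.det = 0 := by
        rw [AlgHom.map_det, AlgHom.mapMatrix_apply, hGU]
        exact det_mul_transpose_eq_zero U (by simpa using hlt)
      exact Subtype.ext this
    have hone : Φ G.det = 1 := by
      rw [AlgHom.map_det, AlgHom.mapMatrix_apply]
      have : G.map Φ = 1 := by
        ext i j
        rw [one_apply]
        exact hv i j
      rw [this, det_one]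
    rw [hdet, map_zero] at hone
    exact zero_ne_one hone
  obtain ⟨A, _, _, _, π, st', τ', hsurj, hPT, hst', hτ'⟩ :=
    exists_posTrace_quotient hR.polyIVT st_st st_mul tr_st tr_comm nonneg _ hbound
  have hnewton : ∀ (f p : ℕ → B) (hp : ∀ i, p (i + 1) ∈ D) (hf : IsNewton f p),
      (∀ m, n < m → f m = 0) → ∀ p' : ℕ → R, (∀ i, p' (i + 1) = Φ ⟨p (i + 1), hp i⟩) →
      ∃ f' : ℕ → R, IsNewton f' p' ∧ ∀ m, n < m → f' m = 0 := by
    intro f p hp hf h0 p' hp'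
    have hfD := fun m => hf.mem D m fun i _ => hp i
    refine ⟨fun m => Φ ⟨f m, hfD m⟩, ⟨?_, fun m => ?_⟩, fun m hm => ?_⟩
    · rw [← map_one Φ]; exact congrArg Φ (Subtype.ext hf.1)
    · simp only [hp']
      rw [← map_natCast Φ m, ← map_one Φ, ← map_add, ← map_mul]
      simp only [← map_neg, ← map_pow, ← map_mul, ← map_sum]
      refine congrArg Φ (Subtype.ext ?_)
      have := hf.2 m
      push_cast
      exact this
    · rw [← map_zero Φ]; exact congrArg Φ (Subtype.ext (h0 m hm))
  have hpow : ∀ (z : H) i, τ' (π z ^ i) = Φ ⟨trace ((z : Matrix (Fin n) (Fin n) B) ^ i),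
      htr _ (H.pow_mem z.2 i)⟩ := fun z i => by
    rw [← map_pow, hτ']; rfl
  have hI1 : ∀ a : A, ∃ f : ℕ → R, IsNewton f (fun i => τ' (a ^ i)) ∧ ∀ m, n < m → f m = 0 := by
    refine hsurj.forall.2 fun z => ?_
    refine hnewton _ _ (fun i => htr _ (H.pow_mem z.2 _))
      (isNewton_detOneAdd (z : Matrix (Fin n) (Fin n) B)) (fun m hm => ?_) _ fun i => hpow z _
    exact coeff_eq_zero_of_natDegree_lt ((detOneAdd_natDegree_le _).trans_lt (by simpa using hm))
  have hskew : ∀ a : A, st' a = -a → ∃ z : H, π z = a ∧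
      (z : Matrix (Fin n) (Fin n) B)ᵀ = -(z : Matrix (Fin n) (Fin n) B) := by
    refine hsurj.forall.2 fun z hz => ⟨(2⁻¹ : R) • (z - st z), ?_, ?_⟩
    · rw [map_smul, map_sub, ← hst', hz]
      module
    · simp only [Subalgebra.coe_smul, Subalgebra.coe_sub, hst, transpose_smul, transpose_sub,
        transpose_transpose, ← smul_neg, neg_sub]
  have hI2 : ∀ (x y : A), st' x = -x → st' y = -y → ∃ f : ℕ → R,
      IsNewton f (fun i => τ' ((x * y) ^ i) / 2) ∧ ∀ m, n < m → f m = 0 := by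
    intro x y hx hy
    obtain ⟨z, rfl, hz⟩ := hskew x hx
    obtain ⟨w, rfl, hw⟩ := hskew y hy
    have hhalf : ∀ i, 2 * ((algebraMap R B 2⁻¹) * trace
        (((z : Matrix (Fin n) (Fin n) B) * (w : Matrix (Fin n) (Fin n) B)) ^ i)) =
        trace (((z : Matrix (Fin n) (Fin n) B) * (w : Matrix (Fin n) (Fin n) B)) ^ i) :=
      fun i => by
        rw [← mul_assoc, show (2 : B) = algebraMap R B 2 from (map_ofNat _ 2).symm, ← map_mul,
          mul_inv_cancel₀ two_ne_zero, map_one, one_mul]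
    have hmem : ∀ i, trace (((z : Matrix (Fin n) (Fin n) B) *
        (w : Matrix (Fin n) (Fin n) B)) ^ i) ∈ D := fun i =>
      htr _ (H.pow_mem (H.mul_mem z.2 w.2) _)
    obtain ⟨f, hf, hf0⟩ := exists_isNewton_half hz hw hhalf
    refine hnewton f _ (fun i => D.mul_mem (D.algebraMap_mem _) (hmem _)) hf
      (fun m hm => hf0 m (by omega)) _ fun i => ?_
    have e1 : (⟨_, D.mul_mem (D.algebraMap_mem 2⁻¹) (hmem (i + 1))⟩ : D) =
        (2⁻¹ : R) • (⟨_, hmem (i + 1)⟩ : D) :=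
      Subtype.ext (by rw [Subalgebra.coe_smul, Algebra.smul_def])
    rw [e1, map_smul, ← map_mul π, hpow, smul_eq_mul, div_eq_inv_mul]
    rfl
  have hτ1 : τ' 1 = n := by
    rw [← map_one π, hτ', hτ, ← map_natCast Φ]
    exact congrArg Φ (Subtype.ext (by simp))
  obtain ⟨ρ, hρt, hρtr⟩ := hPT.exists_matrix_rep hR hτ1 hI1 hI2
  refine ⟨ρ.comp π, fun z hz => ?_, fun z hz => ?_, fun c hc => ?_, fun s hs hss hsp => ?_⟩
  · rw [AlgHom.comp_apply, AlgHom.comp_apply, ← hρt, hst']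
    rfl
  · rw [AlgHom.comp_apply, hρtr, hτ']
    rfl
  · have h0 : π (⟨c • 1, hDH c hc⟩ - Φ ⟨c, hc⟩ • 1) = 0 := by
      by_contra hne
      have := hPT.pos _ hne
      rw [hst', ← map_mul, hτ', hτ] at this
      refine this.ne' ?_
      have e1 : (⟨trace ((⟨c • 1, hDH c hc⟩ - Φ ⟨c, hc⟩ • 1) *
          st (⟨c • 1, hDH c hc⟩ - Φ ⟨c, hc⟩ • 1) : H).1, htr _ (Subtype.prop _)⟩ : D) =
          algebraMap R D n * ((⟨c, hc⟩ - algebraMap R D (Φ ⟨c, hc⟩)) *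
            (⟨c, hc⟩ - algebraMap R D (Φ ⟨c, hc⟩))) := by
        refine Subtype.ext ?_
        have e2 : ((⟨c • 1, hDH c hc⟩ - Φ ⟨c, hc⟩ • 1 : H) : Matrix (Fin n) (Fin n) B) =
            (c - algebraMap R B (Φ ⟨c, hc⟩)) • 1 := by
          rw [sub_smul, algebraMap_smul]
          rfl
        simp only [Subalgebra.coe_mul, hst, e2, transpose_smul, transpose_one, smul_mul_smul_comm,
          mul_one, trace_smul, trace_one, Fintype.card_fin]
        have e3 : ((algebraMap R D n : D) : B) = n := by
          rw [Subalgebra.coe_algebraMap, map_natCast]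
        rw [e3]
        simp only [Subalgebra.coe_sub, Subalgebra.coe_algebraMap, smul_eq_mul]
        ring
      rw [e1, map_mul, map_mul, map_sub, AlgHom.commutes]
      simp
    rw [map_sub, map_smul, map_one, sub_eq_zero] at h0
    rw [AlgHom.comp_apply, h0, map_smul, map_one]
  · obtain ⟨L, hL⟩ := hPT.exists_mul_st hR (q := π ⟨s, hs⟩)
      (by rw [hst']; congr 1; exact Subtype.ext hss)
      (hsurj.forall.2 fun z => by
        rw [hst', ← map_mul, ← map_mul, hτ']
        exact hsp z z.2)
    exact ⟨ρ L, by rw [AlgHom.comp_apply, hL, map_mul, hρt]⟩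
end

section
open Matrix

variable {n g : ℕ}

/-- The center of the trace ring, as a ring of polynomials. -/
def centerAlg (n g : ℕ) : Subalgebra ℝ (PolyRing n g) :=
  (traceRing n g).comap ((Algebra.ofId (PolyRing n g) (MatP n g)).restrictScalars ℝ)

theorem mem_centerAlg {p : PolyRing n g} :
    p ∈ centerAlg n g ↔ p • (1 : MatP n g) ∈ traceRing n g := by
  rw [← Algebra.algebraMap_eq_smul_one]
  rfl

theorem smul_mem_traceRing {p : PolyRing n g} {h : MatP n g} (hp : p ∈ centerAlg n g)
    (hh : h ∈ traceRing n g) : p • h ∈ traceRing n g := by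
  simpa using (traceRing n g).mul_mem (mem_centerAlg.1 hp) hh

theorem closure_subset_traceRing {w : MatP n g} (hw : w ∈ Submonoid.closure (genSet n g)) :
    w ∈ traceRing n g := by
  have : Submonoid.closure (genSet n g) ≤ (traceRing n g).toSubmonoid :=
    Submonoid.closure_le.2 fun x hx => Algebra.subset_adjoin (Or.inl hx)
  exact this hw

theorem genMat_mem (j : Fin g) : genMat n g j ∈ traceRing n g :=
  Algebra.subset_adjoin (Or.inl (Or.inl ⟨j, rfl⟩))

theorem transpose_mem_genSet {x : MatP n g} (hx : x ∈ genSet n g) : xᵀ ∈ genSet n g := by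
  rcases hx with ⟨j, rfl⟩ | ⟨j, rfl⟩
  · exact Or.inr ⟨j, rfl⟩
  · exact Or.inl ⟨j, (transpose_transpose _).symm⟩

theorem transpose_mem_traceRing {h : MatP n g} (hh : h ∈ traceRing n g) :
    hᵀ ∈ traceRing n g := by
  induction hh using Algebra.adjoin_induction with
  | mem x hx =>
    rcases hx with hx | ⟨w, hw, rfl⟩
    · exact Algebra.subset_adjoin (Or.inl (transpose_mem_genSet hx))
    · exact Algebra.subset_adjoin (Or.inr ⟨w, hw, by simp⟩)
  | algebraMap r =>
    rw [Algebra.algebraMap_eq_smul_one, transpose_smul, transpose_one]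
    exact (traceRing n g).smul_mem (one_mem _) r
  | add x y _ _ hx hy => exact add_mem hx hy
  | mul x y _ _ hx hy => rw [transpose_mul]; exact mul_mem hy hx

theorem trace_mem_centerAlg {h : MatP n g} (hh : h ∈ traceRing n g) :
    trace h ∈ centerAlg n g := by
  suffices ∀ y : MatP n g, (∀ w ∈ Submonoid.closure (genSet n g), trace (y * w) ∈ centerAlg n g) →
      ∀ w ∈ Submonoid.closure (genSet n g), trace (y * h * w) ∈ centerAlg n g by
    simpa using this 1 (fun w hw => mem_centerAlg.2 (Algebra.subset_adjoin
      (Or.inr ⟨w, hw, by simp⟩))) 1 (one_mem _)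
  induction hh using Algebra.adjoin_induction with
  | mem x hx =>
    intro y hy w hw
    rcases hx with hx | ⟨v, hv, rfl⟩
    · rw [mul_assoc]
      exact hy _ (mul_mem (Submonoid.subset_closure hx) hw)
    · rw [mul_smul_comm, mul_one, smul_mul_assoc, trace_smul]
      exact mul_mem (mem_centerAlg.2 (Algebra.subset_adjoin (Or.inr ⟨v, hv, rfl⟩))) (hy w hw)
  | algebraMap r =>
    intro y hy w hw
    rw [Algebra.algebraMap_eq_smul_one, mul_smul_comm, mul_one, smul_mul_assoc, trace_smul]
    exact (centerAlg n g).smul_mem (hy w hw) r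
  | add x y _ _ hx hy =>
    intro z hz w hw
    rw [mul_add, add_mul, trace_add]
    exact add_mem (hx z hz w hw) (hy z hz w hw)
  | mul x y _ _ hx hy =>
    intro z hz w hw
    rw [← mul_assoc]
    exact hy _ (hx z hz) w hw

theorem trace_smul_one_mem {h : MatP n g} (hh : h ∈ traceRing n g) :
    trace h • (1 : MatP n g) ∈ traceRing n g :=
  mem_centerAlg.1 (trace_mem_centerAlg hh)

end

section
open Matrix TensorProduct

/-- Extension of scalars for a homomorphism defined on a subalgebra of a polynomial ring. -/
theorem exists_baseChange_hom {k R σ : Type*} [Field k] [Field R] [Algebra k R]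
    (C : Subalgebra k (MvPolynomial σ k)) (φ : C →ₐ[k] R) :
    ∃ (D : Subalgebra R (MvPolynomial σ R)) (Φ : D →ₐ[R] R)
      (hD : ∀ p ∈ C, MvPolynomial.map (algebraMap k R) p ∈ D),
      (∀ p (hp : p ∈ C), Φ ⟨_, hD p hp⟩ = φ ⟨p, hp⟩) ∧
      ∀ x ∈ D, x ∈ Submodule.span R (MvPolynomial.map (algebraMap k R) '' (C : Set _)) := by
  let ι : R ⊗[k] C →ₐ[R] MvPolynomial σ R :=
    (MvPolynomial.algebraTensorAlgEquiv k R).toAlgHom.comp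
      (Algebra.TensorProduct.map (AlgHom.id R R) C.val)
  have hι : ∀ r (c : C), ι (r ⊗ₜ c) =
      r • MvPolynomial.map (algebraMap k R) (c : MvPolynomial σ k) :=
    fun r c => by simp [ι]
  have hinj : Function.Injective ι := by
    refine (MvPolynomial.algebraTensorAlgEquiv k R).injective.comp ?_
    exact Module.Flat.lTensor_preserves_injective_linearMap (M := R) C.val.toLinearMap
      Subtype.val_injective
  let e := AlgEquiv.ofInjective ι hinj
  let Φ : R ⊗[k] C →ₐ[R] R := Algebra.TensorProduct.lift (AlgHom.id R R) φ fun _ _ => .all _ _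
  have hD : ∀ p (hp : p ∈ C), MvPolynomial.map (algebraMap k R) p = ι (1 ⊗ₜ ⟨p, hp⟩) :=
    fun p hp => by rw [hι, one_smul]
  refine ⟨ι.range, Φ.comp e.symm.toAlgHom, fun p hp => ⟨_, (hD p hp).symm⟩, fun p hp => ?_, ?_⟩
  · have : (⟨_, ⟨_, (hD p hp).symm⟩⟩ : ι.range) = e (1 ⊗ₜ ⟨p, hp⟩) :=
      Subtype.ext (hD p hp)
    change Φ (e.symm _) = _
    rw [this, AlgEquiv.symm_apply_apply]
    simp [Φ]
  · rintro _ ⟨x, rfl⟩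
    induction x with
    | zero => exact (map_zero ι) ▸ zero_mem _
    | tmul r c =>
      change ι _ ∈ _
      rw [hι]
      exact Submodule.smul_mem _ _ (Submodule.subset_span ⟨_, c.2, rfl⟩)
    | add x y hx hy =>
      change ι _ ∈ _
      rw [map_add]
      exact add_mem hx hy
end

section
open Matrix Polynomial

universe v

variable {n g : ℕ}

/-- A homomorphism from the center of the trace ring to a real closed field that is nonnegative on
the traces of hermitian squares is evaluation at a point. -/
theorem exists_point_of_nonneg {R : Type v} [Field R] [LinearOrder R] [IsStrictOrderedRing R]
    [Algebra ℝ R] (hR : IsRC R) (hn : 0 < n) (φ : centerAlg n g →ₐ[ℝ] R)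
    (hφ : ∀ h (hh : h ∈ traceRing n g),
      0 ≤ φ ⟨_, trace_mem_centerAlg (mul_mem hh (transpose_mem_traceRing hh))⟩) :
    ∃ x : Fin g × Fin n × Fin n → R,
      (∀ c (hc : c ∈ centerAlg n g), MvPolynomial.aeval x c = φ ⟨c, hc⟩) ∧
      ∀ s (hs : s ∈ traceRing n g), sᵀ = s →
        (∀ h (hh : h ∈ traceRing n g),
          0 ≤ φ ⟨_, trace_mem_centerAlg (mul_mem (mul_mem hh hs) (transpose_mem_traceRing hh))⟩) →
        ∃ L : Matrix (Fin n) (Fin n) R, s.map (MvPolynomial.aeval x) = L * Lᵀ := by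
  obtain ⟨D, Φ, hD, hΦ, hDspan⟩ := exists_baseChange_hom (centerAlg n g) φ
  let m : PolyRing n g →ₐ[ℝ] MvPolynomial (Fin g × Fin n × Fin n) R :=
    MvPolynomial.mapAlgHom (Algebra.ofId ℝ R)
  have hm : ∀ p, m p = MvPolynomial.map (algebraMap ℝ R) p := fun p => rfl
  let M : MatP n g →ₐ[ℝ] Matrix (Fin n) (Fin n) (MvPolynomial (Fin g × Fin n × Fin n) R) :=
    m.mapMatrix
  have hMT : ∀ h, M hᵀ = (M h)ᵀ := fun h => rfl
  have hMtr : ∀ h, trace (M h) = m (trace h) := fun h => by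
    simp only [trace, map_sum]
    rfl
  have hMs : ∀ (c : PolyRing n g) h, M (c • h) = m c • M h := fun c h => by
    ext1 i j
    exact map_mul m _ _
  let H : Subalgebra R (Matrix (Fin n) (Fin n) (MvPolynomial (Fin g × Fin n × Fin n) R)) :=
    Algebra.adjoin R (M '' (traceRing n g : Set (MatP n g)))
  have hMH : ∀ h ∈ traceRing n g, M h ∈ H := fun h hh => Algebra.subset_adjoin ⟨h, hh, rfl⟩
  have hspan : ∀ z ∈ H, z ∈ Submodule.span R (M '' (traceRing n g : Set (MatP n g))) := by
    intro z hz
    have h1 : (Submonoid.closure (M '' (traceRing n g : Set (MatP n g))) : Set _) =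
        M '' (traceRing n g : Set (MatP n g)) :=
      congrArg SetLike.coe (Submonoid.closure_eq ((traceRing n g).toSubmonoid.map M))
    have h2 : z ∈ Subalgebra.toSubmodule H := hz
    rwa [Algebra.adjoin_eq_span, h1] at h2
  have hT : ∀ z ∈ H, zᵀ ∈ H := fun z hz => by
    refine Submodule.span_induction (p := fun z _ => zᵀ ∈ H) ?_ ?_ ?_ ?_ (hspan z hz)
    · rintro _ ⟨h, hh, rfl⟩
      exact hMH _ (transpose_mem_traceRing hh)
    · rw [transpose_zero]; exact zero_mem _
    · exact fun x y _ _ hx hy => add_mem hx hy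
    · exact fun r x _ hx => H.smul_mem hx r
  have htr : ∀ z ∈ H, trace z ∈ D := fun z hz => by
    refine Submodule.span_induction (p := fun z _ => trace z ∈ D) ?_ ?_ ?_ ?_ (hspan z hz)
    · rintro _ ⟨h, hh, rfl⟩
      rw [hMtr]
      exact hD _ (trace_mem_centerAlg hh)
    · rw [trace_zero]; exact zero_mem _
    · exact fun x y _ _ hx hy => by rw [trace_add]; exact add_mem hx hy
    · exact fun r x _ hx => by rw [trace_smul]; exact D.smul_mem hx r
  have hDH : ∀ c ∈ D, c • (1 : Matrix (Fin n) (Fin n) _) ∈ H := fun c hc => by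
    refine Submodule.span_induction (p := fun c _ => c • (1 : Matrix (Fin n) (Fin n) _) ∈ H)
      ?_ ?_ ?_ ?_ (hDspan c hc)
    · rintro _ ⟨p, hp, rfl⟩
      rw [← hm, ← map_one M, ← hMs]
      exact hMH _ (mem_centerAlg.1 hp)
    · rw [zero_smul]; exact zero_mem _
    · exact fun x y _ _ hx hy => by rw [add_smul]; exact add_mem hx hy
    · exact fun r x _ hx => by rw [smul_assoc]; exact H.smul_mem hx r
  have hpos : ∀ s (hs : s ∈ traceRing n g), sᵀ = s →
      (∀ h (hh : h ∈ traceRing n g),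
        0 ≤ φ ⟨_, trace_mem_centerAlg (mul_mem (mul_mem hh hs) (transpose_mem_traceRing hh))⟩) →
      ∀ z (hz : z ∈ H), 0 ≤ Φ ⟨trace (z * M s * zᵀ),
        htr _ (H.mul_mem (H.mul_mem hz (hMH s hs)) (hT z hz))⟩ := by
    intro s hs hst hsp z hz
    obtain ⟨k, x, y, rfl⟩ := (Submodule.mem_span_set' (s := _)).1 (hspan z hz)
    choose h hh hy using fun i => (y i).2
    let G : Fin k → Fin k → R := fun i j => φ ⟨trace (h i * s * (h j)ᵀ),
      trace_mem_centerAlg (mul_mem (mul_mem (hh i) hs) (transpose_mem_traceRing (hh j)))⟩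
    have hG : 0 ≤ ∑ i, ∑ j, x i * x j * G i j := by
      refine gram_nonneg φ.toRingHom.range k G (fun i j => ⟨_, rfl⟩)
         (fun i j => ?_) (fun x hx => ?_) x
      · refine congrArg φ (Subtype.ext ?_)
        change trace (h i * s * (h j)ᵀ) = trace (h j * s * (h i)ᵀ)
        rw [← trace_transpose]
        simp only [transpose_mul, transpose_transpose, hst, mul_assoc]
      · choose c hc using hx
        have h1 := hsp (∑ i, (c i : PolyRing n g) • h i)
          (Subalgebra.sum_mem _ fun i _ => smul_mem_traceRing (c i).2 (hh i))
        convert h1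
        have h2 : ∀ i j, x i * x j * G i j = φ (c i * c j * ⟨trace (h i * s * (h j)ᵀ),
            trace_mem_centerAlg (mul_mem (mul_mem (hh i) hs)
              (transpose_mem_traceRing (hh j)))⟩) := fun i j => by
          rw [map_mul, map_mul, ← hc, ← hc]; rfl
        rw [Finset.sum_congr rfl fun i _ => Finset.sum_congr rfl fun j _ => h2 i j]
        simp only [← map_sum]
        refine congrArg φ (Subtype.ext ?_)
        simp only [transpose_sum, transpose_smul, Finset.sum_mul, Finset.mul_sum,
      trace_sum,
          smul_mul_assoc, mul_smul_comm, trace_smul, smul_eq_mul]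
        push_cast
        rw [Finset.sum_comm]
        simp only [mul_assoc, mul_left_comm]
    refine hG.trans_eq ?_
    have h2 : ∀ i j, x i * x j * G i j = Φ ((x i * x j) • ⟨_, hD _ (trace_mem_centerAlg
        (mul_mem (mul_mem (hh i) hs) (transpose_mem_traceRing (hh j))))⟩) := fun i j => by
      rw [map_smul, hΦ]; rfl
    simp only [h2, ← map_sum]
    refine congrArg Φ (Subtype.ext ?_)
    simp only [← hy, ← hMT, transpose_sum, transpose_smul, Finset.sum_mul, Finset.mul_sum,
      trace_sum,
      smul_mul_assoc, mul_smul_comm, trace_smul, ← map_mul, hMtr]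
    push_cast
    rw [Finset.sum_comm]
    simp only [Finset.smul_sum, smul_smul, mul_comm]
    rfl
  obtain ⟨ρ, hρT, hρtr, hρc, hρs⟩ := exists_rep_of_positive_trace hR D Φ H hT htr hDH
    (fun z hz => by
      have := hpos 1 (one_mem _) transpose_one (fun h hh => by simpa using hφ h hh) z hz
      simpa using this)
  let x : Fin g × Fin n × Fin n → R := fun v =>
    ρ ⟨M (genMat n g v.1), hMH _ (genMat_mem _)⟩ v.2.1 v.2.2
  let E : MatP n g →ₐ[ℝ] Matrix (Fin n) (Fin n) R := (MvPolynomial.aeval x).mapMatrix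
  have hgen : ∀ w ∈ genSet n g, ∃ hw : M w ∈ H, ρ ⟨M w, hw⟩ = E w := by
    have h1 : ∀ j, ρ ⟨M (genMat n g j), hMH _ (genMat_mem _)⟩ = E (genMat n g j) := fun j => by
      ext i k
      simp [E, x, genMat]
    rintro _ (⟨j, rfl⟩ | ⟨j, rfl⟩)
    · exact ⟨_, h1 j⟩
    · refine ⟨hT _ (hMH _ (genMat_mem j)), ?_⟩
      exact (hρT _ _).trans (congrArg transpose (h1 j))
  have hmul : ∀ a b : MatP n g, (∃ hw : M a ∈ H, ρ ⟨M a, hw⟩ = E a) →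
      (∃ hw : M b ∈ H, ρ ⟨M b, hw⟩ = E b) →
      ∃ hw : M (a * b) ∈ H, ρ ⟨M (a * b), hw⟩ = E (a * b) := by
    rintro a b ⟨ha, ha'⟩ ⟨hb, hb'⟩
    refine ⟨by rw [map_mul]; exact mul_mem ha hb, ?_⟩
    rw [map_mul E, ← ha', ← hb', ← map_mul ρ]
    exact congrArg ρ (Subtype.ext (map_mul M a b))
  have hone : ∃ hw : M 1 ∈ H, ρ ⟨M 1, hw⟩ = E 1 := by
    refine ⟨by rw [map_one]; exact one_mem _, ?_⟩
    rw [map_one E, ← map_one ρ]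
    exact congrArg ρ (Subtype.ext (map_one M))
  have hscal : ∀ c (hc : c ∈ centerAlg n g),
      ∃ hw : M (c • 1) ∈ H, ρ ⟨M (c • 1), hw⟩ = φ ⟨c, hc⟩ • 1 := by
    intro c hc
    refine ⟨hMH _ (mem_centerAlg.1 hc), ?_⟩
    rw [← hΦ c hc, ← hρc]
    exact congrArg ρ (Subtype.ext (by change M (c • 1) = m c • 1; rw [hMs, map_one]))
  have hall : ∀ h ∈ traceRing n g, ∃ hw : M h ∈ H, ρ ⟨M h, hw⟩ = E h := by
    intro h hh
    induction hh using Algebra.adjoin_induction with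
    | mem x hx =>
      rcases hx with hx | ⟨w, hw, rfl⟩
      · exact hgen x hx
      · have hw' : ∃ hw : M w ∈ H, ρ ⟨M w, hw⟩ = E w := by
          induction hw using Submonoid.closure_induction with
          | mem x hx => exact hgen x hx
          | one => exact hone
          | mul a b _ _ ha hb => exact hmul a b ha hb
        obtain ⟨h1, h2⟩ := hscal _ (trace_mem_centerAlg (closure_subset_traceRing hw))
        refine ⟨h1, h2.trans ?_⟩
        obtain ⟨h3, h4⟩ := hw'
        have h5 := hρtr _ h3
        rw [h4] at h5
        have h6 : φ ⟨_, trace_mem_centerAlg (closure_subset_traceRing hw)⟩ =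
            MvPolynomial.aeval x (trace w) := by
          rw [← hΦ]
          have h7 : Φ ⟨trace (M w), htr _ h3⟩ =
              Φ ⟨_, hD _ (trace_mem_centerAlg (closure_subset_traceRing hw))⟩ :=
            congrArg Φ (Subtype.ext (hMtr w))
          rw [← h7, ← h5]
          simp [trace, E]
        rw [h6]
        ext i j
        by_cases hij : i = j <;> simp [E, one_apply, hij]
    | algebraMap r =>
      obtain ⟨h1, h2⟩ := hscal _ ((centerAlg n g).algebraMap_mem r)
      have h3 : algebraMap ℝ (PolyRing n g) r • (1 : MatP n g) = algebraMap ℝ (MatP n g) r := by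
        rw [algebraMap_smul, Algebra.algebraMap_eq_smul_one]
      rw [← h3]
      refine ⟨h1, h2.trans ?_⟩
      rw [h3, AlgHom.commutes, Algebra.algebraMap_eq_smul_one (A := Matrix (Fin n) (Fin n) R)]
      refine Eq.trans ?_ (algebraMap_smul R r (1 : Matrix (Fin n) (Fin n) R))
      exact congrArg (· • (1 : Matrix (Fin n) (Fin n) R)) (φ.commutes r)
    | add a b _ _ ha hb =>
      obtain ⟨ha, ha'⟩ := ha
      obtain ⟨hb, hb'⟩ := hb
      refine ⟨by rw [map_add]; exact add_mem ha hb, ?_⟩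
      rw [map_add E, ← ha', ← hb', ← map_add ρ]
      exact congrArg ρ (Subtype.ext (map_add M a b))
    | mul a b _ _ ha hb => exact hmul a b ha hb
  refine ⟨x, fun c hc => ?_, fun s hs hst hsp => ?_⟩
  · obtain ⟨h1, h2⟩ := hscal c hc
    obtain ⟨h3, h4⟩ := hall _ (mem_centerAlg.1 hc)
    have := congrFun (congrFun (h4.symm.trans h2) ⟨0, hn⟩) ⟨0, hn⟩
    simpa [E] using this
  · obtain ⟨h3, h4⟩ := hall _ hs
    obtain ⟨L, hL⟩ := hρs _ h3 ((hMT s).symm.trans (congrArg M hst)) (hpos s hs hst hsp)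
    exact ⟨L, h4.symm.trans hL⟩
end

section
open Matrix

variable {n g : ℕ}

/-- Evaluation at a tuple of matrices, as an algebra homomorphism. -/
def evalHom (n g : ℕ) (X : Fin g → Matrix (Fin n) (Fin n) ℝ) :
    MatP n g →ₐ[ℝ] Matrix (Fin n) (Fin n) ℝ :=
  (MvPolynomial.aeval fun v : Fin g × Fin n × Fin n => X v.1 v.2.1 v.2.2).mapMatrix

theorem evalHom_transpose (X : Fin g → Matrix (Fin n) (Fin n) ℝ) (h : MatP n g) :
    evalHom n g X hᵀ = (evalHom n g X h)ᵀ := rfl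

theorem evalHom_smul_one (X : Fin g → Matrix (Fin n) (Fin n) ℝ) (p : PolyRing n g) :
    evalHom n g X (p • 1) = MvPolynomial.eval (fun v => X v.1 v.2.1 v.2.2) p • 1 := by
  ext i j
  by_cases hij : i = j <;> simp [evalHom, one_apply, hij, MvPolynomial.aeval_eq_eval]

theorem evalHom_genMat (X : Fin g → Matrix (Fin n) (Fin n) ℝ) (j : Fin g) :
    evalHom n g X (genMat n g j) = X j := by
  ext a b
  simp [evalHom, genMat]

theorem trace_evalHom (X : Fin g → Matrix (Fin n) (Fin n) ℝ) (h : MatP n g) :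
    trace (evalHom n g X h) = MvPolynomial.eval (fun v => X v.1 v.2.1 v.2.2) (trace h) := by
  simp [evalHom, trace, MvPolynomial.aeval_eq_eval]

theorem posSemidef_smul_one {r : ℝ} (hr : 0 ≤ r) :
    (r • (1 : Matrix (Fin n) (Fin n) ℝ)).PosSemidef := PosSemidef.one.smul hr

theorem nonneg_of_posSemidef_smul_one {r : ℝ} (hn : 0 < n)
    (hr : (r • (1 : Matrix (Fin n) (Fin n) ℝ)).PosSemidef) : 0 ≤ r := by
  simpa using hr.diag_nonneg (i := ⟨0, hn⟩)

/-- The elements of the trace ring that are positive semidefinite on `K_S`. -/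
def posSet (n g : ℕ) (S : Set (MatP n g)) : Set (MatP n g) :=
  {q | q ∈ traceRing n g ∧ qᵀ = q ∧ ∀ X ∈ KSet n g S, (evalHom n g X q).PosSemidef}

theorem isCyclicPreordering_posSet (hn : 0 < n) (S : Set (MatP n g)) :
    IsCyclicPreordering n g (posSet n g S) := by
  refine ⟨⟨fun q hq => ⟨hq.1, hq.2.1⟩, ⟨one_mem _, transpose_one, fun X _ => ?_⟩,
    fun a ha b hb => ⟨add_mem ha.1 hb.1, ?_, fun X hX => ?_⟩,
    fun h hh q hq => ⟨mul_mem (mul_mem hh hq.1) (transpose_mem_traceRing hh), ?_, fun X hX => ?_⟩,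
    fun q hq => ⟨trace_smul_one_mem hq.1, by simp, fun X hX => ?_⟩⟩, ?_⟩
  · rw [map_one]
    exact PosSemidef.one
  · rw [transpose_add, ha.2.1, hb.2.1]
  · rw [map_add]
    exact (ha.2.2 X hX).add (hb.2.2 X hX)
  · simp only [transpose_mul, transpose_transpose, hq.2.1, mul_assoc]
  · rw [map_mul, map_mul, evalHom_transpose, ← conjTranspose_eq_transpose_of_trivial]
    exact (hq.2.2 X hX).mul_mul_conjTranspose_same _
  · rw [evalHom_smul_one, ← trace_evalHom]
    exact posSemidef_smul_one (hq.2.2 X hX).trace_nonneg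
  · rintro _ ⟨ha, _, p, rfl⟩ _ ⟨hb, _, q, rfl⟩
    refine ⟨mul_mem ha.1 hb.1, by simp, fun X hX => ?_⟩
    have h1 := ha.2.2 X hX
    have h2 := hb.2.2 X hX
    rw [evalHom_smul_one] at h1 h2
    rw [map_mul, evalHom_smul_one, evalHom_smul_one, smul_mul_smul_comm, mul_one]
    exact posSemidef_smul_one (mul_nonneg (nonneg_of_posSemidef_smul_one hn h1)
      (nonneg_of_posSemidef_smul_one hn h2))

theorem subset_posSet {S : Set (MatP n g)} (hS : ∀ s ∈ S, s ∈ traceRing n g ∧ sᵀ = s) :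
    S ⊆ posSet n g S := fun s hs => ⟨(hS s hs).1, (hS s hs).2, fun _ hX => hX s hs⟩

theorem subset_TtrS (S : Set (MatP n g)) : S ⊆ TtrS n g S := fun _ hs _ _ hT => hT hs

theorem TtrS_subset_posSet (hn : 0 < n) {S : Set (MatP n g)}
    (hS : ∀ s ∈ S, s ∈ traceRing n g ∧ sᵀ = s) : TtrS n g S ⊆ posSet n g S :=
  fun _ ha => ha _ (isCyclicPreordering_posSet hn S) (subset_posSet hS)

theorem isCyclicPreordering_TtrS (hn : 0 < n) {S : Set (MatP n g)}
    (hS : ∀ s ∈ S, s ∈ traceRing n g ∧ sᵀ = s) : IsCyclicPreordering n g (TtrS n g S) :=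
  ⟨⟨fun _ hq => ⟨(TtrS_subset_posSet hn hS hq).1, (TtrS_subset_posSet hn hS hq).2.1⟩,
    fun _ hT _ => hT.1.2.1,
    fun a ha b hb T hT hST => hT.1.2.2.1 a (ha T hT hST) b (hb T hT hST),
    fun h hh q hq T hT hST => hT.1.2.2.2.1 h hh q (hq T hT hST),
    fun q hq T hT hST => hT.1.2.2.2.2 q (hq T hT hST)⟩,
    fun a ha b hb T hT hST => hT.2 a ⟨ha.1 T hT hST, ha.2⟩ b ⟨hb.1 T hT hST, hb.2⟩⟩

theorem isClosed_posSemidef : IsClosed {A : Matrix (Fin n) (Fin n) ℝ | A.PosSemidef} := by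
  have : {A : Matrix (Fin n) (Fin n) ℝ | A.PosSemidef} =
      {A | Aᵀ = A} ∩ ⋂ x : Fin n → ℝ, {A | 0 ≤ x ⬝ᵥ (A *ᵥ x)} := by
    ext A
    simp [posSemidef_iff_dotProduct_mulVec, IsHermitian]
  rw [this]
  refine (isClosed_eq (by fun_prop) (by fun_prop)).inter (isClosed_iInter fun x => ?_)
  exact isClosed_le continuous_const (by fun_prop)

theorem isClosed_KSet (S : Set (MatP n g)) : IsClosed (KSet n g S) := by
  have : KSet n g S = ⋂ s ∈ S, {X | (evalMat n g X s).PosSemidef} := by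
    ext X
    simp [KSet]
  rw [this]
  refine isClosed_biInter fun s _ => isClosed_posSemidef.preimage ?_
  refine continuous_matrix fun i j => ?_
  exact (MvPolynomial.continuous_eval (s i j)).comp (by fun_prop)

theorem isCompact_KSet_of_archimedean (hn : 0 < n) {S : Set (MatP n g)}
    (hS : ∀ s ∈ S, s ∈ traceRing n g ∧ sᵀ = s)
    (h : ∀ h ∈ traceRing n g, ∃ ρ : ℚ, 0 < ρ ∧
      (ρ : ℝ) • (1 : MatP n g) - h * hᵀ ∈ TtrS n g S) : IsCompact (KSet n g S) := by
  choose ρ hρ0 hρ using fun j => h _ (genMat_mem (n := n) (g := g) j)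
  have hcpt : IsCompact (Set.univ.pi fun j : Fin g => Set.univ.pi fun _ : Fin n =>
      Set.univ.pi fun _ : Fin n => Set.Icc (-((ρ j : ℝ) + 1)) ((ρ j : ℝ) + 1)) :=
    isCompact_univ_pi fun _ => isCompact_univ_pi fun _ => isCompact_univ_pi fun _ => isCompact_Icc
  refine hcpt.of_isClosed_subset (isClosed_KSet S)
    fun (X : Fin g → Matrix (Fin n) (Fin n) ℝ) hX j _ a _ b _ => ?_
  have h1 := ((TtrS_subset_posSet hn hS (hρ j)).2.2 X hX).diag_nonneg (i := a)
  rw [map_sub, map_smul, map_one, map_mul, evalHom_transpose, evalHom_genMat] at h1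
  have h2 : X j a b * X j a b ≤ ∑ k, X j a k * X j a k :=
    Finset.single_le_sum (f := fun k => X j a k * X j a k) (fun k _ => mul_self_nonneg _)
      (Finset.mem_univ b)
  simp [mul_apply] at h1
  have h3 : (0 : ℝ) < ρ j := by exact_mod_cast hρ0 j
  exact ⟨by nlinarith, by nlinarith⟩
end

section
open Matrix

variable {n g : ℕ}

/-- The central elements of `T`, as polynomials. -/
def centralPart (T : Set (MatP n g)) : Set (centerAlg n g) :=
  {c | (c : PolyRing n g) • (1 : MatP n g) ∈ T}

namespace IsCyclicPreordering

variable {T : Set (MatP n g)}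

theorem add_mem (hT : IsCyclicPreordering n g T) {a b : MatP n g} (ha : a ∈ T) (hb : b ∈ T) :
    a + b ∈ T := hT.1.2.2.1 a ha b hb

theorem trace_mem (hT : IsCyclicPreordering n g T) {a : MatP n g} (ha : a ∈ T)
    (h : trace a ∈ centerAlg n g) : ⟨trace a, h⟩ ∈ centralPart T := hT.1.2.2.2.2 a ha

theorem mul_transpose_mem (hT : IsCyclicPreordering n g T) {h : MatP n g}
    (hh : h ∈ traceRing n g) : h * hᵀ ∈ T := by
  simpa using hT.1.2.2.2.1 h hh 1 hT.1.2.1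

theorem centralPart_add (hT : IsCyclicPreordering n g T) (a : centerAlg n g)
    (ha : a ∈ centralPart T) (b : centerAlg n g) (hb : b ∈ centralPart T) :
    a + b ∈ centralPart T := by
  have := hT.add_mem ha hb
  rwa [← add_smul] at this

theorem centralPart_mul (hT : IsCyclicPreordering n g T) (a : centerAlg n g)
    (ha : a ∈ centralPart T) (b : centerAlg n g) (hb : b ∈ centralPart T) :
    a * b ∈ centralPart T := by
  have := hT.2 _ ⟨ha, mem_centerAlg.1 a.2, _, rfl⟩ _ ⟨hb, mem_centerAlg.1 b.2, _, rfl⟩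
  rwa [smul_mul_smul_comm, mul_one] at this

theorem centralPart_sq (hT : IsCyclicPreordering n g T) (a : centerAlg n g) :
    a * a ∈ centralPart T := by
  have := hT.mul_transpose_mem (mem_centerAlg.1 a.2)
  rwa [transpose_smul, transpose_one, smul_mul_smul_comm, mul_one] at this

/-- The Positivstellensatz for central elements positive on `K_S`. -/
theorem exists_mul_eq_one_add (hT : IsCyclicPreordering n g T) (hn : 0 < n)
    {S : Set (MatP n g)} (hfin : S.Finite) (hST : S ⊆ T) (f : centerAlg n g)
    (hf : ∀ X ∈ KSet n g S,
      0 < MvPolynomial.eval (fun v => X v.1 v.2.1 v.2.2) (f : PolyRing n g)) :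
    ∃ t₁ ∈ centralPart T, ∃ t₂ ∈ centralPart T, f * t₁ = 1 + t₂ := by
  classical
  by_contra! hcon
  have h0 : (0 : centerAlg n g) ∈ centralPart T := by simpa using hT.centralPart_sq 0
  have h1 : (1 : centerAlg n g) ∈ centralPart T := by simpa using hT.centralPart_sq 1
  have hpre : IsPreordering (centralPart T) :=
    ⟨hT.centralPart_add, hT.centralPart_mul, hT.centralPart_sq, fun h =>
      hcon 0 h0 _ h (by ring)⟩
  obtain ⟨R, _, _, _, φ, hR, hφ⟩ := (hpre.adjoin_mem_iff (-f) (by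
    rintro ⟨a, ha, b, hb, hab⟩
    exact hcon b hb a ha (by linear_combination hab))).exists_hom
  have hφT : ∀ a ∈ centralPart T, 0 ≤ φ a := fun a ha => hφ a ⟨a, ha, 0, h0, by ring⟩
  have hφf : 0 ≤ -φ f := by
    rw [← map_neg]
    exact hφ _ ⟨0, h0, 1, h1, by ring⟩
  letI : Algebra ℝ R := (φ.comp (algebraMap ℝ (centerAlg n g))).toAlgebra
  let φ' : centerAlg n g →ₐ[ℝ] R := { φ with commutes' := fun _ => rfl }
  obtain ⟨x, hx, hxs⟩ := exists_point_of_nonneg hR hn φ' fun h hh =>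
    hφT _ (hT.trace_mem (hT.mul_transpose_mem hh) _)
  choose L hL using fun s : S => hxs s (hT.1.1 s (hST s.2)).1 (hT.1.1 s (hST s.2)).2
    fun h hh => hφT _ (hT.trace_mem (hT.1.2.2.2.1 h hh s (hST s.2)) _)
  obtain ⟨y, -, hy⟩ := hR.polyIVT.exists_sqrt hφf
  have := hfin.fintype
  let σ := (Fin g × Fin n × Fin n) ⊕ (S × Fin n × Fin n) ⊕ Unit
  let P : S × Fin n × Fin n → MvPolynomial σ ℝ := fun v =>
    MvPolynomial.rename Sum.inl ((v.1 : MatP n g) v.2.1 v.2.2) -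
      ∑ k, MvPolynomial.X (Sum.inr (Sum.inl (v.1, v.2.1, k))) *
        MvPolynomial.X (Sum.inr (Sum.inl (v.1, v.2.2, k)))
  let P0 : MvPolynomial σ ℝ := MvPolynomial.rename Sum.inl (f : PolyRing n g) +
    MvPolynomial.X (Sum.inr (Sum.inr ())) * MvPolynomial.X (Sum.inr (Sum.inr ()))
  let w : σ → R := Sum.elim x (Sum.elim (fun v => L v.1 v.2.1 v.2.2) fun _ => y)
  have hw : w ∘ Sum.inl = x := rfl
  obtain ⟨z, hz⟩ := hR.polyIVT.solvesDown (algebraMap ℝ R) σ inferInstance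
    (insert P0 (Finset.univ.image P)) w (by
      intro q hq
      rcases Finset.mem_insert.1 hq with rfl | hq
      · have := hx f f.2
        rw [MvPolynomial.aeval_def] at this
        simp only [P0, MvPolynomial.eval₂_add, MvPolynomial.eval₂_mul, MvPolynomial.eval₂_X,
          MvPolynomial.eval₂_rename, hw, this]
        change _ + y * y = 0
        rw [hy]
        exact add_neg_cancel (φ f)
      · obtain ⟨v, -, rfl⟩ := Finset.mem_image.1 hq
        have := congrFun (congrFun (hL v.1) v.2.1) v.2.2
        simp only [map_apply, MvPolynomial.aeval_def, mul_apply, transpose_apply] at this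
        simp only [P, MvPolynomial.eval₂_sub, MvPolynomial.eval₂_sum, MvPolynomial.eval₂_mul,
          MvPolynomial.eval₂_X, MvPolynomial.eval₂_rename, hw, this]
        exact sub_self _)
  let X : Fin g → Matrix (Fin n) (Fin n) ℝ := fun j => of fun a b => z (Sum.inl (j, a, b))
  have hX : X ∈ KSet n g S := by
    intro s hs
    let M : Matrix (Fin n) (Fin n) ℝ := of fun a b => z (Sum.inr (Sum.inl (⟨s, hs⟩, a, b)))
    have : evalMat n g X s = M * Mᴴ := by
      ext a b
      have h2 := hz _ (Finset.mem_insert_of_mem (Finset.mem_image_of_mem P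
        (Finset.mem_univ (⟨s, hs⟩, a, b))))
      simp only [P, map_sub, map_sum, map_mul, MvPolynomial.eval_X, MvPolynomial.eval_rename,
        sub_eq_zero] at h2
      simp only [mul_apply, conjTranspose_apply, star_trivial]
      exact h2
    rw [this]
    exact posSemidef_self_mul_conjTranspose M
  have h2 := hz _ (Finset.mem_insert_self _ _)
  simp only [P0, map_add, map_mul, MvPolynomial.eval_X, MvPolynomial.eval_rename] at h2
  have h3 := hf X hX
  have h4 : MvPolynomial.eval (fun v => X v.1 v.2.1 v.2.2) (f : PolyRing n g) =
    MvPolynomial.eval (z ∘ Sum.inl) (f : PolyRing n g) := rfl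
  nlinarith [mul_self_nonneg (z (Sum.inr (Sum.inr ())))]

end IsCyclicPreordering
end

section
open Matrix

variable {n g : ℕ}

namespace IsCyclicQM

variable {Q : Set (MatP n g)}

theorem add_mem (hQ : IsCyclicQM n g Q) {a b : MatP n g} (ha : a ∈ Q) (hb : b ∈ Q) : a + b ∈ Q :=
  hQ.2.2.1 a ha b hb

theorem conj_mem (hQ : IsCyclicQM n g Q) {h q : MatP n g} (hh : h ∈ traceRing n g) (hq : q ∈ Q) :
    h * q * hᵀ ∈ Q := hQ.2.2.2.1 h hh q hq

theorem trace_mem (hQ : IsCyclicQM n g Q) {q : MatP n g} (hq : q ∈ Q) :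
    trace q • (1 : MatP n g) ∈ Q := hQ.2.2.2.2 q hq

theorem mul_transpose_mem (hQ : IsCyclicQM n g Q) {h : MatP n g} (hh : h ∈ traceRing n g) :
    h * hᵀ ∈ Q := by
  simpa using hQ.conj_mem hh hQ.2.1

theorem zero_mem (hQ : IsCyclicQM n g Q) : (0 : MatP n g) ∈ Q := by
  simpa using hQ.mul_transpose_mem ((traceRing n g).zero_mem)

theorem smul_mem (hQ : IsCyclicQM n g Q) {r : ℝ} (hr : 0 ≤ r) {q : MatP n g} (hq : q ∈ Q) :
    r • q ∈ Q := by
  have := hQ.conj_mem ((traceRing n g).smul_mem (one_mem _) (√r)) hq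
  simpa [smul_smul, Real.mul_self_sqrt hr] using this

theorem algebraMap_mem (hQ : IsCyclicQM n g Q) {r : ℝ} (hr : 0 ≤ r) :
    r • (1 : MatP n g) ∈ Q := hQ.smul_mem hr hQ.2.1

theorem sum_mem (hQ : IsCyclicQM n g Q) {ι : Type*} (s : Finset ι) (f : ι → MatP n g)
    (hf : ∀ i ∈ s, f i ∈ Q) : ∑ i ∈ s, f i ∈ Q :=
  Finset.sum_induction f (· ∈ Q) (fun _ _ => hQ.add_mem) hQ.zero_mem hf

theorem pow_mem (hQ : IsCyclicQM n g Q) {q : MatP n g} (hq : q ∈ Q) (k : ℕ) : q ^ k ∈ Q := by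
  obtain ⟨hqT, hqs⟩ := hQ.1 q hq
  rcases Nat.even_or_odd' k with ⟨j, rfl | rfl⟩
  · have := hQ.mul_transpose_mem ((traceRing n g).pow_mem hqT j)
    rwa [transpose_pow, hqs, ← pow_add, ← two_mul] at this
  · have := hQ.conj_mem ((traceRing n g).pow_mem hqT j) hq
    rwa [transpose_pow, hqs, ← pow_succ, ← pow_add, show j + 1 + j = 2 * j + 1 by ring] at this

/-- The element `h` of the trace ring is bounded with respect to `Q`. -/
def Bdd (Q : Set (MatP n g)) (h : MatP n g) : Prop :=
  h ∈ traceRing n g ∧ ∃ N : ℝ, 0 < N ∧ N • (1 : MatP n g) - h * hᵀ ∈ Q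

theorem Bdd.of_mem (hQ : IsCyclicQM n g Q) {h : MatP n g} (hh : h ∈ traceRing n g) {N : ℝ}
    (hN : N • (1 : MatP n g) - h * hᵀ ∈ Q) : Bdd Q h := by
  refine ⟨hh, max N 0 + 1, by positivity, ?_⟩
  have h1 := hQ.add_mem hN (hQ.algebraMap_mem (r := max N 0 + 1 - N)
    (by linarith [le_max_left N 0]))
  convert h1 using 1
  module

theorem Bdd.algebraMap (hQ : IsCyclicQM n g Q) (r : ℝ) : Bdd Q (r • (1 : MatP n g)) := by
  refine .of_mem hQ ((traceRing n g).smul_mem (one_mem _) r) (N := r * r) ?_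
  convert hQ.zero_mem using 1
  simp [smul_smul]

theorem Bdd.add (hQ : IsCyclicQM n g Q) {a b : MatP n g} (ha : Bdd Q a) (hb : Bdd Q b) :
    Bdd Q (a + b) := by
  obtain ⟨ha, N, hN, hNa⟩ := ha
  obtain ⟨hb, M, hM, hMb⟩ := hb
  refine .of_mem hQ ((traceRing n g).add_mem ha hb) (N := 2 * N + 2 * M) ?_
  have h1 := hQ.add_mem (hQ.smul_mem zero_le_two (hQ.add_mem hNa hMb))
    (hQ.mul_transpose_mem ((traceRing n g).sub_mem ha hb))
  convert h1 using 1
  simp only [transpose_add, transpose_sub, add_mul, mul_add, sub_mul, mul_sub]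
  module

theorem Bdd.mul (hQ : IsCyclicQM n g Q) {a b : MatP n g} (ha : Bdd Q a) (hb : Bdd Q b) :
    Bdd Q (a * b) := by
  obtain ⟨ha, N, hN, hNa⟩ := ha
  obtain ⟨hb, M, hM, hMb⟩ := hb
  refine .of_mem hQ ((traceRing n g).mul_mem ha hb) (N := N * M) ?_
  have h1 := hQ.add_mem (hQ.conj_mem ha hMb) (hQ.smul_mem hM.le hNa)
  convert h1 using 1
  simp only [transpose_mul, mul_sub, sub_mul, mul_smul_comm, smul_mul_assoc, mul_one, mul_assoc]
  module

theorem Bdd.transpose (hQ : IsCyclicQM n g Q) {a : MatP n g} (ha : Bdd Q a) : Bdd Q aᵀ := by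
  obtain ⟨ha, N, hN, hNa⟩ := ha
  have hT := transpose_mem_traceRing ha
  refine .of_mem hQ hT (N := N) ?_
  have h1 := hQ.conj_mem hT hNa
  have h2 := hQ.mul_transpose_mem
    ((traceRing n g).sub_mem ((traceRing n g).smul_mem (one_mem _) N)
      ((traceRing n g).mul_mem hT ha))
  have h3 := hQ.smul_mem (inv_nonneg.2 hN.le) (hQ.add_mem h1 h2)
  convert h3 using 1
  simp only [transpose_sub, transpose_mul, transpose_smul, transpose_one, transpose_transpose,
    mul_sub, sub_mul, mul_smul_comm, smul_mul_assoc, mul_one, one_mul, mul_assoc, smul_add,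
    smul_sub, smul_smul, inv_mul_cancel₀ hN.ne', one_smul]
  have : N⁻¹ * (N * N) = N := by field_simp
  simp only [this]
  module

theorem Bdd.trace (hQ : IsCyclicQM n g Q) (hn : 0 < n) {a : MatP n g} (ha : Bdd Q a) :
    Bdd Q (trace a • 1) := by
  obtain ⟨ha, N, hN, hNa⟩ := ha
  have hn' : (n : ℝ) ≠ 0 := by positivity
  refine .of_mem hQ (trace_smul_one_mem ha) (N := n * n * N) ?_
  have h1 := hQ.trace_mem hNa
  have h2 := hQ.trace_mem (hQ.mul_transpose_mem
    ((traceRing n g).sub_mem ha ((traceRing n g).smul_mem (trace_smul_one_mem ha) (n : ℝ)⁻¹)))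
  have h3 := hQ.smul_mem (Nat.cast_nonneg n) (hQ.add_mem h1 h2)
  convert h3 using 1
  have e : ∀ r : ℝ, ∀ m : PolyRing n g, r • m = MvPolynomial.C r * m := fun r m =>
    (MvPolynomial.C_mul' ).symm
  have e1 : (MvPolynomial.C (n : ℝ) : PolyRing n g) * MvPolynomial.C ((n : ℝ)⁻¹) = 1 := by
    rw [← map_mul, mul_inv_cancel₀ hn', map_one]
  have e2 : (n : PolyRing n g) = MvPolynomial.C (n : ℝ) := (map_natCast _ n).symm
  have e3 : ∀ (r : ℝ) (p : PolyRing n g), r • p • (1 : MatP n g) = (r • p) • (1 : MatP n g) :=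
    fun r p => (smul_assoc r p _).symm
  have e4 : ∀ (r : ℝ), r • (1 : MatP n g) = (MvPolynomial.C r : PolyRing n g) • (1 : MatP n g) :=
    fun r => by rw [← mul_one (MvPolynomial.C r), ← e, smul_assoc, one_smul]
  simp only [transpose_sub, transpose_smul, transpose_one, mul_sub, sub_mul, trace_sub,
    mul_smul_comm, smul_mul_assoc, mul_one, one_mul, trace_smul, trace_transpose, trace_one,
    Fintype.card_fin, e3, e4, smul_smul, ← add_smul, ← sub_smul, smul_eq_mul, e, e2, map_mul]
  congr 1
  set c := MvPolynomial.C (n : ℝ)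
  set d := MvPolynomial.C (n : ℝ)⁻¹
  linear_combination (-(Matrix.trace a) ^ 2 * (c * d - 1)) * e1

theorem Bdd.of_symm (hQ : IsCyclicQM n g Q) {q : MatP n g} {N : ℝ} (hN : 0 < N)
    (h1 : N • (1 : MatP n g) - q ∈ Q) (h2 : N • (1 : MatP n g) + q ∈ Q) : Bdd Q q := by
  obtain ⟨h3, h4⟩ := hQ.1 _ h1
  obtain ⟨h5, h6⟩ := hQ.1 _ h2
  have hN1 : N • (1 : MatP n g) ∈ traceRing n g := (traceRing n g).smul_mem (one_mem _) N
  have hq : q ∈ traceRing n g := by simpa using (traceRing n g).sub_mem h5 hN1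
  have hqs : qᵀ = q := by simpa using h6
  refine .of_mem hQ hq (N := N * N) ?_
  have h7 := hQ.smul_mem (inv_nonneg.2 (mul_nonneg zero_le_two hN.le))
    (hQ.add_mem (hQ.conj_mem h3 h2) (hQ.conj_mem h5 h1))
  convert h7 using 1
  simp only [h4, h6, hqs, mul_sub, sub_mul, mul_add, add_mul, mul_smul_comm, smul_mul_assoc,
    mul_one, one_mul, mul_assoc, smul_add, smul_sub, smul_smul]
  match_scalars <;> field_simp <;> ring

end IsCyclicQM
end

section
open Matrix

variable {n g : ℕ}

namespace IsCyclicQM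

variable {Q : Set (MatP n g)}

theorem exists_pow_le_succ (hQ : IsCyclicQM n g Q) {q : MatP n g} (hq : q ∈ Q) {ε : ℝ}
    (hε : 0 < ε) (k : ℕ) : ∃ C : ℝ, ε • q ^ (k + 1) + C • 1 - q ^ k ∈ Q := by
  induction k with
  | zero => exact ⟨1, by simpa using hQ.smul_mem hε.le hq⟩
  | succ k ih =>
    obtain ⟨C, hC⟩ := ih
    obtain ⟨hqT, hqs⟩ := hQ.1 q hq
    have h1 := hQ.conj_mem ((traceRing n g).sub_mem hqT
      ((traceRing n g).smul_mem (one_mem _) ε⁻¹)) (hQ.pow_mem hq k)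
    have h2 := hQ.add_mem (hQ.smul_mem hε.le h1) (hQ.smul_mem (inv_nonneg.2 hε.le) hC)
    refine ⟨ε⁻¹ * C, ?_⟩
    convert h2 using 1
    have e1 : q * q ^ k = q ^ (k + 1) := (pow_succ' q k).symm
    have e2 : q ^ k * q = q ^ (k + 1) := (pow_succ q k).symm
    have e3 : q ^ (k + 1) * q = q ^ (k + 1 + 1) := (pow_succ q (k + 1)).symm
    simp only [transpose_sub, transpose_smul, transpose_one, hqs, sub_mul, mul_sub,
      smul_mul_assoc, mul_smul_comm, one_mul, mul_one, e1, e2, e3, smul_sub, smul_add, smul_smul,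
      mul_inv_cancel₀ hε.ne', inv_mul_cancel₀ hε.ne', one_smul]
    match_scalars <;> field_simp <;> ring

theorem exists_pow_le_pow (hQ : IsCyclicQM n g Q) {q : MatP n g} (hq : q ∈ Q) {k l : ℕ}
    (hkl : k < l) {ε : ℝ} (hε : 0 < ε) : ∃ C : ℝ, ε • q ^ l + C • 1 - q ^ k ∈ Q := by
  induction l, hkl using Nat.le_induction generalizing ε with
  | base => exact hQ.exists_pow_le_succ hq hε k
  | succ l _ ih =>
    obtain ⟨C, hC⟩ := ih one_pos
    obtain ⟨D, hD⟩ := hQ.exists_pow_le_succ hq hε l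
    refine ⟨C + D, ?_⟩
    convert hQ.add_mem hC hD using 1
    module

theorem exists_sum_mul_transpose_le (hQ : IsCyclicQM n g Q) {q : MatP n g} (hq : q ∈ Q)
    (c : ℕ → PolyRing n g) (m l : ℕ) (hm : m ≤ l) (hc : ∀ k < m, Bdd Q (c k • 1)) {ε : ℝ}
    (hε : 0 < ε) : ∃ C : ℝ, ε • q ^ (2 * l) + C • 1 -
      (∑ k ∈ Finset.range m, c k • q ^ k) * (∑ k ∈ Finset.range m, c k • q ^ k)ᵀ ∈ Q := by
  obtain ⟨hqT, hqs⟩ := hQ.1 q hq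
  have hcT : ∀ k < m, c k • q ^ k ∈ traceRing n g := fun k hk =>
    smul_mem_traceRing (mem_centerAlg.2 (hc k hk).1) ((traceRing n g).pow_mem hqT k)
  induction m generalizing ε with
  | zero => exact ⟨0, by simpa using hQ.smul_mem hε.le (hQ.pow_mem hq (2 * l))⟩
  | succ m ih =>
    obtain ⟨C, hC⟩ := ih (by omega) (fun k hk => hc k (by omega)) (ε := ε / 4) (by positivity)
      (fun k hk => hcT k (by omega))
    obtain ⟨-, N, hN, hNc⟩ := hc m (by omega)
    obtain ⟨D, hD⟩ := hQ.exists_pow_le_pow hq (show 2 * m < 2 * l by omega) (ε := ε / (4 * N))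
      (by positivity)
    have hs : ∑ k ∈ Finset.range m, c k • q ^ k ∈ traceRing n g :=
      (traceRing n g).sum_mem fun k hk => hcT k ((Finset.mem_range.1 hk).trans m.lt_succ_self)
    rw [Finset.sum_range_succ]
    set s := ∑ k ∈ Finset.range m, c k • q ^ k
    have h1 := hQ.mul_transpose_mem ((traceRing n g).sub_mem hs (hcT m m.lt_succ_self))
    have h2 : N • q ^ (2 * m) - c m • q ^ m * (c m • q ^ m)ᵀ ∈ Q := by
      convert hQ.conj_mem ((traceRing n g).pow_mem hqT m) hNc using 1
      simp only [transpose_smul, transpose_pow, transpose_one, hqs, sub_mul, mul_sub,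
        smul_mul_assoc, mul_smul_comm, mul_one, two_mul m, pow_add]
    generalize c m • q ^ m = t at h1 h2 ⊢
    have h3 := hQ.add_mem h1 (hQ.smul_mem zero_le_two
      (hQ.add_mem hC (hQ.add_mem h2 (hQ.smul_mem hN.le hD))))
    refine ⟨2 * C + 2 * N * D, ?_⟩
    convert h3 using 1
    simp only [transpose_sub, transpose_add, sub_mul, mul_sub, add_mul, mul_add]
    match_scalars <;> field_simp <;> ring

theorem exists_sub_mem_of_charpoly (hQ : IsCyclicQM n g Q) (hn : 0 < n) {q : MatP n g}
    (hq : q ∈ Q) (hc : ∀ k < n, Bdd Q (q.charpoly.coeff k • 1)) :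
    ∃ N : ℝ, N • 1 - q ∈ Q := by
  obtain ⟨hqT, hqs⟩ := hQ.1 q hq
  obtain ⟨C, hC⟩ := hQ.exists_sum_mul_transpose_le hq q.charpoly.coeff n n le_rfl hc
    (ε := 1 / 2) (by norm_num)
  obtain ⟨D, hD⟩ := hQ.exists_pow_le_pow hq (show 1 < 2 * n by omega) (ε := 1 / 2) (by norm_num)
  have e := pow_card_eq_neg_sum q
  rw [Fintype.card_fin, eq_neg_iff_add_eq_zero, add_comm, ← eq_neg_iff_add_eq_zero] at e
  rw [e, transpose_neg, neg_mul_neg, transpose_pow, hqs, ← pow_add, ← two_mul] at hC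
  refine ⟨C + D, ?_⟩
  convert hQ.add_mem hC hD using 1
  rw [pow_one]
  module

/-- The polynomials whose scalar matrices are bounded. -/
def bddCenter (hQ : IsCyclicQM n g Q) : Subalgebra ℝ (PolyRing n g) where
  carrier := {p | Bdd Q (p • 1)}
  add_mem' ha hb := by
    have := Bdd.add hQ ha hb
    rwa [← add_smul] at this
  mul_mem' ha hb := by
    have := Bdd.mul hQ ha hb
    rwa [smul_mul_smul_comm, mul_one] at this
  algebraMap_mem' r := by
    have := Bdd.algebraMap hQ r
    rwa [← algebraMap_smul (PolyRing n g) r] at this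

theorem exists_sub_mem_of_trace_pow (hQ : IsCyclicQM n g Q) (hn : 0 < n) {q : MatP n g}
    (hq : q ∈ Q) (ht : ∀ k < n, Bdd Q (trace (q ^ (k + 1)) • 1)) : ∃ N : ℝ, N • 1 - q ∈ Q := by
  refine hQ.exists_sub_mem_of_charpoly hn hq fun k hk => ?_
  change q.charpoly.coeff k ∈ hQ.bddCenter
  rw [charpoly_coeff_eq_detOneAdd q (by simpa using hk.le), Fintype.card_fin]
  refine (isNewton_detOneAdd (-q)).mem _ _ fun i hi => ?_
  have ht' : trace (q ^ (i + 1)) ∈ hQ.bddCenter := ht i (by omega)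
  rw [neg_pow]
  rcases neg_one_pow_eq_or (MatP n g) (i + 1) with h | h <;> rw [h]
  · simpa using ht'
  · simpa using ht'

theorem bdd_of_genMat (hQ : IsCyclicQM n g Q) (hn : 0 < n) (h : ∀ j, Bdd Q (genMat n g j))
    {a : MatP n g} (ha : a ∈ traceRing n g) : Bdd Q a := by
  have h1 : ∀ x ∈ genSet n g, Bdd Q x := by
    rintro x (⟨j, rfl⟩ | ⟨j, rfl⟩)
    · exact h j
    · exact (h j).transpose hQ
  have hone : Bdd Q 1 := by simpa using Bdd.algebraMap hQ (1 : ℝ)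
  have h2 : ∀ w ∈ Submonoid.closure (genSet n g), Bdd Q w := fun w hw =>
    Submonoid.closure_induction (fun x hx => h1 x hx) hone (fun _ _ _ _ => Bdd.mul hQ) hw
  induction ha using Algebra.adjoin_induction with
  | mem x hx =>
    rcases hx with hx | ⟨w, hw, rfl⟩
    · exact h1 x hx
    · exact (h2 w hw).trace hQ hn
  | algebraMap r => exact Algebra.algebraMap_eq_smul_one (A := MatP n g) r ▸ Bdd.algebraMap hQ r
  | add x y _ _ hx hy => exact hx.add hQ hy
  | mul x y _ _ hx hy => exact hx.mul hQ hy

end IsCyclicQM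

/-- The sum of the traces of the powers of the `Ξ_j Ξ_jᵀ` up to the `n`-th. -/
def tracePowSum (n g : ℕ) : PolyRing n g :=
  ∑ j : Fin g, ∑ k ∈ Finset.range n, trace ((genMat n g j * (genMat n g j)ᵀ) ^ (k + 1))

namespace IsCyclicQM

variable {Q : Set (MatP n g)}

theorem genMat_mul_transpose_mem (hQ : IsCyclicQM n g Q) (j : Fin g) :
    genMat n g j * (genMat n g j)ᵀ ∈ Q :=
  hQ.mul_transpose_mem (genMat_mem j)

theorem tracePowSum_smul_one_mem (hQ : IsCyclicQM n g Q) : tracePowSum n g • 1 ∈ Q := by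
  simp only [tracePowSum, Finset.sum_smul]
  exact hQ.sum_mem _ _ fun j _ => hQ.sum_mem _ _ fun k _ =>
    hQ.trace_mem (hQ.pow_mem (hQ.genMat_mul_transpose_mem j) _)

theorem bdd_of_tracePowSum (hQ : IsCyclicQM n g Q) (hn : 0 < n) {ρ : ℝ}
    (h : ρ • 1 - tracePowSum n g • 1 ∈ Q) {a : MatP n g} (ha : a ∈ traceRing n g) :
    Bdd Q a := by
  refine hQ.bdd_of_genMat hn (fun j => ?_) ha
  set q : Fin g → MatP n g := fun j => genMat n g j * (genMat n g j)ᵀ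
  have hq : ∀ j k, trace (q j ^ k) • (1 : MatP n g) ∈ Q := fun j k =>
    hQ.trace_mem (hQ.pow_mem (hQ.genMat_mul_transpose_mem j) k)
  obtain ⟨N, hN⟩ := hQ.exists_sub_mem_of_trace_pow hn (hQ.genMat_mul_transpose_mem j)
    fun k hk => by
      have h1 : tracePowSum n g • (1 : MatP n g) - trace (q j ^ (k + 1)) • 1 ∈ Q := by
        simp only [tracePowSum, Finset.sum_smul]
        rw [← Finset.add_sum_erase _ _ (Finset.mem_univ j),
          ← Finset.add_sum_erase _ _ (Finset.mem_range.2 hk), add_assoc, add_sub_cancel_left]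
        exact hQ.add_mem (hQ.sum_mem _ _ fun i _ => hq j _)
          (hQ.sum_mem _ _ fun i _ => hQ.sum_mem _ _ fun l _ => hq i _)
      refine Bdd.of_symm hQ (N := max ρ 1) (by positivity) ?_
        (hQ.add_mem (hQ.algebraMap_mem (by positivity)) (hq j _))
      convert hQ.add_mem (hQ.add_mem h h1)
        (hQ.algebraMap_mem (sub_nonneg.2 (le_max_left ρ 1))) using 1
      module
  exact .of_mem hQ (genMat_mem j) hN

end IsCyclicQM
end

section
open Matrix

variable {n g : ℕ}

/-- Wörmann's identity: a bound in the quadratic module `P + f P` with `f = ρ - σ` yields a bound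
on `σ` in the preordering `P`. -/
theorem exists_algebraMap_sub_mem {A : Type*} [CommRing A] [Algebra ℝ A] {P : Set A}
    (hadd : ∀ a ∈ P, ∀ b ∈ P, a + b ∈ P) (hmul : ∀ a ∈ P, ∀ b ∈ P, a * b ∈ P)
    (hsq : ∀ a, a * a ∈ P) {ρ M : ℝ} (hρ : 0 ≤ ρ) {σ t₁ t₂ a b : A} (hσ : σ ∈ P) (ht₁ : t₁ ∈ P)
    (ht₂ : t₂ ∈ P) (ha : a ∈ P) (hb : b ∈ P) (h : (algebraMap ℝ A ρ - σ) * t₁ = 1 + t₂)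
    (hM : algebraMap ℝ A M - t₂ = a + (algebraMap ℝ A ρ - σ) * b) :
    ∃ N : ℝ, algebraMap ℝ A N - σ ∈ P := by
  have h1 : (1 : A) ∈ P := by simpa using hsq 1
  have hρP : algebraMap ℝ A ρ ∈ P := by
    have := hsq (algebraMap ℝ A √ρ)
    rwa [← map_mul, Real.mul_self_sqrt hρ] at this
  set f := algebraMap ℝ A ρ - σ with hf
  clear_value f
  have h2 := hmul _ ht₁ _ (hsq f)
  have h3 := hadd _ (hadd _ (hmul _ (hadd _ h1 _ ht₂) _ ha) _ (hmul _ h2 _ hb)) _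
    (hsq (algebraMap ℝ A (M / 2) - t₂))
  have h5 := hadd _ (hadd _ h2 _ (hmul _ ht₂ _ hσ)) _ (hmul _ hρP _ h3)
  refine ⟨ρ * (1 + (M + M / 2 * (M / 2))), ?_⟩
  convert h5 using 1
  simp only [map_mul, map_add, map_one]
  have e3 : algebraMap ℝ A (M / 2) * 2 = algebraMap ℝ A M := by
    rw [← map_ofNat (algebraMap ℝ A) 2, ← map_mul]
    congr 1
    ring
  generalize algebraMap ℝ A (M / 2) = m at *
  rw [← e3] at hM ⊢
  generalize algebraMap ℝ A ρ = r at *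
  linear_combination (-f) * h - r * f * b * h + r * (1 + t₂) * hM - (1 + t₂) * hf

namespace IsCyclicPreordering

variable {T : Set (MatP n g)}

theorem isCyclicQM_adjoin (hT : IsCyclicPreordering n g T) (f : centerAlg n g) :
    IsCyclicQM n g {x | ∃ a ∈ T, ∃ b ∈ T, x = a + (f : PolyRing n g) • b} := by
  have h0 : (0 : MatP n g) ∈ T := hT.1.zero_mem
  refine ⟨?_, ⟨1, hT.1.2.1, 0, h0, by simp⟩, ?_, ?_, ?_⟩
  · rintro _ ⟨a, ha, b, hb, rfl⟩
    obtain ⟨ha1, ha2⟩ := hT.1.1 a ha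
    obtain ⟨hb1, hb2⟩ := hT.1.1 b hb
    exact ⟨(traceRing n g).add_mem ha1 (smul_mem_traceRing f.2 hb1),
      by rw [transpose_add, transpose_smul, ha2, hb2]⟩
  · rintro _ ⟨a, ha, b, hb, rfl⟩ _ ⟨c, hc, d, hd, rfl⟩
    refine ⟨a + c, hT.1.add_mem ha hc, b + d, hT.1.add_mem hb hd, ?_⟩
    rw [smul_add]
    abel
  · rintro h hh _ ⟨a, ha, b, hb, rfl⟩
    exact ⟨_, hT.1.conj_mem hh ha, _, hT.1.conj_mem hh hb,
      by rw [mul_add, add_mul, mul_smul_comm, smul_mul_assoc]⟩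
  · rintro _ ⟨a, ha, b, hb, rfl⟩
    exact ⟨_, hT.1.trace_mem ha, _, hT.1.trace_mem hb,
      by rw [trace_add, trace_smul, add_smul, smul_assoc]⟩

theorem tracePowSum_mem_centerAlg (n g : ℕ) : tracePowSum n g ∈ centerAlg n g :=
  (centerAlg n g).sum_mem fun j _ => (centerAlg n g).sum_mem fun k _ =>
    trace_mem_centerAlg ((traceRing n g).pow_mem ((traceRing n g).mul_mem (genMat_mem j)
      (transpose_mem_traceRing (genMat_mem j))) _)

theorem exists_sub_tracePowSum_mem (hT : IsCyclicPreordering n g T) (hn : 0 < n)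
    {S : Set (MatP n g)} (hfin : S.Finite) (hST : S ⊆ T) (hK : IsCompact (KSet n g S)) :
    ∃ N : ℝ, N • 1 - tracePowSum n g • 1 ∈ T := by
  obtain ⟨c, hc⟩ := (hK.image (f := fun X => MvPolynomial.eval (fun v => X v.1 v.2.1 v.2.2)
    (tracePowSum n g)) ((MvPolynomial.continuous_eval _).comp (by fun_prop))).bddAbove
  set ρ := max c 0 + 1
  set σ : centerAlg n g := ⟨tracePowSum n g, tracePowSum_mem_centerAlg n g⟩
  set f : centerAlg n g := algebraMap ℝ _ ρ - σ
  have hsmul : ∀ r : ℝ, (MvPolynomial.C r : PolyRing n g) • (1 : MatP n g) = r • 1 := fun r => by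
    rw [← MvPolynomial.algebraMap_eq, algebraMap_smul]
  have hfc : (f : PolyRing n g) = MvPolynomial.C ρ - tracePowSum n g := rfl
  obtain ⟨t₁, ht₁, t₂, ht₂, ht⟩ := hT.exists_mul_eq_one_add hn hfin hST f fun X hX => by
    have h1 := hc (Set.mem_image_of_mem _ hX)
    rw [hfc, map_sub, MvPolynomial.eval_C, sub_pos]
    exact h1.trans_lt ((le_max_left c 0).trans_lt (lt_add_one _))
  have hQ := hT.isCyclicQM_adjoin f
  obtain ⟨-, N, hN, hNt⟩ := hQ.bdd_of_tracePowSum hn (ρ := ρ)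
    ⟨0, hT.1.zero_mem, 1, hT.1.2.1, by rw [hfc, sub_smul, hsmul, zero_add]⟩ (mem_centerAlg.1 t₂.2)
  obtain ⟨a, ha, b, hb, hab⟩ := hQ.smul_mem (by positivity : (0 : ℝ) ≤ 2⁻¹ * (n : ℝ)⁻¹)
    (hQ.add_mem hNt
      (hQ.mul_transpose_mem ((traceRing n g).sub_mem (one_mem _) (mem_centerAlg.1 t₂.2))))
  have haC := trace_mem_centerAlg (hT.1.1 a ha).1
  have hbC := trace_mem_centerAlg (hT.1.1 b hb).1
  have hM : algebraMap ℝ (centerAlg n g) ((N + 1) / 2) - t₂ = ⟨_, haC⟩ + f * ⟨_, hbC⟩ := by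
    apply Subtype.ext
    have h1 := congrArg trace hab
    have h2 : (n : PolyRing n g) * MvPolynomial.C (n : ℝ)⁻¹ = 1 := by
      rw [← map_natCast MvPolynomial.C, ← map_mul, mul_inv_cancel₀ (by positivity), map_one]
    have h3 : (2 : PolyRing n g) * MvPolynomial.C 2⁻¹ = 1 := by
      rw [← map_ofNat MvPolynomial.C 2, ← map_mul, mul_inv_cancel₀ two_ne_zero, map_one]
    have h4 : (MvPolynomial.C ((N + 1) / 2) : PolyRing n g) =
        (MvPolynomial.C N + 1) * MvPolynomial.C 2⁻¹ := by
      rw [div_eq_mul_inv, map_mul, map_add, map_one]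
    have h5 : (algebraMap ℝ (centerAlg n g) ((N + 1) / 2) : PolyRing n g) =
      MvPolynomial.C ((N + 1) / 2) := rfl
    change (algebraMap ℝ (centerAlg n g) ((N + 1) / 2) : PolyRing n g) - t₂ =
      trace a + f * trace b
    simp only [transpose_sub, transpose_smul, transpose_one, ← hsmul, trace_smul, trace_add,
      trace_sub, trace_one, mul_sub, sub_mul, smul_mul_assoc, mul_smul_comm, mul_one, one_mul,
      Fintype.card_fin, smul_eq_mul, MvPolynomial.smul_eq_C_mul, map_mul] at h1
    rw [h5, h4]
    linear_combination h1 + (2 * MvPolynomial.C 2⁻¹ * (t₂ : PolyRing n g) -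
      MvPolynomial.C N * MvPolynomial.C 2⁻¹ -
      MvPolynomial.C 2⁻¹) * h2 + (t₂ : PolyRing n g) * h3
  obtain ⟨M, hM⟩ := exists_algebraMap_sub_mem hT.centralPart_add hT.centralPart_mul
    hT.centralPart_sq (by positivity : 0 ≤ ρ) (σ := σ) hT.1.tracePowSum_smul_one_mem ht₁ ht₂
    (hT.trace_mem ha haC) (hT.trace_mem hb hbC) ht hM
  refine ⟨M, ?_⟩
  have h1 : (MvPolynomial.C M - tracePowSum n g) • (1 : MatP n g) ∈ T := hM
  rwa [sub_smul, hsmul] at h1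

end IsCyclicPreordering
end

/-- T_S^tr is archimedean iff K_S is compact. -/
theorem stmt15 (n g : ℕ) (hn : 0 < n) (hg : 0 < g)
    (S : Set (MatP n g)) (hSfin : S.Finite)
    (hS : ∀ s ∈ S, s ∈ traceRing n g ∧ sᵀ = s) :
    (∀ h ∈ traceRing n g, ∃ ρ : ℚ, 0 < ρ ∧
        (ρ : ℝ) • (1 : MatP n g) - h * hᵀ ∈ TtrS n g S) ↔
      IsCompact (KSet n g S) := by
  refine ⟨isCompact_KSet_of_archimedean hn hS, fun hK h hh => ?_⟩
  have hT := isCyclicPreordering_TtrS hn hS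
  obtain ⟨ρ, hρ⟩ := hT.exists_sub_tracePowSum_mem hn hSfin (subset_TtrS S) hK
  obtain ⟨-, N, hN, hNh⟩ := hT.1.bdd_of_tracePowSum hn hρ hh
  obtain ⟨r, hr⟩ := exists_rat_gt N
  refine ⟨r, by exact_mod_cast hN.trans hr, ?_⟩
  convert hT.1.add_mem hNh (hT.1.algebraMap_mem (sub_nonneg.2 hr.le)) using 1
  module
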